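/- There exist an absolute constant c > 0 and, for each m ∈ ℕ, a constant c(m) > 0 such that the following holds. Let d, m ∈ ℕ, let F ∈ 𝔉_d^s, and let (μ, ν) be a random vector with non-negative integer coordinates. Define G = ∑_{k≥0} P{μ = k} · F^k and H = ∑_{k≥0} P{ν = k} · F^k. Then ρ_m(G, H) ≤ E min{ c·m/√(ν+1) + c(m)·|μ−ν|/(ν+1), 1 }. (In particular, ρ_m(G,H) is bounded by the infimum of this expectation over all joint distributions of (μ,ν) with the given marginals.) -/

import Mathlib

open MeasureTheory RealInnerProductSpace
open scoped ENNReal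

noncomputable section

abbrev Euc (d : ℕ) := EuclideanSpace ℝ (Fin d)

/-- Convolution of two measures on an additive structure. -/
def mconv {α : Type*} [MeasurableSpace α] [Add α] (μ ν : Measure α) : Measure α :=
  (μ.prod ν).map (fun p => p.1 + p.2)

/-- Convolution power `μ^{*n}`, with `μ^{*0}` the Dirac measure at `0`. -/
def convPow {α : Type*} [MeasurableSpace α] [AddMonoid α] (μ : Measure α) : ℕ → Measure α
  | 0 => Measure.dirac 0
  | n + 1 => mconv (convPow μ n) μ

/-- Convolution product of a finite family of measures. -/
def convProd {α : Type*} [MeasurableSpace α] [AddMonoid α] :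
    ∀ {n : ℕ}, (Fin n → Measure α) → Measure α
  | 0, _ => Measure.dirac 0
  | n + 1, G => mconv (convProd (fun i : Fin n => G i.castSucc)) (G (Fin.last n))

/-- The compound Poisson measure `e(a·μ) = e^{-a} ∑_k a^k μ^{*k}/k!`. -/
def cpois {α : Type*} [MeasurableSpace α] [AddMonoid α] (a : ℝ) (μ : Measure α) : Measure α :=
  Measure.sum fun k : ℕ =>
    (ENNReal.ofReal (Real.exp (-a) * a ^ k / k.factorial)) • convPow μ k

/-- A measure is symmetric if it is invariant under `x ↦ -x`. -/
def IsSymmMeasure {d : ℕ} (μ : Measure (Euc d)) : Prop :=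
  μ.map (fun x => -x) = μ

/-- Characteristic function of a measure on `ℝ^d`. -/
def charFn {d : ℕ} (μ : Measure (Euc d)) (t : Euc d) : ℂ :=
  ∫ x, Complex.exp ((⟪t, x⟫ : ℂ) * Complex.I) ∂μ

/-- Characteristic function of a measure on `ℝ`. -/
def charFn1 (μ : Measure ℝ) (t : ℝ) : ℂ :=
  ∫ x, Complex.exp (((t * x : ℝ) : ℂ) * Complex.I) ∂μ

/-- Convex polyhedra determined by the directions `t 1, …, t m`. -/
def polyhedraOn {d m : ℕ} (t : Fin m → Euc d) : Set (Set (Euc d)) :=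
  {X | ∃ a b : Fin m → EReal,
    X = {x | ∀ j, a j ≤ ((⟪x, t j⟫ : ℝ) : EReal) ∧ ((⟪x, t j⟫ : ℝ) : EReal) ≤ b j}}

/-- The collection `𝔛_m` of convex polyhedra determined by `m` pairs of parallel hyperplanes. -/
def polyhedra (d m : ℕ) : Set (Set (Euc d)) :=
  {X | ∃ t : Fin m → Euc d, X ∈ polyhedraOn t}

/-- The distance `ρ_m(G,H) = sup_{X ∈ 𝔛_m} |G{X} - H{X}|`. -/
def rhoPoly {d : ℕ} (m : ℕ) (G H : Measure (Euc d)) : ℝ :=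
  ⨆ X ∈ polyhedra d m, |(G X).toReal - (H X).toReal|

/-- The Lévy concentration function `Q(μ, b) = sup_x μ[x, x+b]`. -/
def concFn (μ : Measure ℝ) (b : ℝ) : ℝ :=
  ⨆ x : ℝ, (μ (Set.Icc x (x + b))).toReal

/-- `q(H, X) = inf_{‖t‖=1} Q(𝓛(⟨ξ,t⟩), λ{⟨x,t⟩ : x ∈ X})` where `H = 𝓛(ξ)`. -/
def qFn {d : ℕ} (H : Measure (Euc d)) (X : Set (Euc d)) : ℝ :=
  ⨅ t ∈ {t : Euc d | ‖t‖ = 1},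
    concFn (H.map fun x => ⟪x, t⟫) (volume ((fun x => ⟪x, t⟫) '' X)).toReal

/-- The uniform (Kolmogorov) distance on `ℝ^d`. -/
def kolmDist {d : ℕ} (G H : Measure (Euc d)) : ℝ :=
  ⨆ x : Euc d, |(G {y | ∀ i, y i ≤ x i}).toReal - (H {y | ∀ i, y i ≤ x i}).toReal|

/-- The uniform (Kolmogorov) distance on `ℝ`. -/
def kolmDist1 (G H : Measure ℝ) : ℝ :=
  ⨆ x : ℝ, |(G (Set.Iic x)).toReal - (H (Set.Iic x)).toReal|

end

open MeasureTheory

namespace ZB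

noncomputable section

variable {ι : Type} [Fintype ι]

/-- bounded measurable functions -/
structure BM (ι : Type) [Fintype ι] where
  /-- underlying function -/
  toFun : (ι → ℝ) → ℝ
  meas' : Measurable toFun
  bdd' : ∃ C, ∀ z, |toFun z| ≤ C

instance : CoeFun (BM ι) (fun _ => (ι → ℝ) → ℝ) := ⟨fun f => f.toFun⟩

theorem BM.meas (f : BM ι) : Measurable (f : (ι → ℝ) → ℝ) := f.meas'

theorem BM.bdd (f : BM ι) : ∃ C, 0 ≤ C ∧ ∀ z, |f z| ≤ C := by
  obtain ⟨C, hC⟩ := f.bdd'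
  exact ⟨C, (abs_nonneg _).trans (hC 0), hC⟩

@[ext] theorem BM.ext {f g : BM ι} (h : ∀ z, f z = g z) : f = g := by
  cases f; cases g
  congr
  exact funext h

theorem BM.inj : Function.Injective (fun f : BM ι => f.toFun) := fun _ _ h => BM.ext (congrFun h)

instance : Zero (BM ι) := ⟨⟨fun _ => 0, measurable_const, 0, by simp⟩⟩
instance : Add (BM ι) := ⟨fun f g => ⟨fun z => f z + g z, f.meas.add g.meas, by
    obtain ⟨C, _, hC⟩ := f.bdd
    obtain ⟨D, _, hD⟩ := g.bdd
    exact ⟨C + D, fun z => (abs_add_le _ _).trans (add_le_add (hC z) (hD z))⟩⟩⟩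
instance : Neg (BM ι) := ⟨fun f => ⟨fun z => - f z, f.meas.neg, by
    obtain ⟨C, _, hC⟩ := f.bdd
    exact ⟨C, fun z => by rw [abs_neg]; exact hC z⟩⟩⟩
instance : Sub (BM ι) := ⟨fun f g => ⟨fun z => f z - g z, f.meas.sub g.meas, by
    obtain ⟨C, _, hC⟩ := f.bdd
    obtain ⟨D, _, hD⟩ := g.bdd
    exact ⟨C + D, fun z => (abs_sub _ _).trans (add_le_add (hC z) (hD z))⟩⟩⟩
theorem BM.smul_bdd (c : ℝ) (f : BM ι) : ∃ C, ∀ z, |c * f z| ≤ C := by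
  obtain ⟨C, _, hC⟩ := f.bdd
  refine ⟨|c| * C, fun z => ?_⟩
  rw [abs_mul]
  exact mul_le_mul_of_nonneg_left (hC z) (abs_nonneg _)
instance : SMul ℝ (BM ι) := ⟨fun c f => ⟨fun z => c * f z, f.meas.const_mul c, BM.smul_bdd c f⟩⟩
instance : SMul ℕ (BM ι) := ⟨fun c f => ⟨fun z => (c : ℝ) * f z, f.meas.const_mul _, BM.smul_bdd c f⟩⟩
instance : SMul ℤ (BM ι) := ⟨fun c f => ⟨fun z => (c : ℝ) * f z, f.meas.const_mul _, BM.smul_bdd c f⟩⟩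

instance : AddCommGroup (BM ι) := BM.inj.addCommGroup _ rfl (fun _ _ => rfl) (fun _ => rfl)
  (fun _ _ => rfl) (fun f c => by ext z; exact (nsmul_eq_mul c (f z)).symm)
  (fun f c => by ext z; exact (zsmul_eq_mul (f z) c).symm)

/-- coercion as additive hom -/
def BM.toAdd : BM ι →+ ((ι → ℝ) → ℝ) where
  toFun f := f.toFun
  map_zero' := rfl
  map_add' _ _ := rfl

instance : Module ℝ (BM ι) := BM.inj.module ℝ BM.toAdd (fun _ _ => rfl)

@[simp] theorem BM.add_apply (f g : BM ι) (z) : (f + g) z = f z + g z := rfl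
@[simp] theorem BM.sub_apply (f g : BM ι) (z) : (f - g) z = f z - g z := rfl
@[simp] theorem BM.neg_apply (f : BM ι) (z) : (-f) z = - f z := rfl
@[simp] theorem BM.zero_apply (z) : (0 : BM ι) z = 0 := rfl
@[simp] theorem BM.smul_apply (c : ℝ) (f : BM ι) (z) : (c • f) z = c * f z := rfl
theorem BM.sum_apply {κ : Type*} (s : Finset κ) (f : κ → BM ι) (z) :
    (∑ i ∈ s, f i) z = ∑ i ∈ s, f i z := by
  classical
  induction s using Finset.induction_on with
  | empty => simp
  | insert a s ha ih => rw [Finset.sum_insert ha, Finset.sum_insert ha, BM.add_apply, ih]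

/-- constant one -/
def one : BM ι := ⟨fun _ => 1, measurable_const, 1, by simp⟩
@[simp] theorem one_apply (z) : (one : BM ι) z = 1 := rfl

/-- absolute value -/
def ab (f : BM ι) : BM ι := ⟨fun z => |f z|, f.meas.abs, by
  obtain ⟨C, _, hC⟩ := f.bdd
  exact ⟨C, fun z => by rw [abs_abs]; exact hC z⟩⟩
@[simp] theorem ab_apply (f : BM ι) (z) : ab f z = |f z| := rfl

/-- product -/
def pm (f g : BM ι) : BM ι := ⟨fun z => f z * g z, f.meas.mul g.meas, by
  obtain ⟨C, hC0, hC⟩ := f.bdd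
  obtain ⟨D, hD0, hD⟩ := g.bdd
  exact ⟨C * D, fun z => by
    rw [abs_mul]; exact mul_le_mul (hC z) (hD z) (abs_nonneg _) hC0⟩⟩
@[simp] theorem pm_apply (f g : BM ι) (z) : pm f g z = f z * g z := rfl

open Classical in
/-- indicator -/
def ind (X : Set (ι → ℝ)) (hX : MeasurableSet X) : BM ι :=
  ⟨X.indicator (fun _ => 1), (measurable_const).indicator hX, 1, fun z => by
    by_cases h : z ∈ X <;> simp [h]⟩

theorem ind_of_mem {X : Set (ι → ℝ)} {hX : MeasurableSet X} {z} (h : z ∈ X) :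
    ind X hX z = 1 := by simp [ind, h]
theorem ind_of_not_mem {X : Set (ι → ℝ)} {hX : MeasurableSet X} {z} (h : z ∉ X) :
    ind X hX z = 0 := by simp [ind, h]
theorem ind_nonneg {X : Set (ι → ℝ)} {hX : MeasurableSet X} (z) : 0 ≤ ind X hX z := by
  by_cases h : z ∈ X
  · rw [ind_of_mem h]; norm_num
  · rw [ind_of_not_mem h]
theorem ind_le_one {X : Set (ι → ℝ)} {hX : MeasurableSet X} (z) : ind X hX z ≤ 1 := by
  by_cases h : z ∈ X
  · rw [ind_of_mem h]
  · rw [ind_of_not_mem h]; norm_num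

variable {E E' : Type} [MeasurableSpace E] [MeasurableSpace E']

theorem integrable_mul_BM {μ : Measure E} {p : E → ι → ℝ} (hp : Measurable p)
    {w : E → ℝ} (hw : Integrable w μ)
    (f : BM ι) (z : ι → ℝ) : Integrable (fun u => w u * f (z + p u)) μ := by
  obtain ⟨C, _, hC⟩ := f.bdd
  exact hw.mul_bdd (c := C) ((f.meas.comp (hp.const_add z)).aestronglyMeasurable)
    (Filter.Eventually.of_forall fun u => by rw [Real.norm_eq_abs]; exact hC _)

/-- kernel operator -/
def T (μ : Measure E) [IsFiniteMeasure μ] (p : E → ι → ℝ) (hp : Measurable p)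
    (w : E → ℝ) (hm : Measurable w) (hw : Integrable w μ) : Module.End ℝ (BM ι) where
  toFun f := ⟨fun z => ∫ u, w u * f (z + p u) ∂μ, by
    have : StronglyMeasurable (fun z : ι → ℝ => ∫ u, w u * f (z + p u) ∂μ) := by
      apply StronglyMeasurable.integral_prod_right (f := fun z u => w u * f (z + p u))
      have h1 : Measurable (fun q : (ι → ℝ) × E => w q.2 * f (q.1 + p q.2)) :=
        (hm.comp measurable_snd).mul (f.meas.comp (measurable_fst.add (hp.comp measurable_snd)))
      exact h1.stronglyMeasurable
    exact this.measurable, by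
    obtain ⟨C, hC0, hC⟩ := f.bdd
    refine ⟨∫ u, |w u| * C ∂μ, fun z => ?_⟩
    rw [← Real.norm_eq_abs]
    refine norm_integral_le_of_norm_le (hw.abs.mul_const C) (Filter.Eventually.of_forall ?_)
    intro u
    rw [Real.norm_eq_abs, abs_mul]
    exact mul_le_mul_of_nonneg_left (hC _) (abs_nonneg _)⟩
  map_add' f g := by
    ext z
    change ∫ u, w u * (f (z + p u) + g (z + p u)) ∂μ = _
    simp only [mul_add]
    exact integral_add (integrable_mul_BM hp hw f z) (integrable_mul_BM hp hw g z)
  map_smul' c f := by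
    ext z
    simp only [RingHom.id_apply]
    change ∫ u, w u * (c * f (z + p u)) ∂μ = c * ∫ u, w u * f (z + p u) ∂μ
    rw [← integral_const_mul]
    congr 1; ext u; ring

theorem T_apply (μ : Measure E) [IsFiniteMeasure μ] (p : E → ι → ℝ) (hp : Measurable p)
    (w : E → ℝ) (hm : Measurable w)
    (hw : Integrable w μ) (f : BM ι) (z) :
    (T μ p hp w hm hw f) z = ∫ u, w u * f (z + p u) ∂μ := rfl

theorem T_T_apply (μ : Measure E) (ν : Measure E') [IsFiniteMeasure μ] [IsFiniteMeasure ν]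
    (p : E → ι → ℝ) (hp : Measurable p) (p' : E' → ι → ℝ) (hp' : Measurable p')
    (w : E → ℝ) (w' : E' → ℝ) (hm hw hm' hw') (f : BM ι) (z) :
    (T μ p hp w hm hw (T ν p' hp' w' hm' hw' f)) z
      = ∫ q, w q.1 * w' q.2 * f (z + (p q.1 + p' q.2)) ∂(μ.prod ν) := by
  rw [integral_prod]
  · rw [T_apply]
    congr 1; ext u
    rw [T_apply, ← integral_const_mul]
    congr 1; ext v
    rw [add_assoc]; ring
  · obtain ⟨C, _, hC⟩ := f.bdd
    refine (Integrable.mul_prod hw hw').mul_bdd (c := C) ?_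
      (Filter.Eventually.of_forall fun u => by rw [Real.norm_eq_abs]; exact hC _)
    exact (f.meas.comp (measurable_const.add
      ((hp.comp measurable_fst).add (hp'.comp measurable_snd)))).aestronglyMeasurable

/-- set of kernel operators -/
def kers (ι : Type) [Fintype ι] : Set (Module.End ℝ (BM ι)) :=
  {a | ∃ (E : Type) (_ : MeasurableSpace E) (μ : Measure E) (_ : IsFiniteMeasure μ)
    (p : E → ι → ℝ) (hp : Measurable p) (w : E → ℝ) (hm : Measurable w)
    (hw : Integrable w μ), a = T μ p hp w hm hw}

theorem kers_comm : ∀ a ∈ kers ι, ∀ b ∈ kers ι, a * b = b * a := by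
  rintro _ ⟨E, _, μ, _, p, hp, w, hm, hw, rfl⟩ _ ⟨E', _, ν, _, p', hp', w', hm', hw', rfl⟩
  ext f z
  change (T μ p hp w hm hw (T ν p' hp' w' hm' hw' f)) z
    = (T ν p' hp' w' hm' hw' (T μ p hp w hm hw f)) z
  rw [T_T_apply, T_T_apply, ← integral_prod_swap]
  congr 1; ext q
  simp only [Prod.fst_swap, Prod.snd_swap]
  rw [add_comm (p q.2)]; ring

/-- the commutative algebra generated by the kernels (as subalgebra) -/
def Alg (ι : Type) [Fintype ι] : Subalgebra ℝ (Module.End ℝ (BM ι)) := Algebra.adjoin ℝ (kers ι)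

/-- the commutative algebra generated by the kernels -/
structure Op (ι : Type) [Fintype ι] where
  /-- underlying endomorphism -/
  val : Module.End ℝ (BM ι)
  mem : val ∈ Alg ι

theorem Op.inj : Function.Injective (fun a : Op ι => a.val) := by
  rintro ⟨a, ha⟩ ⟨b, hb⟩ h
  cases h; rfl

instance : Zero (Op ι) := ⟨⟨0, zero_mem _⟩⟩
instance : One (Op ι) := ⟨⟨1, one_mem _⟩⟩
instance : Add (Op ι) := ⟨fun a b => ⟨a.val + b.val, add_mem a.mem b.mem⟩⟩
instance : Mul (Op ι) := ⟨fun a b => ⟨a.val * b.val, mul_mem a.mem b.mem⟩⟩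
instance : Neg (Op ι) := ⟨fun a => ⟨- a.val, neg_mem a.mem⟩⟩
instance : Sub (Op ι) := ⟨fun a b => ⟨a.val - b.val, sub_mem a.mem b.mem⟩⟩
instance : SMul ℕ (Op ι) := ⟨fun n a => ⟨n • a.val, nsmul_mem a.mem n⟩⟩
instance : SMul ℤ (Op ι) := ⟨fun n a => ⟨n • a.val, zsmul_mem a.mem n⟩⟩
instance : SMul ℝ (Op ι) := ⟨fun n a => ⟨n • a.val, Subalgebra.smul_mem _ a.mem n⟩⟩
instance : Pow (Op ι) ℕ := ⟨fun a n => ⟨a.val ^ n, pow_mem a.mem n⟩⟩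
instance : NatCast (Op ι) := ⟨fun n => ⟨n, natCast_mem _ n⟩⟩
instance : IntCast (Op ι) := ⟨fun n => ⟨n, intCast_mem _ n⟩⟩

instance : Ring (Op ι) := Op.inj.ring _ rfl rfl (fun _ _ => rfl) (fun _ _ => rfl) (fun _ => rfl)
  (fun _ _ => rfl) (fun _ _ => rfl) (fun _ _ => rfl) (fun _ _ => rfl) (fun _ => rfl) (fun _ => rfl)

instance : CommRing (Op ι) :=
  { (inferInstance : Ring (Op ι)) with
    mul_comm := fun a b => Op.inj (congrArg Subtype.val
      ((Algebra.isMulCommutative_adjoin ℝ kers_comm).is_comm.comm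
        (⟨a.val, a.mem⟩ : ↥(Alg ι)) ⟨b.val, b.mem⟩)) }

/-- coercion -/
def Op.toAdd : Op ι →+ Module.End ℝ (BM ι) where
  toFun f := f.val
  map_zero' := rfl
  map_add' _ _ := rfl

instance : Module ℝ (Op ι) := Op.inj.module ℝ Op.toAdd (fun _ _ => rfl)
instance : Algebra ℝ (Op ι) := Algebra.ofModule
  (fun r x y => Op.inj (smul_mul_assoc r x.val y.val))
  (fun r x y => Op.inj (mul_smul_comm r x.val y.val))
instance : Module (Op ι) (BM ι) where
  smul a f := a.1 f
  one_smul _ := rfl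
  mul_smul _ _ _ := rfl
  smul_zero a := a.1.map_zero
  smul_add a := a.1.map_add
  add_smul _ _ _ := rfl
  zero_smul _ := rfl
instance : IsScalarTower ℝ (Op ι) (BM ι) := ⟨fun _ _ _ => rfl⟩
instance : SMulCommClass ℝ (Op ι) (BM ι) := ⟨fun c a f => (LinearMap.map_smul a.1 c f).symm⟩
instance : SMulCommClass (Op ι) ℝ (BM ι) := ⟨fun a c f => (LinearMap.map_smul a.1 c f)⟩

/-- kernel as an element of the algebra -/
def ker (μ : Measure E) [IsFiniteMeasure μ] (p : E → ι → ℝ) (hp : Measurable p)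
    (w : E → ℝ) (hm : Measurable w) (hw : Integrable w μ) : Op ι :=
  ⟨T μ p hp w hm hw, Algebra.subset_adjoin ⟨E, inferInstance, μ, inferInstance, p, hp, w, hm, hw, rfl⟩⟩

theorem ker_apply (μ : Measure E) [IsFiniteMeasure μ] (p : E → ι → ℝ) (hp : Measurable p)
    (w : E → ℝ) (hm : Measurable w)
    (hw : Integrable w μ) (f : BM ι) (z) :
    (ker μ p hp w hm hw • f) z = ∫ u, w u * f (z + p u) ∂μ := rfl

theorem Op.ext {a b : Op ι} (h : ∀ (f : BM ι) z, (a • f) z = (b • f) z) : a = b := by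
  apply Op.inj
  apply LinearMap.ext
  intro f
  exact BM.ext (h f)

theorem ker_mul (μ : Measure E) (ν : Measure E') [IsFiniteMeasure μ] [IsFiniteMeasure ν]
    (p : E → ι → ℝ) (hp : Measurable p) (p' : E' → ι → ℝ) (hp' : Measurable p')
    (w : E → ℝ) (w' : E' → ℝ) (hm hw hm' hw') (hm'' hw'') :
    ker μ p hp w hm hw * ker ν p' hp' w' hm' hw'
      = ker (μ.prod ν) (fun q => p q.1 + p' q.2)
        ((hp.comp measurable_fst).add (hp'.comp measurable_snd))
        (fun q => w q.1 * w' q.2) hm'' hw'' := by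
  apply Op.ext
  intro f z
  rw [mul_smul]; exact T_T_apply μ ν p hp p' hp' w w' hm hw hm' hw' f z

/-- convolution with a finite measure -/
def km (μ : Measure (ι → ℝ)) [IsFiniteMeasure μ] : Op ι :=
  ker μ id measurable_id (fun _ => 1) measurable_const (integrable_const 1)

theorem km_apply (μ : Measure (ι → ℝ)) [IsFiniteMeasure μ] (f : BM ι) (z) :
    (km μ • f) z = ∫ u, f (z + u) ∂μ := by
  rw [km, ker_apply]; simp

theorem BM.integrable (μ : Measure E) [IsFiniteMeasure μ] {p : E → ι → ℝ} (hp : Measurable p)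
    (f : BM ι) (z : ι → ℝ) :
    Integrable (fun u => f (z + p u)) μ := by
  have := integrable_mul_BM hp (integrable_const (μ := μ) (1:ℝ)) f z
  simpa using this

/-! positivity -/

/-- positive operators -/
def Pos (a : Op ι) : Prop := ∀ f : BM ι, (∀ z, 0 ≤ f z) → ∀ z, 0 ≤ (a • f) z

/-- Markov operators -/
def Mk (a : Op ι) : Prop := Pos a ∧ a • (one : BM ι) = one

theorem Pos.mono {a : Op ι} (ha : Pos a) {f g : BM ι} (h : ∀ z, f z ≤ g z) (z) :
    (a • f) z ≤ (a • g) z := by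
  have := ha (g - f) (fun z => by simpa using h z) z
  rw [smul_sub] at this
  simpa using this

theorem Pos.mul {a b : Op ι} (ha : Pos a) (hb : Pos b) : Pos (a * b) := by
  intro f hf
  rw [mul_smul]
  exact ha _ (hb _ hf)

theorem Pos.add {a b : Op ι} (ha : Pos a) (hb : Pos b) : Pos (a + b) := by
  intro f hf z
  rw [add_smul]
  exact add_nonneg (ha _ hf z) (hb _ hf z)

theorem Pos.smul {a : Op ι} (ha : Pos a) {c : ℝ} (hc : 0 ≤ c) : Pos (c • a) := by
  intro f hf z
  rw [smul_assoc]
  exact mul_nonneg hc (ha _ hf z)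

theorem Pos.sum {κ : Type*} {s : Finset κ} {a : κ → Op ι} (h : ∀ i ∈ s, Pos (a i)) :
    Pos (∑ i ∈ s, a i) := by
  intro f hf z
  rw [Finset.sum_smul, BM.sum_apply]
  exact Finset.sum_nonneg fun i hi => h i hi f hf z

theorem Pos.abs_le {a : Op ι} (ha : Pos a) (f : BM ι) (z) : |(a • f) z| ≤ (a • ab f) z := by
  rw [_root_.abs_le]
  constructor
  · have := ha.mono (f := -ZB.ab f) (g := f) (fun z => by simpa using neg_abs_le (f z)) z
    rw [smul_neg] at this
    simpa using this
  · exact ha.mono (fun z => by simpa using le_abs_self (f z)) z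

theorem Mk.one : Mk (1 : Op ι) := ⟨fun f hf z => by simpa using hf z, by simp⟩

theorem Mk.mul {a b : Op ι} (ha : Mk a) (hb : Mk b) : Mk (a * b) :=
  ⟨ha.1.mul hb.1, by rw [mul_smul, hb.2, ha.2]⟩

theorem Mk.pow {a : Op ι} (ha : Mk a) (n : ℕ) : Mk (a ^ n) := by
  induction n with
  | zero => simpa using Mk.one
  | succ n ih => rw [pow_succ]; exact ih.mul ha

theorem Mk.km (μ : Measure (ι → ℝ)) [IsProbabilityMeasure μ] : Mk (km μ) := by
  constructor
  · intro f hf z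
    rw [km_apply]
    exact integral_nonneg fun u => hf _
  · ext z; rw [km_apply]; simp

theorem Pos.le_const {a : Op ι} (ha : Pos a) {f : BM ι} {C c : ℝ} (hC : 0 ≤ C)
    (h : ∀ z, f z ≤ C) (h1 : ∀ z, (a • (ZB.one : BM ι)) z ≤ c) (z) : (a • f) z ≤ C * c := by
  have := ha.mono (f := f) (g := C • ZB.one) (fun z => by simpa using h z) z
  rw [smul_comm] at this
  exact this.trans (mul_le_mul_of_nonneg_left (h1 z) hC)

theorem Mk.le_const {a : Op ι} (ha : Mk a) {f : BM ι} {C : ℝ}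
    (h : ∀ z, f z ≤ C) (z) : (a • f) z ≤ C := by
  have := ha.1.mono (f := f) (g := C • ZB.one) (fun z => by simpa using h z) z
  rw [smul_comm, ha.2] at this
  simpa using this

theorem Mk.abs_le {a : Op ι} (ha : Mk a) {f : BM ι} {C : ℝ}
    (h : ∀ z, |f z| ≤ C) (z) : |(a • f) z| ≤ C :=
  (ha.1.abs_le f z).trans (ha.le_const (by simpa using h) z)

/-- operators dominated by a positive operator of total mass at most `c` -/
def Bdd (a : Op ι) (c : ℝ) : Prop := ∃ b : Op ι, Pos b ∧ (∀ (f : BM ι) z, |(a • f) z| ≤ (b • ab f) z) ∧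
  ∀ z, (b • (one : BM ι)) z ≤ c

theorem Mk.Bdd {a : Op ι} (ha : Mk a) : Bdd a 1 :=
  ⟨a, ha.1, fun f z => ha.1.abs_le f z, fun z => by rw [ha.2]; simp⟩

theorem Bdd.nonneg {a : Op ι} {c : ℝ} (h : Bdd a c) : 0 ≤ c := by
  obtain ⟨b, hb, _, h2⟩ := h
  exact (hb _ (fun z => by simp) 0).trans (h2 0)

theorem Bdd.mono {a : Op ι} {c c' : ℝ} (h : Bdd a c) (hc : c ≤ c') : Bdd a c' := by
  obtain ⟨b, hb, h1, h2⟩ := h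
  exact ⟨b, hb, h1, fun z => (h2 z).trans hc⟩

theorem Bdd.mul {a a' : Op ι} {c c' : ℝ} (h : Bdd a c) (h' : Bdd a' c') :
    Bdd (a * a') (c * c') := by
  have hc' := h'.nonneg
  obtain ⟨b, hb, h1, h2⟩ := h
  obtain ⟨b', hb', h1', h2'⟩ := h'
  refine ⟨b * b', hb.mul hb', fun f z => ?_, fun z => ?_⟩
  · rw [mul_smul, mul_smul]
    refine (h1 _ z).trans (hb.mono (fun z => ?_) z)
    exact h1' f z
  · rw [mul_smul, mul_comm c]
    exact hb.le_const hc' h2' h2 z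

theorem Bdd.add {a a' : Op ι} {c c' : ℝ} (h : Bdd a c) (h' : Bdd a' c') :
    Bdd (a + a') (c + c') := by
  obtain ⟨b, hb, h1, h2⟩ := h
  obtain ⟨b', hb', h1', h2'⟩ := h'
  refine ⟨b + b', hb.add hb', fun f z => ?_, fun z => ?_⟩
  · rw [add_smul, add_smul]
    exact (abs_add_le _ _).trans (add_le_add (h1 f z) (h1' f z))
  · rw [add_smul]
    exact add_le_add (h2 z) (h2' z)

theorem Bdd.smul {a : Op ι} {c : ℝ} (h : Bdd a c) (t : ℝ) : Bdd (t • a) (|t| * c) := by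
  obtain ⟨b, hb, h1, h2⟩ := h
  refine ⟨|t| • b, hb.smul (abs_nonneg _), fun f z => ?_, fun z => ?_⟩
  · rw [smul_assoc, smul_assoc]
    simp only [BM.smul_apply, abs_mul]
    exact mul_le_mul_of_nonneg_left (h1 f z) (abs_nonneg _)
  · rw [smul_assoc]
    exact mul_le_mul_of_nonneg_left (h2 z) (abs_nonneg _)

theorem Bdd.neg {a : Op ι} {c : ℝ} (h : Bdd a c) : Bdd (-a) c := by
  have := h.smul (-1)
  rw [neg_one_smul] at this
  simpa using this

theorem Bdd.sub {a a' : Op ι} {c c' : ℝ} (h : Bdd a c) (h' : Bdd a' c') :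
    Bdd (a - a') (c + c') := by
  rw [sub_eq_add_neg]; exact h.add h'.neg

theorem Bdd.zero : Bdd (0 : Op ι) 0 := ⟨0, fun f _ z => by simp, fun f z => by simp, by simp⟩

theorem Bdd.sum {κ : Type*} {s : Finset κ} {a : κ → Op ι} {c : κ → ℝ}
    (h : ∀ i ∈ s, Bdd (a i) (c i)) : Bdd (∑ i ∈ s, a i) (∑ i ∈ s, c i) := by
  classical
  induction s using Finset.induction_on with
  | empty => simpa using Bdd.zero
  | insert i s hi ih =>
    rw [Finset.sum_insert hi, Finset.sum_insert hi]
    exact (h i (Finset.mem_insert_self _ _)).add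
      (ih fun j hj => h j (Finset.mem_insert_of_mem hj))

/-- key estimate -/
theorem Bdd.ab_le {a ν : Op ι} {c Q : ℝ} (h : Bdd a c) (hν : Pos ν) {f : BM ι}
    (hf : ∀ z, (ν • ab f) z ≤ Q) (z) : (ν • ab (a • f)) z ≤ c * Q := by
  obtain ⟨b, hb, h1, h2⟩ := h
  have hQ : 0 ≤ Q := (hν _ (fun z => by simp) 0).trans (hf 0)
  have : (ν • ab (a • f)) z ≤ (ν • b • ab f) z := hν.mono (fun z => h1 f z) z
  refine this.trans ?_
  rw [← mul_smul, mul_comm, mul_smul, mul_comm c]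
  exact hb.le_const hQ hf h2 z

theorem Bdd.abs_le {a : Op ι} {c Q : ℝ} (h : Bdd a c) {f : BM ι}
    (hf : ∀ z, |f z| ≤ Q) (z) : |(a • f) z| ≤ c * Q := by
  have := h.ab_le (ν := 1) Mk.one.1 (f := f) (Q := Q) (by simpa using hf) z
  simpa using this

theorem Pos.abs_smul {ν : Op ι} (hν : Pos ν) (a : Op ι) (f : BM ι) (z) :
    |((ν * a) • f) z| ≤ (ν • ab (a • f)) z := by
  rw [mul_smul]; exact hν.abs_le _ z

theorem Bdd.ker (μ : Measure E) [IsFiniteMeasure μ] (p : E → ι → ℝ) (hp : Measurable p)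
    (w : E → ℝ) (hm : Measurable w)
    (hw : Integrable w μ) : Bdd (ker μ p hp w hm hw) (∫ u, |w u| ∂μ) := by
  refine ⟨ZB.ker μ p hp (fun u => |w u|) hm.abs hw.abs, ?_, ?_, ?_⟩
  · intro f hf z
    rw [ker_apply]
    exact integral_nonneg fun u => mul_nonneg (abs_nonneg _) (hf _)
  · intro f z
    rw [ker_apply, ker_apply, ← Real.norm_eq_abs]
    refine (norm_integral_le_integral_norm _).trans (le_of_eq ?_)
    simp [abs_mul]
  · intro z
    rw [ker_apply]; simp

end
end ZB

open MeasureTheory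

namespace ZB

noncomputable section

variable {ι : Type} [Fintype ι]
variable {E E' : Type} [MeasurableSpace E] [MeasurableSpace E']

theorem ker_congr {μ : Measure E} [IsFiniteMeasure μ] {p : E → ι → ℝ} {hp : Measurable p}
    {w w' : E → ℝ} {hm : Measurable w} {hw : Integrable w μ} {hm' : Measurable w'}
    {hw' : Integrable w' μ} (h : ∀ᵐ e ∂μ, w e = w' e) :
    ker μ p hp w hm hw = ker μ p hp w' hm' hw' := by
  apply Op.ext
  intro f z
  rw [ker_apply, ker_apply]
  apply integral_congr_ae
  filter_upwards [h] with e he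
  rw [he]

theorem ker_add {μ : Measure E} [IsFiniteMeasure μ] {p : E → ι → ℝ} {hp : Measurable p}
    {w w' : E → ℝ} {hm : Measurable w} {hw : Integrable w μ} {hm' : Measurable w'}
    {hw' : Integrable w' μ} (hm'' : Measurable (fun e => w e + w' e))
    (hw'' : Integrable (fun e => w e + w' e) μ) :
    ker μ p hp (fun e => w e + w' e) hm'' hw'' = ker μ p hp w hm hw + ker μ p hp w' hm' hw' := by
  apply Op.ext
  intro f z
  rw [add_smul, BM.add_apply, ker_apply, ker_apply, ker_apply,
    ← integral_add (integrable_mul_BM hp hw f z) (integrable_mul_BM hp hw' f z)]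
  simp only [add_mul]

/-- unweighted kernel -/
def ku (μ : Measure E) [IsFiniteMeasure μ] (p : E → ι → ℝ) (hp : Measurable p) : Op ι :=
  ker μ p hp (fun _ => 1) measurable_const (integrable_const 1)

theorem ku_apply (μ : Measure E) [IsFiniteMeasure μ] (p : E → ι → ℝ) (hp : Measurable p)
    (f : BM ι) (z) : (ku μ p hp • f) z = ∫ u, f (z + p u) ∂μ := by
  rw [ku, ker_apply]; simp

theorem Mk.ku (μ : Measure E) [IsProbabilityMeasure μ] (p : E → ι → ℝ) (hp : Measurable p) :
    Mk (ku μ p hp) := by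
  constructor
  · intro f hf z
    rw [ku_apply]
    exact integral_nonneg fun u => hf _
  · ext z; rw [ku_apply]; simp

theorem rep (μ : Measure E) [IsProbabilityMeasure μ] (p : E → ι → ℝ) (hp : Measurable p)
    (φ : E → ℝ) (hm : Measurable φ) (hi : Integrable φ μ) (h2 : Integrable (fun e => φ e ^ 2) μ)
    (h0 : ∫ e, φ e ∂μ = 0) (N : ℕ) :
    ∃ (E' : Type) (_ : MeasurableSpace E') (μ' : Measure E') (_ : IsProbabilityMeasure μ')
      (p' : E' → ι → ℝ) (hp' : Measurable p') (w : E' → ℝ) (hm' : Measurable w)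
      (hi' : Integrable w μ'), Integrable (fun e => w e ^ 2) μ' ∧ ∫ e, w e ∂μ' = 0 ∧
      ∫ e, w e ^ 2 ∂μ' = N * ∫ e, φ e ^ 2 ∂μ ∧
      (ku μ p hp) ^ N = ku μ' p' hp' ∧
      (N : ℝ) • (ker μ p hp φ hm hi * (ku μ p hp) ^ (N - 1)) = ker μ' p' hp' w hm' hi' ∧
      (∀ j, (∀ e, φ e = p e j) → ∀ e, w e = p' e j) := by
  induction N with
  | zero =>
    refine ⟨Unit, inferInstance, Measure.dirac (), inferInstance, fun _ => 0, measurable_const,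
      fun _ => 0, measurable_const, integrable_const 0, by simp, by simp, by simp, ?_, ?_, ?_⟩
    · apply Op.ext; intro f z; rw [ku_apply]; simp
    · apply Op.ext; intro f z; rw [ker_apply]; simp
    · intro j _ e; simp
  | succ N ih =>
    obtain ⟨E', _, μ', _, p', hp', w, hm', hi', hw2, hw0, hwv, hg, hW, hj⟩ := ih
    have e1 : Integrable (fun q : E' × E => w q.1) (μ'.prod μ) := hi'.comp_fst μ
    have e2 : Integrable (fun q : E' × E => φ q.2) (μ'.prod μ) := hi.comp_snd μ'
    have e3 : Integrable (fun q : E' × E => w q.1 ^ 2) (μ'.prod μ) := hw2.comp_fst μ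
    have e4 : Integrable (fun q : E' × E => φ q.2 ^ 2) (μ'.prod μ) := h2.comp_snd μ'
    have e5 : Integrable (fun q : E' × E => w q.1 * φ q.2) (μ'.prod μ) := hi'.mul_prod hi
    have m1 : Measurable (fun q : E' × E => w q.1) := hm'.comp measurable_fst
    have m2 : Measurable (fun q : E' × E => φ q.2) := hm.comp measurable_snd
    have exp : (fun q : E' × E => (w q.1 + φ q.2) ^ 2)
        = fun q => w q.1 ^ 2 + 2 * (w q.1 * φ q.2) + φ q.2 ^ 2 := by ext q; ring
    have i1 : ∫ q : E' × E, w q.1 ∂(μ'.prod μ) = ∫ e, w e ∂μ' := by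
      have := integral_prod_mul (μ := μ') (ν := μ) w (fun _ => (1:ℝ))
      simpa using this
    have i2 : ∫ q : E' × E, φ q.2 ∂(μ'.prod μ) = ∫ e, φ e ∂μ := by
      have := integral_prod_mul (μ := μ') (ν := μ) (fun _ => (1:ℝ)) φ
      simpa using this
    have i3 : ∫ q : E' × E, w q.1 ^ 2 ∂(μ'.prod μ) = ∫ e, w e ^ 2 ∂μ' := by
      have := integral_prod_mul (μ := μ') (ν := μ) (fun e => w e ^ 2) (fun _ => (1:ℝ))
      simpa using this
    have i4 : ∫ q : E' × E, φ q.2 ^ 2 ∂(μ'.prod μ) = ∫ e, φ e ^ 2 ∂μ := by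
      have := integral_prod_mul (μ := μ') (ν := μ) (fun _ => (1:ℝ)) (fun e => φ e ^ 2)
      simpa using this
    have i5 : ∫ q : E' × E, w q.1 * φ q.2 ∂(μ'.prod μ) = 0 := by
      rw [integral_prod_mul, h0, mul_zero]
    refine ⟨E' × E, inferInstance, μ'.prod μ, inferInstance, fun q => p' q.1 + p q.2,
      (hp'.comp measurable_fst).add (hp.comp measurable_snd), fun q => w q.1 + φ q.2,
      m1.add m2, e1.add e2, ?_, ?_, ?_, ?_, ?_, ?_⟩
    · rw [exp]; exact (e3.add (e5.const_mul 2)).add e4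
    · rw [integral_add e1 e2, i1, i2, hw0, h0, add_zero]
    · have e6 : Integrable (fun q : E' × E => w q.1 ^ 2 + 2 * (w q.1 * φ q.2)) (μ'.prod μ) :=
        e3.add (e5.const_mul 2)
      rw [exp, integral_add e6 e4, integral_add e3 (e5.const_mul 2),
        integral_const_mul, i3, i4, i5, hwv]
      push_cast; ring
    · rw [pow_succ, hg]
      unfold ku
      rw [ker_mul (hm'' := by fun_prop) (hw'' := by simp)]
      apply ker_congr; simp
    · have hN : ((N + 1 : ℕ) : ℝ) • (ker μ p hp φ hm hi * ku μ p hp ^ (N + 1 - 1))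
          = ((N : ℝ) • (ker μ p hp φ hm hi * ku μ p hp ^ (N - 1))) * ku μ p hp
            + ku μ p hp ^ N * ker μ p hp φ hm hi := by
        rcases Nat.eq_zero_or_pos N with h | h
        · subst h; simp
        · obtain ⟨M, rfl⟩ : ∃ M, N = M + 1 := ⟨N - 1, by omega⟩
          simp only [Nat.add_sub_cancel]
          rw [smul_mul_assoc, mul_assoc, ← pow_succ, mul_comm (ku μ p hp ^ (M+1)),
            Nat.cast_add (M+1) 1, add_smul]
          simp
      rw [hN, hW, hg, ker_add (hm := m1) (hm' := m2) (hw := e1) (hw' := e2)]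
      unfold ku
      congr 1
      · rw [ker_mul (hm'' := by fun_prop) (hw'' := by simpa using e1)]
        apply ker_congr; simp
      · rw [ker_mul (hm'' := by fun_prop) (hw'' := by simpa using e2)]
        apply ker_congr; simp
    · intro j hj' q
      simp only [Pi.add_apply]
      rw [hj j hj', hj']

theorem int_abs_le {μ : Measure E} [IsProbabilityMeasure μ] {w : E → ℝ} (hi : Integrable w μ)
    (h2 : Integrable (fun e => w e ^ 2) μ) : ∫ e, |w e| ∂μ ≤ √(∫ e, w e ^ 2 ∂μ) := by
  apply Real.le_sqrt_of_sq_le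
  set c := ∫ e, |w e| ∂μ with hc
  have h : 0 ≤ ∫ e, (|w e| - c) ^ 2 ∂μ := integral_nonneg fun e => sq_nonneg _
  have exp : (fun e => (|w e| - c) ^ 2) = fun e => w e ^ 2 - (2 * c) * |w e| + c ^ 2 := by
    ext e; rw [← sq_abs (w e)]; ring
  have e6 : Integrable (fun e => w e ^ 2 - (2 * c) * |w e|) μ := h2.sub (hi.abs.const_mul _)
  rw [exp, integral_add e6 (integrable_const _),
    integral_sub h2 (hi.abs.const_mul _), integral_const_mul, ← hc] at h
  simp at h
  nlinarith

theorem Bdd_rep (μ : Measure E) [IsProbabilityMeasure μ] (p : E → ι → ℝ) (hp : Measurable p)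
    (φ : E → ℝ) (hm : Measurable φ) (hi : Integrable φ μ) (h2 : Integrable (fun e => φ e ^ 2) μ)
    (h0 : ∫ e, φ e ∂μ = 0) (N : ℕ) :
    Bdd ((N : ℝ) • (ker μ p hp φ hm hi * (ku μ p hp) ^ (N - 1))) (√(N * ∫ e, φ e ^ 2 ∂μ)) := by
  obtain ⟨E', _, μ', _, p', hp', w, hm', hi', hw2, hw0, hwv, hg, hW, hj⟩ :=
    rep μ p hp φ hm hi h2 h0 N
  rw [hW, ← hwv]
  exact (Bdd.ker _ _ _ _ _ _).mono (int_abs_le hi' hw2)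

/-- version with index shift -/
theorem Bdd_rep' (μ : Measure E) [IsProbabilityMeasure μ] (p : E → ι → ℝ) (hp : Measurable p)
    (φ : E → ℝ) (hm : Measurable φ) (hi : Integrable φ μ) (h2 : Integrable (fun e => φ e ^ 2) μ)
    (h0 : ∫ e, φ e ∂μ = 0) (N : ℕ) :
    Bdd (ker μ p hp φ hm hi * (ku μ p hp) ^ N) (√((∫ e, φ e ^ 2 ∂μ) / (N + 1))) := by
  have h := (Bdd_rep μ p hp φ hm hi h2 h0 (N + 1)).smul ((N + 1 : ℝ)⁻¹)
  have hN : (0:ℝ) < N + 1 := by positivity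
  rw [smul_smul, Nat.add_sub_cancel, Nat.cast_add, Nat.cast_one, inv_mul_cancel₀ hN.ne',
    one_smul, abs_of_pos (inv_pos.2 hN)] at h
  refine h.mono (le_of_eq ?_)
  rw [mul_comm (N + 1 : ℝ), Real.sqrt_mul (integral_nonneg fun e => sq_nonneg _),
    Real.sqrt_div (integral_nonneg fun e => sq_nonneg _), div_eq_mul_inv]
  rw [mul_comm, mul_assoc]
  congr 1
  have := Real.mul_self_sqrt hN.le
  have h3 := (Real.sqrt_pos.2 hN).ne'
  field_simp
  nlinarith

end
end ZB

open MeasureTheory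

namespace ZB

noncomputable section

variable {ι : Type} [Fintype ι]

theorem selfbd {α : Type*} (φ : α → ℝ) (B0 : ℝ) (h0 : ∀ x, φ x ≤ B0) (a : ℝ)
    (h : ∀ B, (∀ x, φ x ≤ B) → ∀ x, φ x ≤ a + B / 2) (x : α) : φ x ≤ 2 * a := by
  have hne : (Set.range φ).Nonempty := ⟨_, x, rfl⟩
  have hbd : BddAbove (Set.range φ) := ⟨B0, by rintro _ ⟨y, rfl⟩; exact h0 y⟩
  have h1 : ∀ y, φ y ≤ sSup (Set.range φ) := fun y => le_csSup hbd ⟨y, rfl⟩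
  have h2 := h _ h1
  have h3 : sSup (Set.range φ) ≤ a + sSup (Set.range φ) / 2 :=
    csSup_le hne (by rintro _ ⟨y, rfl⟩; exact h2 y)
  have := h1 x
  linarith

theorem meas_sub : Measurable (fun q : (ι → ℝ) × (ι → ℝ) => q.1 - q.2) :=
  measurable_fst.sub measurable_snd

theorem meas_neg : Measurable (fun y : ι → ℝ => -y) := measurable_neg

/-- reflected convolution -/
def kr (H : Measure (ι → ℝ)) [IsFiniteMeasure H] : Op ι := ku H (fun x => -x) meas_neg

/-- symmetrization -/
def sm (H : Measure (ι → ℝ)) : Measure (ι → ℝ) := (H.prod H).map (fun q => q.1 - q.2)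

instance (H : Measure (ι → ℝ)) [IsProbabilityMeasure H] : IsProbabilityMeasure (sm H) :=
  Measure.isProbabilityMeasure_map meas_sub.aemeasurable

/-- symmetrized operator -/
def gg (H : Measure (ι → ℝ)) [IsProbabilityMeasure H] : Op ι := km (sm H)

/-- difference operator -/
def AA (H : Measure (ι → ℝ)) [IsProbabilityMeasure H] : Op ι := 1 - gg H

theorem integral_sm (H : Measure (ι → ℝ)) [IsProbabilityMeasure H] {f : (ι → ℝ) → ℝ}
    (hf : Measurable f) : ∫ y, f y ∂(sm H) = ∫ q, f (q.1 - q.2) ∂(H.prod H) := by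
  rw [sm, integral_map meas_sub.aemeasurable hf.aestronglyMeasurable]

theorem gg_eq (H : Measure (ι → ℝ)) [IsProbabilityMeasure H] : gg H = km H * kr H := by
  unfold gg kr
  have : km H * ku H (fun x => -x) meas_neg = _ :=
    ker_mul (hm'' := by fun_prop) (hw'' := by simp) (μ := H) (ν := H) (p := id)
      (p' := fun x : ι → ℝ => -x) ..
  rw [this]
  apply Op.ext
  intro f z
  rw [km_apply, ker_apply, integral_sm]
  · simp [sub_eq_add_neg]
  · exact f.meas.comp (measurable_const_add z)

theorem Mk.kr (H : Measure (ι → ℝ)) [IsProbabilityMeasure H] : Mk (kr H) := Mk.ku _ _ _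

theorem Mk.gg (H : Measure (ι → ℝ)) [IsProbabilityMeasure H] : Mk (gg H) := Mk.km _

theorem Bdd.AA (H : Measure (ι → ℝ)) [IsProbabilityMeasure H] : Bdd (AA H) 2 := by
  have := (Mk.one (ι := ι)).Bdd.sub (Mk.gg H).Bdd
  exact this.mono (by norm_num)

theorem Bdd.gA (H : Measure (ι → ℝ)) [IsProbabilityMeasure H] (k : ℕ) :
    Bdd (ZB.gg H ^ k * ZB.AA H) 2 := by
  have := ((Mk.gg H).pow k).Bdd.mul (Bdd.AA H)
  exact this.mono (by norm_num)

theorem sm_symm (H : Measure (ι → ℝ)) [IsProbabilityMeasure H] :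
    (sm H).map (fun y => -y) = sm H := by
  unfold sm
  rw [Measure.map_map meas_neg meas_sub]
  have : (fun q : (ι → ℝ) × (ι → ℝ) => q.1 - q.2) ∘ Prod.swap
    = (fun y => -y) ∘ fun q : (ι → ℝ) × (ι → ℝ) => q.1 - q.2 := by
    ext q; simp
  rw [← this, ← Measure.map_map meas_sub measurable_swap,
    Measure.prod_swap]

theorem integral_sm_neg (H : Measure (ι → ℝ)) [IsProbabilityMeasure H] {f : (ι → ℝ) → ℝ}
    (hf : Measurable f) : ∫ y, f (-y) ∂(sm H) = ∫ y, f y ∂(sm H) := by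
  conv_rhs => rw [← sm_symm H]
  rw [integral_map meas_neg.aemeasurable hf.aestronglyMeasurable]

/-- nice measures -/
structure Nice (H : Measure (ι → ℝ)) : Prop where
  bdd : ∃ B, ∀ᵐ x ∂H, ∀ i, |x i| ≤ B
  noatom : ∀ i c, H {x | x i = c} = 0

theorem Nice.sm_bdd {H : Measure (ι → ℝ)} [IsProbabilityMeasure H] (hH : Nice H) :
    ∃ B, 0 ≤ B ∧ ∀ᵐ y ∂(sm H), ∀ i, |y i| ≤ B := by
  obtain ⟨B, hB⟩ := hH.bdd
  refine ⟨|B| + |B|, by positivity, ?_⟩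
  rw [sm, ae_map_iff meas_sub.aemeasurable]
  · have h1 : ∀ᵐ q ∂(H.prod H), ∀ i, |q.1 i| ≤ B := Measure.quasiMeasurePreserving_fst.ae hB
    have h2 : ∀ᵐ q ∂(H.prod H), ∀ i, |q.2 i| ≤ B := Measure.quasiMeasurePreserving_snd.ae hB
    filter_upwards [h1, h2] with q h1 h2 i
    simp only [Pi.sub_apply]
    exact (abs_sub _ _).trans (add_le_add ((h1 i).trans (le_abs_self _)) ((h2 i).trans (le_abs_self _)))
  · have : {y : ι → ℝ | ∀ i, |y i| ≤ |B| + |B|} = ⋂ i, {y | |y i| ≤ |B| + |B|} := by ext; simp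
    rw [this]
    exact MeasurableSet.iInter fun i =>
      measurableSet_le (measurable_pi_apply i).abs measurable_const

/-- second moment of a coordinate -/
def vv (H : Measure (ι → ℝ)) (j : ι) : ℝ := ∫ y, (y j) ^ 2 ∂(sm H)

theorem vv_nonneg (H : Measure (ι → ℝ)) (j : ι) : 0 ≤ vv H j :=
  integral_nonneg fun _ => sq_nonneg _

theorem Nice.int1 {H : Measure (ι → ℝ)} [IsProbabilityMeasure H] (hH : Nice H) (j : ι) :
    Integrable (fun y => y j) (sm H) := by
  obtain ⟨B, _, hB⟩ := hH.sm_bdd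
  refine Integrable.of_bound (measurable_pi_apply j).aestronglyMeasurable B ?_
  filter_upwards [hB] with y hy using hy j

theorem Nice.int2 {H : Measure (ι → ℝ)} [IsProbabilityMeasure H] (hH : Nice H) (j : ι) :
    Integrable (fun y => (y j) ^ 2) (sm H) := by
  obtain ⟨B, hB0, hB⟩ := hH.sm_bdd
  refine Integrable.of_bound ((measurable_pi_apply j).pow_const 2).aestronglyMeasurable (B ^ 2) ?_
  filter_upwards [hB] with y hy
  rw [Real.norm_eq_abs, abs_pow]
  exact pow_le_pow_left₀ (abs_nonneg _) (hy j) 2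

/-- first-moment kernels -/
theorem Nice.Y {H : Measure (ι → ℝ)} [IsProbabilityMeasure H] (hH : Nice H) (j : ι) :
    ∃ W : Op ι, (∀ N : ℕ, Bdd ((N : ℝ) • (W * gg H ^ (N - 1))) (√(N * vv H j))) ∧
      ∀ (N : ℕ) (f F : BM ι) (z : ι → ℝ) (e : ℝ), (∀ w, F w = (w j - e) * f w) →
        (gg H ^ N • F) z = (z j - e) * (gg H ^ N • f) z
          + (((N : ℝ) • (W * gg H ^ (N - 1))) • f) z := by
  have h0 : ∫ y, y j ∂(sm H) = 0 := by
    have := integral_sm_neg H (f := fun y => y j) (measurable_pi_apply j)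
    simp only [Pi.neg_apply, integral_neg] at this
    linarith
  refine ⟨ker (sm H) id measurable_id (fun y => y j) (measurable_pi_apply j) (hH.int1 j),
    fun N => Bdd_rep (sm H) id measurable_id _ _ _ (hH.int2 j) h0 N, ?_⟩
  intro N f F z e hF
  obtain ⟨E', _, μ', _, p', hp', w, hm', hi', hw2, hw0, hwv, hg, hW, hj⟩ :=
    rep (sm H) id measurable_id (fun y => y j) (measurable_pi_apply j) (hH.int1 j) (hH.int2 j) h0 N
  have hg' : gg H ^ N = ku μ' p' hp' := hg
  have hW' : (N : ℝ) • (ker (sm H) id measurable_id (fun y => y j) (measurable_pi_apply j) (hH.int1 j)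
    * gg H ^ (N - 1)) = ker μ' p' hp' w hm' hi' := hW
  rw [hg', hW', ku_apply, ku_apply, ker_apply, ← integral_const_mul,
    ← integral_add ((f.integrable μ' hp' z).const_mul _) (integrable_mul_BM hp' hi' f z)]
  congr 1; ext u
  rw [hF, hj j (fun _ => rfl) u]
  simp only [Pi.add_apply]; ring

/-- half-sample estimate -/
theorem Nice.half {H : Measure (ι → ℝ)} [IsProbabilityMeasure H] {j : ι} {W : Op ι}
    (hW : ∀ N : ℕ, Bdd ((N : ℝ) • (W * gg H ^ (N - 1))) (√(N * vv H j)))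
    {ν : Op ι} (hν : Pos ν) {k : ℕ} {σ B Q : ℝ} (hσ : 0 ≤ σ) (hv : (k + 1) * vv H j ≤ σ ^ 2)
    {f : BM ι} (hB : ∀ k' ≤ k, ∀ z, (ν • ab ((gg H ^ k' * AA H) • f)) z ≤ B / (k' + 1))
    (hQ : ∀ z, (ν • ab f) z ≤ Q) (z) :
    (ν • ab (((k : ℝ) • (W * gg H ^ (k - 1)) - ((k + 1 : ℕ) : ℝ) • (W * gg H ^ (k + 1 - 1))) • f)) z
      ≤ (4 * σ * B + σ * Q) / (k + 1) := by
  have hv0 := vv_nonneg H j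
  have hB0 : 0 ≤ B := by
    have := hB 0 (Nat.zero_le _) z
    simp only [Nat.cast_zero, zero_add, div_one] at this
    exact (hν _ (fun z => by simp) z).trans this
  have hQ0 : 0 ≤ Q := (hν _ (fun z => by simp) z).trans (hQ z)
  have hk : (0:ℝ) < k + 1 := by positivity
  have hs : ∀ k' ≤ k + 1, √((k' : ℝ) * vv H j) ≤ σ := by
    intro k' hk'
    rw [Real.sqrt_le_left hσ]
    refine le_trans ?_ hv
    apply mul_le_mul_of_nonneg_right _ hv0
    exact_mod_cast hk'
  -- second piece
  have h2 : Bdd (W * gg H ^ k) (σ / (k + 1)) := by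
    have h := ((hW (k + 1)).mono (hs _ le_rfl)).smul ((k + 1 : ℝ)⁻¹)
    rw [smul_smul, Nat.add_sub_cancel, Nat.cast_add, Nat.cast_one, inv_mul_cancel₀ hk.ne',
      one_smul, abs_of_pos (inv_pos.2 hk)] at h
    refine h.mono (le_of_eq ?_)
    field_simp
  have h2' := h2.ab_le hν hQ z
  set k1 := (k + 1) / 2 with hk1
  set k2 := k - k1 with hk2
  have hsum : k1 + k2 = k := by omega
  -- first piece
  have h1 : (ν • ab (((k : ℝ) • (W * gg H ^ (k - 1) * AA H)) • f)) z ≤ 4 * σ * B / (k + 1) := by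
    rcases Nat.eq_zero_or_pos k with h | h
    · have : ab (((k : ℝ) • (W * gg H ^ (k - 1) * AA H)) • f) = 0 := by
        ext w; simp [h]
      rw [this, smul_zero]
      simp only [BM.zero_apply]
      positivity
    · have hk1p : 1 ≤ k1 := by omega
      have hk1r : (0:ℝ) < k1 := by exact_mod_cast hk1p
      have e : (k : ℝ) • (W * gg H ^ (k - 1) * AA H)
          = (((k : ℝ) / k1) • ((k1 : ℝ) • (W * gg H ^ (k1 - 1)))) * (gg H ^ k2 * AA H) := by
        rw [smul_smul, div_mul_cancel₀ _ hk1r.ne', smul_mul_assoc, mul_assoc, mul_assoc,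
          ← mul_assoc (gg H ^ (k1 - 1)), ← pow_add]
        congr 5; omega
      have hb := ((hW k1).mono (hs k1 (by omega))).smul ((k : ℝ) / k1)
      rw [e, mul_smul]
      refine (hb.ab_le hν (hB k2 (by omega)) z).trans ?_
      rw [abs_of_nonneg (by positivity)]
      have hx : (k : ℝ) ≤ 2 * k1 := by exact_mod_cast (by omega : k ≤ 2 * k1)
      have hy : (k : ℝ) + 1 ≤ 2 * (k2 + 1) := by exact_mod_cast (by omega : k + 1 ≤ 2 * (k2 + 1))
      have hq : (k : ℝ) / k1 ≤ 2 := by rw [div_le_iff₀ hk1r]; exact hx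
      have hr : B / ((k2 : ℝ) + 1) ≤ 2 * B / (k + 1) := by
        rw [div_le_div_iff₀ (by positivity) hk]
        nlinarith
      calc (k : ℝ) / k1 * σ * (B / (k2 + 1)) ≤ 2 * σ * (2 * B / (k + 1)) := by gcongr
        _ = _ := by ring
  have key : ((k : ℝ) • (W * gg H ^ (k - 1)) - ((k + 1 : ℕ) : ℝ) • (W * gg H ^ (k + 1 - 1)))
      = (k : ℝ) • (W * gg H ^ (k - 1) * AA H) - W * gg H ^ k := by
    rcases Nat.eq_zero_or_pos k with h | h
    · subst h; simp
    · obtain ⟨M, rfl⟩ : ∃ M, k = M + 1 := ⟨k - 1, by omega⟩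
      simp only [Nat.add_sub_cancel, AA]
      rw [mul_sub, mul_one, mul_assoc W (gg H ^ M), ← pow_succ, smul_sub, Nat.cast_add (M + 1) 1,
        add_smul]
      simp only [Nat.cast_one, one_smul]
      abel
  rw [key]
  have h3 : (ν • ab (((k : ℝ) • (W * gg H ^ (k - 1) * AA H) - W * gg H ^ k) • f)) z
      ≤ (ν • (ab (((k : ℝ) • (W * gg H ^ (k - 1) * AA H)) • f) + ab ((W * gg H ^ k) • f))) z := by
    apply hν.mono
    intro w
    rw [sub_smul]
    simp only [ab_apply, BM.sub_apply, BM.add_apply]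
    exact abs_sub _ _
  refine h3.trans ?_
  rw [smul_add, BM.add_apply]
  refine (add_le_add h1 h2').trans (le_of_eq ?_)
  field_simp

end
end ZB

open MeasureTheory

namespace ZB

noncomputable section

variable {ι : Type} [Fintype ι]

/-- generalized boxes -/
structure Bx (ι : Type) [Fintype ι] where
  I : ι → Set ℝ
  oc : ∀ i, (I i).OrdConnected

/-- underlying set of a box -/
def Bx.set (B : Bx ι) : Set (ι → ℝ) := {w | ∀ i, w i ∈ B.I i}

theorem Bx.meas (B : Bx ι) : MeasurableSet B.set := by
  have : B.set = ⋂ i, (fun w : ι → ℝ => w i) ⁻¹' (B.I i) := by ext; simp [Bx.set]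
  rw [this]
  exact MeasurableSet.iInter fun i => measurable_pi_apply i (B.oc i).measurableSet

/-- indicator of a box -/
def ib (B : Bx ι) : BM ι := ind B.set B.meas

theorem ib_of_mem {B : Bx ι} {w} (h : w ∈ B.set) : ib B w = 1 := ind_of_mem h
theorem ib_of_not_mem {B : Bx ι} {w} (h : w ∉ B.set) : ib B w = 0 := ind_of_not_mem h
theorem ib_nonneg (B : Bx ι) (w) : 0 ≤ ib B w := ind_nonneg w
theorem ib_le_one (B : Bx ι) (w) : ib B w ≤ 1 := ind_le_one w

open Classical in
/-- intersect one side -/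
def Bx.cut (B : Bx ι) (j : ι) (S : Set ℝ) (hS : S.OrdConnected) : Bx ι where
  I i := if i = j then B.I i ∩ S else B.I i
  oc i := by
    split_ifs
    · exact (B.oc i).inter hS
    · exact B.oc i

theorem Bx.mem_cut {B : Bx ι} {j : ι} {S : Set ℝ} {hS : S.OrdConnected} {w : ι → ℝ} :
    w ∈ (B.cut j S hS).set ↔ w ∈ B.set ∧ w j ∈ S := by
  simp only [Bx.set, Bx.cut, Set.mem_ofPred_eq]
  constructor
  · intro h
    refine ⟨fun i => ?_, ?_⟩
    · have := h i
      split_ifs at this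
      · exact this.1
      · exact this
    · have := h j
      rw [if_pos rfl] at this
      exact this.2
  · rintro ⟨h1, h2⟩ i
    split_ifs with h
    · subst h; exact ⟨h1 i, h2⟩
    · exact h1 i

/-- the induction hypothesis -/
def HK (ι : Type) [Fintype ι] (K : ℝ) (N : ℕ) : Prop :=
  ∀ (H : Measure (ι → ℝ)) [IsProbabilityMeasure H], Nice H → ∀ B : Bx ι, ∀ k ≤ N, ∀ z,
    |((gg H ^ k * AA H) • ib B) z| ≤ K / (k + 1)

theorem count_floor (x : ℝ) (M : ℕ) :
    ∑ i ∈ Finset.range M, (if ((i : ℝ) + 1 ≤ x) then (1:ℝ) else 0) = min (M : ℝ) (⌊x⌋₊ : ℝ) := by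
  induction M with
  | zero => simp
  | succ M ih =>
    rw [Finset.sum_range_succ, ih]
    have h : ((M : ℝ) + 1 ≤ x) ↔ M + 1 ≤ ⌊x⌋₊ := by
      rw [Nat.le_floor_iff' (by omega)]; simp
    rcases le_or_gt (M + 1) ⌊x⌋₊ with h1 | h1
    · have h2 : (M : ℝ) + 1 ≤ ⌊x⌋₊ := by exact_mod_cast h1
      rw [if_pos (h.2 h1), min_eq_left (by linarith), min_eq_left (by push_cast; linarith)]
      push_cast; rfl
    · have h2 : (⌊x⌋₊ : ℝ) ≤ M := by exact_mod_cast Nat.lt_succ_iff.1 h1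
      rw [if_neg (fun h' => by have := h.1 h'; omega), min_eq_right h2,
        min_eq_right (by push_cast; linarith), add_zero]

theorem uni_box {D : Op ι} {c κ : ℝ} (hD : Bdd D c) (hκ : ∀ (B : Bx ι) z, |(D • ib B) z| ≤ κ)
    {φ : ℝ → ℝ} (h0 : ∀ x, 0 ≤ φ x) (h1 : ∀ x, φ x ≤ 1)
    (hoc : ∀ t, {x | t ≤ φ x}.OrdConnected) {j : ι} {B : Bx ι} {f : BM ι}
    (hf : ∀ w, f w = φ (w j) * ib B w) (z) : |(D • f) z| ≤ κ := by
  have hc := hD.nonneg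
  have key : ∀ M : ℕ, 0 < M → |(D • f) z| ≤ κ + c / M := by
    intro M hM
    have hM' : (0:ℝ) < M := by exact_mod_cast hM
    set fM : BM ι := (M : ℝ)⁻¹ • ∑ i ∈ Finset.range M, ib (B.cut j {x | ((i : ℝ) + 1) / M ≤ φ x} (hoc _))
      with hfM
    have e1 : ∀ w, fM w = (⌊M * φ (w j)⌋₊ : ℝ) / M * ib B w := by
      intro w
      have : (∑ i ∈ Finset.range M, ib (B.cut j {x | ((i : ℝ) + 1) / M ≤ φ x} (hoc _))) w
          = (⌊M * φ (w j)⌋₊ : ℝ) * ib B w := by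
        rw [BM.sum_apply]
        have hmin : min (M : ℝ) ⌊M * φ (w j)⌋₊ = ⌊M * φ (w j)⌋₊ := by
          apply min_eq_right
          refine (Nat.floor_le (mul_nonneg hM'.le (h0 _))).trans ?_
          nlinarith [h1 (w j)]
        rw [← hmin, ← count_floor, Finset.sum_mul]
        apply Finset.sum_congr rfl
        intro i _
        have hiff : ((i : ℝ) + 1 ≤ M * φ (w j)) ↔ ((i : ℝ) + 1) / M ≤ φ (w j) := by
          rw [div_le_iff₀ hM', mul_comm]
        by_cases hw : w ∈ B.set
        · rw [ib_of_mem hw]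
          split_ifs with h
          · rw [ib_of_mem (B := B.cut j _ _) (Bx.mem_cut.2 ⟨hw, hiff.1 h⟩)]; simp
          · rw [ib_of_not_mem (B := B.cut j _ _) (fun h' => h (hiff.2 (Bx.mem_cut.1 h').2))]; simp
        · rw [ib_of_not_mem hw, ib_of_not_mem (B := B.cut j _ _) (fun h' => hw (Bx.mem_cut.1 h').1)]; simp
      rw [hfM, BM.smul_apply, this]
      field_simp
    have e2 : ∀ w, |(f - fM) w| ≤ 1 / M := by
      intro w
      rw [BM.sub_apply, hf, e1, ← sub_mul, abs_mul, abs_of_nonneg (ib_nonneg B w)]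
      have ha : |φ (w j) - (⌊M * φ (w j)⌋₊ : ℝ) / M| ≤ 1 / M := by
        have hx := Nat.floor_le (mul_nonneg hM'.le (h0 (w j)))
        have hy := (Nat.lt_floor_add_one (M * φ (w j))).le
        rw [abs_le]
        constructor
        · have : (⌊M * φ (w j)⌋₊ : ℝ) / M ≤ φ (w j) := by rw [div_le_iff₀ hM']; linarith
          have : (0:ℝ) ≤ 1 / M := by positivity
          linarith
        · rw [sub_le_iff_le_add, ← add_div, le_div_iff₀ hM']; linarith
      calc _ ≤ 1 / (M : ℝ) * 1 := mul_le_mul ha (ib_le_one B w) (ib_nonneg B w) (by positivity)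
        _ = _ := mul_one _
    have e3 : |(D • fM) z| ≤ κ := by
      rw [hfM, smul_comm, Finset.smul_sum, BM.smul_apply, BM.sum_apply, abs_mul,
        abs_of_pos (inv_pos.2 hM')]
      have : |∑ i ∈ Finset.range M, (D • ib (B.cut j {x | ((i : ℝ) + 1) / M ≤ φ x} (hoc _))) z| ≤ M * κ := by
        refine (Finset.abs_sum_le_sum_abs _ _).trans ?_
        refine (Finset.sum_le_sum fun i _ => hκ _ z).trans ?_
        simp
      calc _ ≤ (M : ℝ)⁻¹ * (M * κ) := mul_le_mul_of_nonneg_left this (by positivity)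
        _ = κ := by field_simp
    have e4 := hD.abs_le e2 z
    rw [smul_sub, BM.sub_apply] at e4
    have : (D • f) z = (D • fM) z + ((D • f) z - (D • fM) z) := by ring
    rw [this]
    refine (abs_add_le _ _).trans (add_le_add e3 (e4.trans (le_of_eq ?_)))
    ring
  by_contra hlt
  push Not at hlt
  obtain ⟨M, hM⟩ := exists_nat_gt (c / (|(D • f) z| - κ))
  have hd : 0 < |(D • f) z| - κ := by linarith
  have hM0 : (0:ℝ) < M := lt_of_le_of_lt (by positivity) hM
  have := key M (by exact_mod_cast hM0)
  have h3 : c / M < |(D • f) z| - κ := by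
    rw [div_lt_iff₀ hM0]
    rw [div_lt_iff₀ hd] at hM
    linarith
  linarith

/-- slab indicator -/
def slab (j : ι) (e l : ℝ) : BM ι := ind {w | |w j - e| ≤ l}
  (measurableSet_le (by fun_prop) measurable_const)

theorem slab_of_mem {j : ι} {e l : ℝ} {w : ι → ℝ} (h : |w j - e| ≤ l) : slab j e l w = 1 :=
  ind_of_mem h
theorem slab_of_not_mem {j : ι} {e l : ℝ} {w : ι → ℝ} (h : ¬ |w j - e| ≤ l) : slab j e l w = 0 :=
  ind_of_not_mem h
theorem slab_nonneg (j : ι) (e l : ℝ) (w) : 0 ≤ slab j e l w := ind_nonneg w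
theorem slab_le_one (j : ι) (e l : ℝ) (w) : slab j e l w ≤ 1 := ind_le_one w

theorem slab_mono {j : ι} {e e' l l' : ℝ} (h : ∀ x, |x - e| ≤ l → |x - e'| ≤ l') (w) :
    slab j e l w ≤ slab j e' l' w := by
  by_cases hw : |w j - e| ≤ l
  · rw [slab_of_mem hw, slab_of_mem (h _ hw)]
  · rw [slab_of_not_mem hw]; exact slab_nonneg _ _ _ _

/-- monotone times box, contained in a slab -/
def MB (j : ι) (e r : ℝ) (f : BM ι) : Prop :=
  ∃ (B : Bx ι) (φ : ℝ → ℝ), Monotone φ ∧ (∀ x, 0 ≤ φ x) ∧ (∀ x, φ x ≤ 1) ∧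
    (∀ w, f w = φ (w j) * ib B w) ∧ ∀ w ∈ B.set, |w j - e| ≤ r

theorem MB.ib {j : ι} {e r : ℝ} {B : Bx ι} (h : ∀ w ∈ B.set, |w j - e| ≤ r) : MB j e r (ib B) :=
  ⟨B, fun _ => 1, monotone_const, fun _ => zero_le_one, fun _ => le_rfl, fun w => by simp, h⟩

theorem MB.abs_le {j : ι} {e r : ℝ} {f : BM ι} (h : MB j e r f) (w) : |f w| ≤ slab j e r w := by
  obtain ⟨B, φ, hm, h0, h1, hf, hB⟩ := h
  rw [hf]
  by_cases hw : w ∈ B.set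
  · rw [ib_of_mem hw, slab_of_mem (hB w hw), mul_one, abs_of_nonneg (h0 _)]; exact h1 _
  · rw [ib_of_not_mem hw]; simpa using slab_nonneg _ _ _ _

theorem MB.bd {D : Op ι} {c κ : ℝ} (hD : Bdd D c) (hκ : ∀ (B : Bx ι) z, |(D • ZB.ib B) z| ≤ κ)
    {j : ι} {e r : ℝ} {f : BM ι} (h : MB j e r f) (z) : |(D • f) z| ≤ κ := by
  obtain ⟨B, φ, hm, h0, h1, hf, hB⟩ := h
  refine uni_box hD hκ h0 h1 (fun t => ⟨?_⟩) hf z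
  intro x hx y hy u hu
  exact le_trans hx (hm hu.1)

theorem MB.deriv {j : ι} {e r : ℝ} (hr : 0 < r) {f : BM ι} (h : MB j e r f) :
    ∃ f' : BM ι, MB j e r f' ∧ ∀ w, ((2 * r) • f' - r • f) w = (w j - e) * f w := by
  obtain ⟨B, φ, hm, h0, h1, hf, hB⟩ := h
  set ψ : ℝ → ℝ := fun x => max 0 (min 1 ((x - e + r) / (2 * r))) with hψ
  have hψm : Monotone ψ := by
    intro x y hxy
    simp only [hψ]
    gcongr
  have hψ0 : ∀ x, 0 ≤ ψ x := fun x => le_max_left _ _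
  have hψ1 : ∀ x, ψ x ≤ 1 := fun x => max_le zero_le_one (min_le_left _ _)
  have hb : ∀ w : ι → ℝ, |ψ (w j) * f w| ≤ 1 := by
    intro w
    rw [hf, abs_of_nonneg (mul_nonneg (hψ0 _) (mul_nonneg (h0 _) (ib_nonneg _ _)))]
    exact mul_le_one₀ (hψ1 _) (mul_nonneg (h0 _) (ib_nonneg _ _))
      (mul_le_one₀ (h1 _) (ib_nonneg _ _) (ib_le_one _ _))
  refine ⟨⟨fun w => ψ (w j) * f w, (hψm.measurable.comp (measurable_pi_apply j)).mul f.meas, 1, hb⟩,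
    ⟨B, fun x => ψ x * φ x, ?_, ?_, ?_, ?_, hB⟩, ?_⟩
  · intro x y hxy
    exact mul_le_mul (hψm hxy) (hm hxy) (h0 _) (hψ0 _)
  · exact fun x => mul_nonneg (hψ0 _) (h0 _)
  · exact fun x => mul_le_one₀ (hψ1 _) (h0 _) (h1 _)
  · intro w
    change ψ (w j) * f w = _
    rw [hf]; ring
  · intro w
    change 2 * r * (ψ (w j) * f w) - r * f w = _
    by_cases hw : w ∈ B.set
    · have hx := _root_.abs_le.1 (hB w hw)
      have : ψ (w j) = (w j - e + r) / (2 * r) := by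
        simp only [hψ]
        rw [min_eq_right, max_eq_right]
        · apply div_nonneg <;> linarith
        · rw [div_le_one (by linarith)]; linarith
      rw [this]
      field_simp
      ring
    · rw [hf, ib_of_not_mem hw]; ring

/-- local L1 estimate -/
theorem Nice.LL {H : Measure (ι → ℝ)} [IsProbabilityMeasure H] (hH : Nice H) {K : ℝ} {N n : ℕ}
    (hK : HK ι K N) (hn : n ≤ N) (hK0 : 0 ≤ K) {j : ι} {e r σ Q : ℝ} (hr : 0 < r) (hrσ : r ≤ σ)
    (hv : (n + 1) * vv H j ≤ σ ^ 2) {ν : Op ι} (hν : Mk ν)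
    (hQ : ∀ z, (ν • slab j e (14 * σ)) z ≤ Q) {f : BM ι} (hf : MB j e r f) (z) :
    (ν • ab ((gg H ^ n * AA H) • f)) z ≤ 2 * (K + 1) * Q / (n + 1) := by
  have hσ : 0 < σ := hr.trans_le hrσ
  have hQ0 : 0 ≤ Q := (hν.1 _ (fun z => slab_nonneg _ _ _ z) z).trans (hQ z)
  obtain ⟨W, hW, hY⟩ := hH.Y j
  let α := {x : BM ι × ℕ × (ι → ℝ) // MB j e r x.1 ∧ x.2.1 ≤ n}
  let Φ : α → ℝ := fun x =>
    ((x.1.2.1 : ℝ) + 1) * (ν • ab ((gg H ^ x.1.2.1 * AA H) • x.1.1)) x.1.2.2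
  have hfQ : ∀ f : BM ι, MB j e r f → ∀ z, (ν • ab f) z ≤ Q := by
    intro f hf z
    refine le_trans (hν.1.mono (fun w => ?_) z) (hQ z)
    refine (hf.abs_le w).trans (slab_mono (fun x hx => hx.trans ?_) w)
    linarith
  have main := selfbd Φ ((n + 1) * 2) ?_ (K * Q + Q / 14) ?_ ⟨(f, n, z), hf, le_rfl⟩
  · simp only [Φ] at main
    rw [le_div_iff₀ (by positivity)]
    nlinarith
  · rintro ⟨⟨f, k, z⟩, hf, hk⟩
    simp only [Φ]
    have h1 : (ν • ab ((gg H ^ k * AA H) • f)) z ≤ 2 * 1 := by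
      refine (Bdd.gA H k).ab_le hν.1 (fun z => hν.le_const (fun w => ?_) z) z
      exact (hf.abs_le w).trans (slab_le_one _ _ _ _)
    have h2 : 0 ≤ (ν • ab ((gg H ^ k * AA H) • f)) z := hν.1 _ (fun z => by simp) z
    have h3 : (k : ℝ) + 1 ≤ n + 1 := by
      have : (k : ℝ) ≤ n := by exact_mod_cast hk
      linarith
    rw [mul_one] at h1
    exact mul_le_mul h3 h1 h2 (by positivity)
  · intro β hβ
    have hβ' : ∀ f : BM ι, MB j e r f → ∀ k ≤ n, ∀ z,
        (ν • ab ((gg H ^ k * AA H) • f)) z ≤ β / (k + 1) := by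
      intro f hf k hk z
      rw [le_div_iff₀ (by positivity), mul_comm]
      exact hβ ⟨(f, k, z), hf, hk⟩
    rintro ⟨⟨f, k, z⟩, hf, hk⟩
    simp only [Φ]
    have hk' : (0:ℝ) < k + 1 := by positivity
    obtain ⟨f', hf', hF⟩ := hf.deriv hr
    set F := (2 * r) • f' - r • f with hFdef
    set Y := ((k : ℝ) • (W * gg H ^ (k - 1)) - ((k + 1 : ℕ) : ℝ) • (W * gg H ^ (k + 1 - 1))) with hYdef
    have hvk : (k + 1) * vv H j ≤ σ ^ 2 := by
      refine le_trans (mul_le_mul_of_nonneg_right ?_ (vv_nonneg H j)) hv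
      have : (k : ℝ) ≤ n := by exact_mod_cast hk
      linarith
    have hhalf := Nice.half hW hν.1 hσ.le hvk (f := f) (B := β) (Q := Q)
      (fun k' hk' z => hβ' f hf k' (hk'.trans hk) z) (hfQ f hf) z
    have hid : ∀ w, ((gg H ^ k * AA H) • F) w
        = (w j - e) * ((gg H ^ k * AA H) • f) w + (Y • f) w := by
      intro w
      have h1 := hY k f F w e hF
      have h2 := hY (k + 1) f F w e hF
      have e1 : gg H ^ k * AA H = gg H ^ k - gg H ^ (k + 1) := by
        rw [AA, mul_sub, mul_one, pow_succ]
      rw [e1, hYdef, sub_smul, sub_smul, sub_smul, BM.sub_apply, BM.sub_apply, BM.sub_apply, h1, h2]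
      ring
    have hbox : ∀ w, |((gg H ^ k * AA H) • f) w| ≤ K / (k + 1) := by
      intro w
      exact MB.bd (Bdd.gA H k) (fun B z => hK H hH B k (hk.trans hn) z) hf w
    have hpt : ∀ w, ab ((gg H ^ k * AA H) • f) w ≤ ((K / (k + 1)) • slab j e (14 * σ) +
        (1 / (14 * σ)) • ((2 * r) • ab ((gg H ^ k * AA H) • f') + r • ab ((gg H ^ k * AA H) • f)
          + ab (Y • f))) w := by
      intro w
      simp only [BM.add_apply, BM.smul_apply, ab_apply]
      by_cases hw : |w j - e| ≤ 14 * σ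
      · rw [slab_of_mem hw, mul_one]
        refine (hbox w).trans (le_add_of_nonneg_right ?_)
        positivity
      · rw [slab_of_not_mem hw, mul_zero, zero_add, one_div, ← div_eq_inv_mul,
          le_div_iff₀ (by positivity)]
        push Not at hw
        have h3 : |((gg H ^ k * AA H) • F) w| ≤ 2 * r * |((gg H ^ k * AA H) • f') w|
            + r * |((gg H ^ k * AA H) • f) w| := by
          rw [hFdef, smul_sub, smul_comm, smul_comm _ r, BM.sub_apply, BM.smul_apply, BM.smul_apply]
          refine (abs_sub _ _).trans ?_
          rw [abs_mul (2 * r), abs_mul r, abs_of_pos hr, abs_of_pos (by positivity : 0 < 2 * r)]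
        have h4 : |w j - e| * |((gg H ^ k * AA H) • f) w|
            ≤ |((gg H ^ k * AA H) • F) w| + |(Y • f) w| := by
          rw [← abs_mul]
          have : (w j - e) * ((gg H ^ k * AA H) • f) w = ((gg H ^ k * AA H) • F) w - (Y • f) w := by
            rw [hid]; ring
          rw [this]; exact abs_sub _ _
        have h5 : 14 * σ * |((gg H ^ k * AA H) • f) w| ≤ |w j - e| * |((gg H ^ k * AA H) • f) w| :=
          mul_le_mul_of_nonneg_right hw.le (abs_nonneg _)
        linarith
    have h6 := hν.1.mono hpt z
    rw [smul_add, smul_comm ν (K / ((k : ℝ) + 1)), smul_comm ν (1 / (14 * σ)), smul_add ν, smul_add ν,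
      smul_comm ν (2 * r), smul_comm ν r] at h6
    simp only [BM.add_apply, BM.smul_apply] at h6
    have h7 := hβ' f hf k hk z
    have h8 := hβ' f' hf' k hk z
    have h9 := hQ z
    have hβ0 : 0 ≤ β / (k + 1) := (hν.1 _ (fun z => by simp) z).trans h7
    have hβ1 : 0 ≤ β := by
      have := mul_nonneg hβ0 hk'.le
      rwa [div_mul_cancel₀ _ hk'.ne'] at this
    have h10 : (ν • ab ((gg H ^ k * AA H) • f)) z ≤ K / (k + 1) * Q +
        1 / (14 * σ) * (2 * σ * (β / (k + 1)) + σ * (β / (k + 1)) + (4 * σ * β + σ * Q) / (k + 1)) := by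
      refine h6.trans ?_
      have h11 : 0 ≤ (ν • ab ((gg H ^ k * AA H) • f')) z := hν.1 _ (fun z => by simp) z
      have h12 : 0 ≤ (ν • ab ((gg H ^ k * AA H) • f)) z := hν.1 _ (fun z => by simp) z
      gcongr
    calc ((k : ℝ) + 1) * (ν • ab ((gg H ^ k * AA H) • f)) z ≤ ((k : ℝ) + 1) * (K / (k + 1) * Q +
        1 / (14 * σ) * (2 * σ * (β / (k + 1)) + σ * (β / (k + 1)) + (4 * σ * β + σ * Q) / (k + 1))) :=
          mul_le_mul_of_nonneg_left h10 hk'.le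
      _ = K * Q + Q / 14 + β / 2 := by field_simp; ring

/-- cutting far away -/
theorem Nice.cut {H : Measure (ι → ℝ)} [IsProbabilityMeasure H] (hH : Nice H) {K : ℝ} {N k : ℕ}
    (hK : HK ι K N) (hk : k ≤ N) {i : ι} {σ b : ℝ} (hσ : 0 ≤ σ) (hb : 0 < b)
    (hv : (k + 1) * vv H i ≤ σ ^ 2) {B : Bx ι} {z : ι → ℝ} {s : ℝ} (hs : s ^ 2 = 1)
    (hB : ∀ w ∈ B.set, b < s * (w i - z i)) :
    |((gg H ^ k * AA H) • ib B) z| ≤ σ / b * (4 * K + 1) / (k + 1) := by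
  obtain ⟨W, hW, hY⟩ := hH.Y i
  set φ : ℝ → ℝ := fun x => b / max |x - z i| b with hφ
  have hmx : ∀ x, 0 < max |x - z i| b := fun x => lt_max_of_lt_right hb
  have h0 : ∀ x, 0 ≤ φ x := fun x => div_nonneg hb.le (hmx x).le
  have h1 : ∀ x, φ x ≤ 1 := fun x => (div_le_one (hmx x)).2 (le_max_right _ _)
  have hoc : ∀ t, {x | t ≤ φ x}.OrdConnected := by
    intro t
    refine ⟨fun x hx y hy u hu => ?_⟩
    have : |u - z i| ≤ max |x - z i| |y - z i| := by
      rw [abs_le]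
      constructor
      · have := neg_abs_le (x - z i); have := le_max_left |x - z i| |y - z i|
        linarith [hu.1]
      · have := le_abs_self (y - z i); have := le_max_right |x - z i| |y - z i|
        linarith [hu.2]
    rcases le_total |x - z i| |y - z i| with h | h
    · rw [max_eq_right h] at this
      refine le_trans (show t ≤ φ y from hy) ?_
      simp only [hφ]
      exact div_le_div_of_nonneg_left hb.le (hmx u) (max_le_max this le_rfl)
    · rw [max_eq_left h] at this
      refine le_trans (show t ≤ φ x from hx) ?_
      simp only [hφ]
      exact div_le_div_of_nonneg_left hb.le (hmx u) (max_le_max this le_rfl)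
  have hφm : Measurable φ :=
    measurable_const.div (((measurable_id.sub_const _).abs).max measurable_const)
  let Φ : BM ι := ⟨fun w => φ (w i) * ib B w,
    (hφm.comp (measurable_pi_apply i)).mul (ib B).meas, 1, fun w => by
      rw [abs_of_nonneg (mul_nonneg (h0 _) (ib_nonneg _ _))]
      exact mul_le_one₀ (h1 _) (ib_nonneg _ _) (ib_le_one _ _)⟩
  have hΦ : ∀ w, Φ w = φ (w i) * ib B w := fun w => rfl
  have hs1 : |s| = 1 := by
    rcases (show s = 1 ∨ s = -1 by rcases eq_or_eq_neg_of_sq_eq_sq s 1 (by simpa using hs) with h | h <;> simp [h]) with h | h <;> simp [h]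
  have hF : ∀ w, ((s * b) • ib B) w = (w i - z i) * Φ w := by
    intro w
    rw [hΦ, BM.smul_apply]
    by_cases hw : w ∈ B.set
    · have := hB w hw
      have h2 : |w i - z i| = s * (w i - z i) := by
        rw [← abs_of_pos (hb.trans this), abs_mul, hs1, one_mul]
      rw [ib_of_mem hw]
      simp only [hφ]
      rw [max_eq_left (by rw [h2]; exact this.le), h2]
      have h3 : w i - z i ≠ 0 := by rintro h; rw [h] at this; linarith
      have h4 : s ≠ 0 := by rintro rfl; norm_num at hs
      field_simp
      rw [hs]
    · rw [ib_of_not_mem hw]; ring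
  have hhalf := Nice.half hW (Mk.one (ι := ι)).1 hσ hv (f := Φ) (B := K) (Q := 1)
    (fun k' hk' z => by
      rw [one_smul, ab_apply]
      exact uni_box (Bdd.gA H k') (fun B z => hK H hH B k' (hk'.trans hk) z) h0 h1 hoc hΦ z)
    (fun w => by
      rw [one_smul, ab_apply, hΦ, abs_of_nonneg (mul_nonneg (h0 _) (ib_nonneg _ _))]
      exact mul_le_one₀ (h1 _) (ib_nonneg _ _) (ib_le_one _ _)) z
  rw [one_smul, ab_apply] at hhalf
  have g1 := hY k Φ _ z (z i) hF
  have g2 := hY (k + 1) Φ _ z (z i) hF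
  have e1 : gg H ^ k * AA H = gg H ^ k - gg H ^ (k + 1) := by
    rw [AA, mul_sub, mul_one, pow_succ]
  have e2 : (s * b) * ((gg H ^ k * AA H) • ib B) z = (((k : ℝ) • (W * gg H ^ (k - 1))
      - ((k + 1 : ℕ) : ℝ) • (W * gg H ^ (k + 1 - 1))) • Φ) z := by
    rw [← BM.smul_apply, ← smul_comm, e1, sub_smul, sub_smul, BM.sub_apply, BM.sub_apply, g1, g2]
    ring
  rw [← e2, abs_mul, abs_mul, hs1, one_mul, abs_of_pos hb] at hhalf
  have : |((gg H ^ k * AA H) • ib B) z| ≤ (4 * σ * K + σ * 1) / (k + 1) / b := by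
    rw [le_div_iff₀ hb]; linarith
  refine this.trans (le_of_eq ?_)
  field_simp

/-- truncated second moment -/
def VV (H : Measure (ι → ℝ)) (j : ι) (ρ : ℝ) : ℝ := ∫ y, min ((y j / ρ) ^ 2) 1 ∂(sm H)

/-- clip to [-1,1] -/
def clip (x : ℝ) : ℝ := max (-1) (min x 1)

theorem clip_mono : Monotone clip := fun x y h => by unfold clip; gcongr
theorem clip_le (x : ℝ) : clip x ≤ 1 := max_le (by norm_num) (min_le_right _ _)
theorem le_clip (x : ℝ) : -1 ≤ clip x := le_max_left _ _
theorem clip_neg (x : ℝ) : clip (-x) = - clip x := by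
  unfold clip
  rcases le_total x 1 with h | h <;> rcases le_total (-1) x with h' | h'
  · rw [min_eq_left (by linarith), min_eq_left h, max_eq_right (by linarith), max_eq_right h']
  · rw [min_eq_right (by linarith), min_eq_left h, max_eq_right (by linarith), max_eq_left h']; norm_num
  · rw [min_eq_left (by linarith), min_eq_right h, max_eq_left (by linarith), max_eq_right (by linarith)]
  · linarith
theorem clip_abs (x : ℝ) : |clip x| ≤ 1 := abs_le.2 ⟨le_clip x, clip_le x⟩
theorem clip_of_mem {x : ℝ} (h : |x| ≤ 1) : clip x = x := by
  have := abs_le.1 h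
  unfold clip
  rw [min_eq_left this.2, max_eq_right this.1]
theorem clip_sq (x : ℝ) : clip x ^ 2 = min (x ^ 2) 1 := by
  rcases le_total |x| 1 with h | h
  · rw [clip_of_mem h, min_eq_left]; rw [← sq_abs]; exact pow_le_one₀ (abs_nonneg _) h
  · have h2 : 1 ≤ x ^ 2 := by rw [← sq_abs]; exact one_le_pow₀ h
    rw [min_eq_right h2]
    unfold clip
    rcases le_abs.1 h with h' | h'
    · rw [min_eq_right h', max_eq_right (by norm_num)]; norm_num
    · rw [min_eq_left (by linarith), max_eq_left (by linarith)]; norm_num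
theorem clip_meas : Measurable clip := clip_mono.measurable

/-- concentration bound -/
theorem conc (H : Measure (ι → ℝ)) [IsProbabilityMeasure H] (j : ι) {ρ : ℝ} (hρ : 0 < ρ) (n : ℕ)
    (e : ℝ) (z) : (gg H ^ n • slab j e ρ) z * √((n + 1) * VV H j ρ) ≤ 4 := by
  set φ : (ι → ℝ) → ℝ := fun y => clip (y j / ρ) with hφ
  have hm : Measurable φ := clip_meas.comp (by fun_prop)
  have hi : Integrable φ (sm H) := Integrable.of_bound hm.aestronglyMeasurable 1
    (Filter.Eventually.of_forall fun y => clip_abs _)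
  have hsq : ∀ y, φ y ^ 2 = min ((y j / ρ) ^ 2) 1 := fun y => clip_sq _
  have hi2 : Integrable (fun y => φ y ^ 2) (sm H) :=
    Integrable.of_bound (hm.pow_const 2).aestronglyMeasurable 1
    (Filter.Eventually.of_forall fun y => by
      rw [Real.norm_eq_abs, abs_pow]; exact pow_le_one₀ (abs_nonneg _) (clip_abs _))
  have h0 : ∫ y, φ y ∂(sm H) = 0 := by
    have := integral_sm_neg H hm
    simp only [hφ, Pi.neg_apply, neg_div, clip_neg, integral_neg] at this
    simp only [hφ]
    linarith
  have hV : ∫ y, φ y ^ 2 ∂(sm H) = VV H j ρ := by simp only [hsq]; rfl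
  have hb := Bdd_rep' (sm H) id measurable_id φ hm hi hi2 h0 n
  rw [hV] at hb
  have hV0 : 0 ≤ VV H j ρ := by rw [← hV]; exact integral_nonneg fun _ => sq_nonneg _
  set W := ker (sm H) id measurable_id φ hm hi with hWdef
  let f : BM ι := ⟨fun w => (clip ((w j - e) / (2 * ρ)) + 1) / 2,
    ((clip_meas.comp (by fun_prop)).add_const 1).div_const 2, 1,
    fun w => by
      have := clip_le ((w j - e) / (2 * ρ)); have := le_clip ((w j - e) / (2 * ρ))
      rw [abs_le]; constructor <;> linarith⟩
  have hf1 : ∀ w, |f w| ≤ 1 := fun w => by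
    have := clip_le ((w j - e) / (2 * ρ)); have := le_clip ((w j - e) / (2 * ρ))
    change |(clip ((w j - e) / (2 * ρ)) + 1) / 2| ≤ 1
    rw [abs_le]; constructor <;> linarith
  have hWf : ∀ w, ((VV H j ρ / 4) • slab j e ρ) w ≤ (W • f) w := by
    intro w
    have e1 : (W • f) w = ∫ y, φ y * (f (w + y) - f w) ∂(sm H) := by
      rw [hWdef, ker_apply]
      simp only [mul_sub, id]
      have hI : Integrable (fun y => φ y * f (w + y)) (sm H) := integrable_mul_BM measurable_id hi f w
      rw [integral_sub hI (hi.mul_const _), integral_mul_const, h0]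
      simp
    have hIntg : Integrable (fun y => φ y * (f (w + y) - f w)) (sm H) := by
      simp only [mul_sub]
      exact (integrable_mul_BM measurable_id hi f w).sub (hi.mul_const _)
    have hfd : ∀ y, f (w + y) - f w = (clip ((w j + y j - e) / (2 * ρ)) - clip ((w j - e) / (2 * ρ))) / 2 := by
      intro y
      change (clip ((w j + y j - e) / (2 * ρ)) + 1) / 2 - (clip ((w j - e) / (2 * ρ)) + 1) / 2 = _
      ring
    have hpos : ∀ y, 0 ≤ φ y * (f (w + y) - f w) := by
      intro y
      rw [hfd]
      rcases le_total 0 (y j) with h | h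
      · apply mul_nonneg
        · have := clip_mono (show 0 ≤ y j / ρ from div_nonneg h hρ.le)
          rwa [clip_of_mem (by simp)] at this
        · have : clip ((w j - e) / (2 * ρ)) ≤ clip ((w j + y j - e) / (2 * ρ)) := by
            apply clip_mono; gcongr; linarith
          linarith
      · apply mul_nonneg_of_nonpos_of_nonpos
        · have := clip_mono (show y j / ρ ≤ 0 from div_nonpos_of_nonpos_of_nonneg h hρ.le)
          rwa [clip_of_mem (x := 0) (by simp)] at this
        · have : clip ((w j + y j - e) / (2 * ρ)) ≤ clip ((w j - e) / (2 * ρ)) := by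
            apply clip_mono; gcongr; linarith
          linarith
    rw [e1, BM.smul_apply]
    by_cases hw : |w j - e| ≤ ρ
    · rw [slab_of_mem hw, mul_one, ← hV, ← integral_div]
      refine integral_mono (hi2.div_const 4) hIntg (fun y => ?_)
      have hx := abs_le.1 hw
      have hcw : clip ((w j - e) / (2 * ρ)) = (w j - e) / (2 * ρ) := by
        apply clip_of_mem
        rw [abs_div, abs_of_pos (by positivity : 0 < 2 * ρ), div_le_one (by positivity)]
        linarith
      have hcw2 : clip ((w j + ρ * clip (y j / ρ) - e) / (2 * ρ)) = (w j + ρ * clip (y j / ρ) - e) / (2 * ρ) := by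
        apply clip_of_mem
        have h1 := clip_le (y j / ρ); have h2 := le_clip (y j / ρ)
        rw [abs_div, abs_of_pos (by positivity : 0 < 2 * ρ), div_le_one (by positivity), abs_le]
        constructor <;> nlinarith
      change φ y ^ 2 / 4 ≤ _
      rw [hfd]
      rcases le_total 0 (y j) with h | h
      · have hc0 : 0 ≤ φ y := by
          have := clip_mono (show 0 ≤ y j / ρ from div_nonneg h hρ.le)
          rwa [clip_of_mem (by simp)] at this
        have hle : ρ * clip (y j / ρ) ≤ y j := by
          have : clip (y j / ρ) ≤ y j / ρ := max_le
            ((by norm_num : (-1:ℝ) ≤ 0).trans (div_nonneg h hρ.le)) (min_le_left _ _)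
          rw [le_div_iff₀ hρ] at this; linarith
        have : clip ((w j + ρ * clip (y j / ρ) - e) / (2 * ρ)) ≤ clip ((w j + y j - e) / (2 * ρ)) := by
          apply clip_mono; gcongr
        have h3 : φ y / 4 ≤ (clip ((w j + y j - e) / (2 * ρ)) - clip ((w j - e) / (2 * ρ))) / 2 := by
          rw [hcw2] at this
          rw [hcw]
          have : (w j + ρ * clip (y j / ρ) - e) / (2 * ρ) - (w j - e) / (2 * ρ) = φ y / 2 := by
            simp only [hφ]; field_simp; ring
          linarith
        nlinarith
      · have hc0 : φ y ≤ 0 := by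
          have := clip_mono (show y j / ρ ≤ 0 from div_nonpos_of_nonpos_of_nonneg h hρ.le)
          rwa [clip_of_mem (x := 0) (by simp)] at this
        have hle : y j ≤ ρ * clip (y j / ρ) := by
          have : y j / ρ ≤ clip (y j / ρ) := by
            unfold clip
            rw [min_eq_left ((div_nonpos_of_nonpos_of_nonneg h hρ.le).trans zero_le_one)]
            exact le_max_right _ _
          rw [div_le_iff₀ hρ] at this; linarith
        have : clip ((w j + y j - e) / (2 * ρ)) ≤ clip ((w j + ρ * clip (y j / ρ) - e) / (2 * ρ)) := by
          apply clip_mono; gcongr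
        have h3 : (clip ((w j + y j - e) / (2 * ρ)) - clip ((w j - e) / (2 * ρ))) / 2 ≤ φ y / 4 := by
          rw [hcw2] at this
          rw [hcw]
          have : (w j + ρ * clip (y j / ρ) - e) / (2 * ρ) - (w j - e) / (2 * ρ) = φ y / 2 := by
            simp only [hφ]; field_simp; ring
          linarith
        nlinarith
    · rw [slab_of_not_mem hw, mul_zero]
      exact integral_nonneg hpos
  have h1 := ((Mk.gg H).pow n).1.mono hWf z
  rw [smul_comm, BM.smul_apply, ← mul_smul, mul_comm] at h1
  have h2 := (le_abs_self _).trans (hb.abs_le hf1 z)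
  have hg : ku (sm H) id measurable_id = gg H := rfl
  rw [hg] at h2
  have h3 : VV H j ρ / 4 * (gg H ^ n • slab j e ρ) z ≤ √(VV H j ρ / (n + 1)) * 1 := by
    rw [mul_comm] at h1
    rw [mul_comm (gg H ^ n) W] at h1
    linarith
  rcases hV0.eq_or_lt with h | h
  · rw [← h]; simp
  · have hn : (0:ℝ) < n + 1 := by positivity
    set q := (gg H ^ n • slab j e ρ) z
    set V := VV H j ρ
    have e1 : √(V / (n + 1)) = V / √((n + 1) * V) := by
      rw [eq_div_iff (by positivity), ← Real.sqrt_mul (by positivity)]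
      rw [show V / (n + 1) * ((n + 1) * V) = V ^ 2 by field_simp]
      exact Real.sqrt_sq h.le
    rw [e1, mul_one, le_div_iff₀ (by positivity)] at h3
    nlinarith

/-- cover of a slab by smaller slabs -/
theorem slab_cover {a : Op ι} (ha : Pos a) {j : ι} {ρ q : ℝ} (hρ : 0 < ρ)
    (hq : ∀ e z, (a • slab j e ρ) z ≤ q) {l : ℝ} (hl : 0 ≤ l) (e : ℝ) (z) :
    (a • slab j e l) z ≤ (l / ρ + 1) * q := by
  have hq0 : 0 ≤ q := (ha _ (fun w => slab_nonneg _ _ _ w) z).trans (hq e z)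
  set N := ⌊l / ρ⌋₊ + 1 with hN
  have h1 : ∀ w, slab j e l w ≤ (∑ i ∈ Finset.range N, slab j (e - l + (2 * i + 1) * ρ) ρ) w := by
    intro w
    rw [BM.sum_apply]
    by_cases hw : |w j - e| ≤ l
    · rw [slab_of_mem hw]
      have hx := abs_le.1 hw
      set t := w j - e + l with ht
      have ht0 : 0 ≤ t := by linarith
      set i := ⌊t / (2 * ρ)⌋₊ with hi
      have hi1 : (i : ℝ) ≤ t / (2 * ρ) := Nat.floor_le (by positivity)
      have hi2 : t / (2 * ρ) < i + 1 := Nat.lt_floor_add_one _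
      rw [le_div_iff₀ (by positivity)] at hi1
      rw [div_lt_iff₀ (by positivity)] at hi2
      have hiN : i ∈ Finset.range N := by
        rw [Finset.mem_range, hN, Nat.lt_succ_iff]
        apply Nat.floor_mono
        rw [div_le_div_iff₀ (by positivity) hρ]
        nlinarith
      have : slab j (e - l + (2 * i + 1) * ρ) ρ w = 1 := by
        apply slab_of_mem
        rw [abs_le]
        constructor <;> linarith
      refine this.symm.le.trans ?_
      exact Finset.single_le_sum (f := fun i : ℕ => slab j (e - l + (2 * i + 1) * ρ) ρ w)
        (fun i _ => slab_nonneg _ _ _ _) hiN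
    · rw [slab_of_not_mem hw]
      exact Finset.sum_nonneg fun i _ => slab_nonneg _ _ _ _
  have h2 := ha.mono h1 z
  rw [Finset.smul_sum, BM.sum_apply] at h2
  refine h2.trans ((Finset.sum_le_sum fun i _ => hq _ z).trans ?_)
  rw [Finset.sum_const, Finset.card_range, nsmul_eq_mul]
  apply mul_le_mul_of_nonneg_right _ hq0
  rw [hN]; push_cast
  have := Nat.floor_le (div_nonneg hl hρ.le)
  linarith

end
end ZB

open MeasureTheory

namespace ZB

noncomputable section

variable {ι : Type} [Fintype ι]

theorem Bdd.one : Bdd (1 : Op ι) 1 := Mk.one.Bdd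

theorem Bdd.pow {a : Op ι} {c : ℝ} (h : Bdd a c) (n : ℕ) : Bdd (a ^ n) (c ^ n) := by
  induction n with
  | zero => simpa using Bdd.one
  | succ n ih => rw [pow_succ, pow_succ]; exact ih.mul h

theorem binom_inv {p q : ℝ} (hp : 0 < p) (hq : 0 ≤ q) (hpq : p + q = 1) (n : ℕ) :
    ∑ k ∈ Finset.range (n + 1), (p ^ k * q ^ (n - k) * n.choose k) * (1 / ((k : ℝ) + 1))
      ≤ 1 / ((n + 1) * p) := by
  have h1 : ∑ k ∈ Finset.range (n + 2), p ^ k * q ^ (n + 1 - k) * ((n + 1).choose k : ℝ) = 1 := by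
    rw [← add_pow, hpq, one_pow]
  rw [Finset.sum_range_succ'] at h1
  have h2 : ∀ k ∈ Finset.range (n + 1), (p ^ k * q ^ (n - k) * n.choose k) * (1 / ((k : ℝ) + 1))
      = 1 / ((n + 1) * p) * (p ^ (k + 1) * q ^ (n + 1 - (k + 1)) * ((n + 1).choose (k + 1) : ℝ)) := by
    intro k _
    have := Nat.add_one_mul_choose_eq n k
    have h3 : ((n : ℝ) + 1) * n.choose k = ((n + 1).choose (k + 1) : ℝ) * (k + 1) := by exact_mod_cast this
    rw [Nat.add_sub_add_right, pow_succ]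
    have hk : (0:ℝ) < k + 1 := by positivity
    have hn : (0:ℝ) < n + 1 := by positivity
    field_simp
    linear_combination (q ^ (n - k)) * h3
  rw [Finset.sum_congr rfl h2, ← Finset.mul_sum]
  have h3 : 0 ≤ p ^ 0 * q ^ (n + 1 - 0) * ((n + 1).choose 0 : ℝ) := by positivity
  calc _ ≤ 1 / ((n + 1) * p) * 1 := by
        apply mul_le_mul_of_nonneg_left _ (by positivity); linarith
    _ = _ := mul_one _

theorem binom_lin {p q : ℝ} (hpq : p + q = 1) (n : ℕ) :
    ∑ k ∈ Finset.range (n + 1), (p ^ k * q ^ (n - k) * n.choose k) * ((n : ℝ) - k) = n * q := by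
  cases n with
  | zero => simp
  | succ n =>
    rw [Finset.sum_range_succ]
    have h1 : ∑ k ∈ Finset.range (n + 1), p ^ k * q ^ (n - k) * (n.choose k : ℝ) = 1 := by
      rw [← add_pow, hpq, one_pow]
    have h2 : ∀ k ∈ Finset.range (n + 1), (p ^ k * q ^ (n + 1 - k) * ((n + 1).choose k : ℝ))
        * (((n + 1 : ℕ) : ℝ) - k) = (((n + 1 : ℕ) : ℝ) * q) * (p ^ k * q ^ (n - k) * (n.choose k : ℝ)) := by
      intro k hk
      have hk' : k ≤ n := by simpa [Nat.lt_succ_iff] using hk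
      have := Nat.choose_mul_succ_eq n k
      have h3 : (n.choose k : ℝ) * (n + 1) = ((n + 1).choose k : ℝ) * (n + 1 - k) := by
        have h4 : ((n + 1 - k : ℕ) : ℝ) = n + 1 - k := by rw [Nat.cast_sub (by omega)]; push_cast; ring
        rw [← h4]; exact_mod_cast this
      rw [show n + 1 - k = (n - k) + 1 by omega, pow_succ]
      push_cast
      linear_combination (- (p ^ k * q ^ (n - k) * q)) * h3
    rw [Finset.sum_congr rfl h2, ← Finset.mul_sum, h1]
    simp

theorem binom_one {p q : ℝ} (hpq : p + q = 1) (n : ℕ) :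
    ∑ k ∈ Finset.range (n + 1), (p ^ k * q ^ (n - k) * (n.choose k : ℝ)) = 1 := by
  rw [← add_pow, hpq, one_pow]

/-- double binomial mixing -/
theorem dbl {h hs b h' hs' b' : Op ι} {p q : ℝ} (hp : 0 < p) (hq : 0 ≤ q) (hpq : p + q = 1)
    (hh : h = p • hs + b) (hh' : h' = p • hs' + b') (m1 : Mk hs) (m2 : Mk hs')
    (b1 : Bdd b q) (b2 : Bdd b' q) {n : ℕ} {G : BM ι} {D1 D2 D3 : ℝ} (hD1 : 0 ≤ D1)
    (hD3 : 0 ≤ D3)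
    (hG : ∀ k ≤ n, ∀ z, |((hs * hs') ^ k • G) z| ≤ D1 / (k + 1) + D2 + D3 * (n - k)) (z) :
    |((h * h') ^ n • G) z| ≤ 2 * D1 / ((n + 1) * p) + D2 + 2 * D3 * n * q := by
  set β : ℕ → ℝ := fun k => p ^ k * q ^ (n - k) * (n.choose k : ℝ) with hβ
  have hβ0 : ∀ k, 0 ≤ β k := fun k => by simp only [hβ]; positivity
  have hexp : (h * h') ^ n = ∑ k ∈ Finset.range (n + 1), ∑ l ∈ Finset.range (n + 1),
      ((p ^ k * (n.choose k : ℝ)) * (p ^ l * (n.choose l : ℝ))) •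
        (b ^ (n - k) * b' ^ (n - l) * (hs ^ k * hs' ^ l)) := by
    rw [mul_pow, hh, hh', add_pow, add_pow, Finset.sum_mul_sum]
    refine Finset.sum_congr rfl fun k _ => Finset.sum_congr rfl fun l _ => ?_
    have e1 : ((n.choose k : ℕ) : Op ι) = (n.choose k : ℝ) • (1 : Op ι) := by
      rw [Nat.cast_smul_eq_nsmul ℝ, nsmul_eq_mul, mul_one]
    have e2 : ((n.choose l : ℕ) : Op ι) = (n.choose l : ℝ) • (1 : Op ι) := by
      rw [Nat.cast_smul_eq_nsmul ℝ, nsmul_eq_mul, mul_one]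
    rw [e1, e2, smul_pow, smul_pow]
    simp only [smul_mul_assoc, mul_smul_comm, smul_smul, mul_one]
    congr 1
    · ring
    · ring
  have hterm : ∀ k ∈ Finset.range (n + 1), ∀ l ∈ Finset.range (n + 1),
      |((((p ^ k * (n.choose k : ℝ)) * (p ^ l * (n.choose l : ℝ))) •
        (b ^ (n - k) * b' ^ (n - l) * (hs ^ k * hs' ^ l))) • G) z| ≤
      β k * β l * (D1 * (1 / (k + 1)) + D1 * (1 / (l + 1)) + D2 + D3 * (n - k) + D3 * (n - l)) := by
    intro k hk l hl
    have hk' : k ≤ n := by simpa [Nat.lt_succ_iff] using hk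
    have hl' : l ≤ n := by simpa [Nat.lt_succ_iff] using hl
    have hkr : (k : ℝ) ≤ n := by exact_mod_cast hk'
    have hlr : (l : ℝ) ≤ n := by exact_mod_cast hl'
    obtain ⟨x, κ, hx, hκ, he, hor⟩ : ∃ (x : Op ι) (κ : ℕ), Mk x ∧ κ ≤ n ∧
        hs ^ k * hs' ^ l = x * (hs * hs') ^ κ ∧ (κ = k ∨ κ = l) := by
      rcases le_total k l with hkl | hkl
      · refine ⟨hs' ^ (l - k), k, m2.pow _, hk', ?_, Or.inl rfl⟩
        obtain ⟨d, rfl⟩ := Nat.exists_eq_add_of_le hkl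
        rw [Nat.add_sub_cancel_left, pow_add]; ring
      · refine ⟨hs ^ (k - l), l, m1.pow _, hl', ?_, Or.inr rfl⟩
        obtain ⟨d, rfl⟩ := Nat.exists_eq_add_of_le hkl
        rw [Nat.add_sub_cancel_left, pow_add]; ring
    have hb := (((b1.pow (n - k)).mul (b2.pow (n - l))).mul hx.Bdd).abs_le (hG κ hκ) z
    have e5 : (b ^ (n - k) * b' ^ (n - l) * (hs ^ k * hs' ^ l)) • G =
        (b ^ (n - k) * b' ^ (n - l) * x) • ((hs * hs') ^ κ • G) := by
      rw [he, ← mul_smul]; ring_nf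
    rw [smul_assoc, BM.smul_apply, e5, abs_mul, abs_of_nonneg (by positivity)]
    have hD : D1 / ((κ : ℝ) + 1) + D2 + D3 * (n - κ) ≤
        D1 * (1 / (k + 1)) + D1 * (1 / (l + 1)) + D2 + D3 * (n - k) + D3 * (n - l) := by
      have a1 : 0 ≤ D1 * (1 / ((k : ℝ) + 1)) := by positivity
      have a2 : 0 ≤ D1 * (1 / ((l : ℝ) + 1)) := by positivity
      have a3 : 0 ≤ D3 * ((n : ℝ) - k) := mul_nonneg hD3 (by linarith)
      have a4 : 0 ≤ D3 * ((n : ℝ) - l) := mul_nonneg hD3 (by linarith)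
      rcases hor with rfl | rfl <;> rw [div_eq_mul_one_div] <;> linarith
    calc _ ≤ p ^ k * (n.choose k : ℝ) * (p ^ l * (n.choose l : ℝ)) *
          (q ^ (n - k) * q ^ (n - l) * 1 * (D1 / ((κ : ℝ) + 1) + D2 + D3 * (n - κ))) := by
          apply mul_le_mul_of_nonneg_left hb (by positivity)
      _ = β k * β l * (D1 / ((κ : ℝ) + 1) + D2 + D3 * (n - κ)) := by simp only [hβ]; ring
      _ ≤ _ := mul_le_mul_of_nonneg_left hD (mul_nonneg (hβ0 _) (hβ0 _))
  rw [hexp, Finset.sum_smul, BM.sum_apply]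
  refine (Finset.abs_sum_le_sum_abs _ _).trans ?_
  have hs1 : ∑ k ∈ Finset.range (n + 1), β k = 1 := binom_one hpq n
  set S := ∑ k ∈ Finset.range (n + 1), β k * (1 / ((k : ℝ) + 1)) with hS
  have hS1 : S ≤ 1 / ((n + 1) * p) := binom_inv hp hq hpq n
  have hL : ∑ k ∈ Finset.range (n + 1), β k * ((n : ℝ) - k) = n * q := binom_lin hpq n
  have hrow : ∀ k ∈ Finset.range (n + 1),
      |((∑ l ∈ Finset.range (n + 1), ((p ^ k * (n.choose k : ℝ)) * (p ^ l * (n.choose l : ℝ))) •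
        (b ^ (n - k) * b' ^ (n - l) * (hs ^ k * hs' ^ l))) • G) z| ≤
      D1 * (β k * (1 / (k + 1))) + D1 * S * β k + D2 * β k + D3 * (β k * (n - k)) + D3 * (n * q) * β k := by
    intro k hk
    rw [Finset.sum_smul, BM.sum_apply]
    refine (Finset.abs_sum_le_sum_abs _ _).trans ((Finset.sum_le_sum (hterm k hk)).trans (le_of_eq ?_))
    have : ∀ l : ℕ, β k * β l * (D1 * (1 / (k + 1)) + D1 * (1 / (l + 1)) + D2 + D3 * (n - k) + D3 * (n - l))
      = (β k * (D1 * (1 / (k + 1)) + D2 + D3 * (n - k))) * β l + (β k * D1) * (β l * (1 / (l + 1)))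
        + (β k * D3) * (β l * (n - l)) := fun l => by ring
    simp only [this]
    rw [Finset.sum_add_distrib, Finset.sum_add_distrib, ← Finset.mul_sum, ← Finset.mul_sum,
      ← Finset.mul_sum, hs1, hL, ← hS]
    ring
  refine (Finset.sum_le_sum hrow).trans ?_
  simp only [Finset.sum_add_distrib]
  rw [← Finset.mul_sum, ← Finset.mul_sum, ← Finset.mul_sum, ← Finset.mul_sum, ← Finset.mul_sum, hs1, hL,
    ← hS]
  have : D1 * S ≤ D1 * (1 / ((n + 1) * p)) := mul_le_mul_of_nonneg_left hS1 hD1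
  calc _ ≤ D1 * (1 / ((n + 1) * p)) + D1 * (1 / ((n + 1) * p)) * 1 + D2 * 1 + D3 * (n * q)
        + D3 * (n * q) * 1 := by linarith
    _ = _ := by ring

/-- relation between a measure and its conditioning -/
structure Cnd (H Hs : Measure (ι → ℝ)) [IsProbabilityMeasure H] [IsProbabilityMeasure Hs] (p : ℝ) :
    Prop where
  pos : 0 < p
  le : p ≤ 1
  nice : Nice H → Nice Hs
  P1 : Pos (km H - p • km Hs)
  P2 : Pos (kr H - p • kr Hs)
  B1 : Bdd (km H - p • km Hs) (1 - p)
  B2 : Bdd (kr H - p • kr Hs) (1 - p)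
  E1 : Bdd (km Hs - km H) (2 * (1 - p))
  E2 : Bdd (kr Hs - kr H) (2 * (1 - p))
  F1 : ∀ n : ℕ, Bdd ((km Hs - km H) * km H ^ n) (√((1 - p) / (p * (n + 1))))
  F2 : ∀ n : ℕ, Bdd ((kr Hs - kr H) * kr H ^ n) (√((1 - p) / (p * (n + 1))))

theorem cnd_aux (H : Measure (ι → ℝ)) [IsProbabilityMeasure H] {s : Set (ι → ℝ)} (hs : MeasurableSet s)
    (Hs : Measure (ι → ℝ)) [IsProbabilityMeasure Hs] (hHs : Hs = ProbabilityTheory.cond H s)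
    (hp : 0 < H.real s) (P : (ι → ℝ) → ι → ℝ) (hP : Measurable P) :
    Pos (ku H P hP - H.real s • ku Hs P hP) ∧ Bdd (ku H P hP - H.real s • ku Hs P hP) (1 - H.real s) ∧
    Bdd (ku Hs P hP - ku H P hP) (2 * (1 - H.real s)) ∧
    ∀ n : ℕ, Bdd ((ku Hs P hP - ku H P hP) * ku H P hP ^ n) (√((1 - H.real s) / (H.real s * (n + 1)))) := by
  set p := H.real s with hpdef
  have hp1 : p ≤ 1 := measureReal_le_one
  have hIntg : ∀ f : (ι → ℝ) → ℝ, ∫ x, f x ∂Hs = p⁻¹ * ∫ x, s.indicator f x ∂H := by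
    intro f
    rw [hHs, ProbabilityTheory.cond, integral_smul_measure, integral_indicator hs, ENNReal.toReal_inv]
    rfl
  -- weights
  have hb : ku H P hP - p • ku Hs P hP = ker H P hP (sᶜ.indicator (fun _ => 1))
      (measurable_const.indicator hs.compl) ((integrable_const 1).indicator hs.compl) := by
    apply Op.ext
    intro f z
    rw [sub_smul, BM.sub_apply, smul_assoc, BM.smul_apply, ku_apply, ku_apply, ker_apply, hIntg,
      ← mul_assoc, mul_inv_cancel₀ hp.ne', one_mul,
      ← integral_sub (f.integrable H hP z) ((f.integrable H hP z).indicator hs)]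
    congr 1; ext x
    by_cases hx : x ∈ s <;> simp [hx]
  set φ : (ι → ℝ) → ℝ := fun x => p⁻¹ * s.indicator (fun _ => 1) x - 1 with hφ
  have hm : Measurable φ := ((measurable_const.indicator hs).const_mul _).sub_const _
  have hi : Integrable φ H := (((integrable_const (1:ℝ)).indicator hs).const_mul _).sub (integrable_const 1)
  have hsi : ∫ x, s.indicator (fun _ => (1:ℝ)) x ∂H = p := by
    rw [integral_indicator hs]; simp [hpdef]
  have hii : Integrable (fun x => s.indicator (fun _ => (1:ℝ)) x) H := (integrable_const (1:ℝ)).indicator hs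
  have hd : ku Hs P hP - ku H P hP = ker H P hP φ hm hi := by
    apply Op.ext
    intro f z
    rw [sub_smul, BM.sub_apply, ku_apply, ku_apply, ker_apply, hIntg, ← integral_const_mul,
      ← integral_sub (((f.integrable H hP z).indicator hs).const_mul _) (f.integrable H hP z)]
    congr 1; ext x
    by_cases hx : x ∈ s <;> simp [hx, hφ]; ring
  have h0 : ∫ x, φ x ∂H = 0 := by
    simp only [hφ]
    rw [integral_sub (hii.const_mul _) (integrable_const 1), integral_const_mul, hsi]
    simp [inv_mul_cancel₀ hp.ne']
  have hsqe : (fun x => φ x ^ 2) = fun x => (p⁻¹ ^ 2 - 2 * p⁻¹) * s.indicator (fun _ => (1:ℝ)) x + 1 := by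
    ext x
    by_cases hx : x ∈ s
    · simp only [hφ, Set.indicator_of_mem hx]; ring
    · simp only [hφ, Set.indicator_of_notMem hx]; ring
  have hi2 : Integrable (fun x => φ x ^ 2) H := by
    rw [hsqe]; exact (hii.const_mul _).add (integrable_const 1)
  have hv : ∫ x, φ x ^ 2 ∂H = (1 - p) / p := by
    rw [hsqe, integral_add (hii.const_mul _) (integrable_const 1), integral_const_mul, hsi]
    simp
    field_simp
    ring
  have habs : ∫ x, |φ x| ∂H = 2 * (1 - p) := by
    have : (fun x => |φ x|) = fun x => (p⁻¹ - 2) * s.indicator (fun _ => (1:ℝ)) x + 1 := by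
      ext x
      by_cases hx : x ∈ s
      · simp only [hφ, Set.indicator_of_mem hx]
        have : 1 ≤ p⁻¹ := (one_le_inv₀ hp).2 hp1
        rw [abs_of_nonneg (by linarith)]; ring
      · simp only [hφ, Set.indicator_of_notMem hx]; norm_num
    rw [this, integral_add (hii.const_mul _) (integrable_const 1), integral_const_mul, hsi]
    simp
    field_simp
    ring
  refine ⟨?_, ?_, ?_, ?_⟩
  · rw [hb]
    intro f hf z
    rw [ker_apply]
    exact integral_nonneg fun x => mul_nonneg (Set.indicator_nonneg (fun _ _ => zero_le_one) _) (hf _)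
  · rw [hb]
    refine (Bdd.ker H P hP _ _ _).mono (le_of_eq ?_)
    have : ∀ x, |sᶜ.indicator (fun _ => (1:ℝ)) x| = 1 - s.indicator (fun _ => (1:ℝ)) x := by
      intro x; by_cases hx : x ∈ s <;> simp [hx]
    simp only [this]
    rw [integral_sub (integrable_const 1) hii, hsi]; simp
  · rw [hd, ← habs]; exact Bdd.ker H P hP _ _ _
  · intro n
    rw [hd]
    have := Bdd_rep' H P hP φ hm hi hi2 h0 n
    rw [hv] at this
    rw [← div_div]
    exact this

theorem cnd (H : Measure (ι → ℝ)) [IsProbabilityMeasure H] {s : Set (ι → ℝ)} (hs : MeasurableSet s)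
    (hp : 0 < H.real s) : ∃ (Hs : Measure (ι → ℝ)) (_ : IsProbabilityMeasure Hs),
      Cnd H Hs (H.real s) ∧ (∀ᵐ x ∂Hs, x ∈ s) ∧ 
      (∀ f : (ι → ℝ) → ℝ, ∫ x, f x ∂Hs = (H.real s)⁻¹ * ∫ x in s, f x ∂H) := by
  have hne : H s ≠ 0 := by
    intro h; rw [measureReal_def, h] at hp; simp at hp
  have hprob : IsProbabilityMeasure (ProbabilityTheory.cond H s) := ProbabilityTheory.cond_isProbabilityMeasure hne
  refine ⟨ProbabilityTheory.cond H s, hprob, ?_, ProbabilityTheory.ae_cond_mem hs, ?_⟩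
  · have h1 := cnd_aux H hs _ rfl hp id measurable_id
    have h2 := cnd_aux H hs _ rfl hp (fun x => -x) meas_neg
    refine ⟨hp, measureReal_le_one, ?_, h1.1, h2.1, h1.2.1, h2.2.1, h1.2.2.1, h2.2.2.1, h1.2.2.2, h2.2.2.2⟩
    intro hH
    have hac : ProbabilityTheory.cond H s ≪ H := ProbabilityTheory.cond_absolutelyContinuous
    refine ⟨?_, fun i c => hac (hH.noatom i c)⟩
    obtain ⟨B, hB⟩ := hH.bdd
    exact ⟨B, hac.ae_le hB⟩
  · intro f
    rw [ProbabilityTheory.cond, integral_smul_measure, ENNReal.toReal_inv]; rfl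

section cndsec
variable {H Hs : Measure (ι → ℝ)} [IsProbabilityMeasure H] [IsProbabilityMeasure Hs] {p : ℝ}

theorem AA_split (H Hs : Measure (ι → ℝ)) [IsProbabilityMeasure H] [IsProbabilityMeasure Hs] :
    AA H = AA Hs + ((km Hs - km H) * kr Hs + km H * (kr Hs - kr H)) := by
  simp only [AA, gg_eq]; ring

theorem Cnd.diff (h : Cnd H Hs p) : Bdd (AA H - AA Hs) (4 * (1 - p)) := by
  rw [AA_split H Hs, add_sub_cancel_left]
  exact ((h.E1.mul (Mk.kr Hs).Bdd).add ((Mk.km H).Bdd.mul h.E2)).mono (by linarith)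

theorem Cnd.dbl (h : Cnd H Hs p) {n : ℕ} {G : BM ι} {D1 D2 D3 : ℝ} (hD1 : 0 ≤ D1)
    (hD3 : 0 ≤ D3)
    (hG : ∀ k ≤ n, ∀ z, |(gg Hs ^ k • G) z| ≤ D1 / (k + 1) + D2 + D3 * (n - k)) (z) :
    |(gg H ^ n • G) z| ≤ 2 * D1 / ((n + 1) * p) + D2 + 2 * D3 * n * (1 - p) := by
  rw [gg_eq]
  refine ZB.dbl h.pos (sub_nonneg.2 h.le) (by ring) (b := km H - p • km Hs) (b' := kr H - p • kr Hs)
    (by abel) (by abel) (Mk.km Hs) (Mk.kr Hs) h.B1 h.B2 hD1 hD3 (fun k hk z => ?_) z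
  rw [← gg_eq]; exact hG k hk z

theorem Pos.one : Pos (1 : Op ι) := Mk.one.1

theorem Pos.pow {x : Op ι} (h : Pos x) (n : ℕ) : Pos (x ^ n) := by
  induction n with
  | zero => rw [pow_zero]; exact Pos.one
  | succ n ih => rw [pow_succ]; exact ih.mul h

theorem Pos.pow_sub {x y : Op ι} (hx : Pos x) (hy : Pos y) (h : Pos (x - y)) (n : ℕ) :
    Pos (x ^ n - y ^ n) := by
  induction n with
  | zero => intro f _ z; simp
  | succ n ih =>
    have : x ^ (n + 1) - y ^ (n + 1) = x ^ n * (x - y) + (x ^ n - y ^ n) * y := by ring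
    rw [this]
    exact ((hx.pow n).mul h).add (ih.mul hy)

theorem Cnd.gpow (h : Cnd H Hs p) (n : ℕ) {f : BM ι} (hf : ∀ z, 0 ≤ f z) (z) :
    p ^ (2 * n) * (gg Hs ^ n • f) z ≤ (gg H ^ n • f) z := by
  have h1 : Pos (gg H - (p ^ 2) • gg Hs) := by
    have : gg H - (p ^ 2) • gg Hs = km H * (kr H - p • kr Hs) + (km H - p • km Hs) * (p • kr Hs) := by
      rw [gg_eq, gg_eq]
      simp only [mul_sub, sub_mul, mul_smul_comm, smul_mul_assoc, smul_sub, smul_smul, sq]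
      abel
    rw [this]
    exact ((Mk.km H).1.mul h.P2).add (h.P1.mul ((Mk.kr Hs).1.smul h.pos.le))
  have h2 := Pos.pow_sub (Mk.gg H).1 ((Mk.gg Hs).1.smul (sq_nonneg p)) h1 n f hf z
  rw [sub_smul, BM.sub_apply, smul_pow, smul_assoc, BM.smul_apply, ← pow_mul] at h2
  linarith

theorem inv_sqrt_le {a y : ℝ} (ha : 0 < a) (hy : 0 < y) : 1 / √a ≤ (1 / y + y / a) / 2 := by
  have hs : 0 < √a := Real.sqrt_pos.2 ha
  have e : a = √a ^ 2 := (Real.sq_sqrt ha.le).symm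
  set t := √a
  rw [e]
  have : (1 / y + y / t ^ 2) / 2 - 1 / t = (t - y) ^ 2 / (2 * y * t ^ 2) := by field_simp; ring
  have h2 : 0 ≤ (t - y) ^ 2 / (2 * y * t ^ 2) := by positivity
  linarith

/-- cell estimate -/
theorem Cnd.cell (h : Cnd H Hs p) (hH : Nice H) {K : ℝ} (hK0 : 0 ≤ K) {N n1 n2 : ℕ} (hK : HK ι K N)
    (hn : n2 ≤ N) {j : ι} {r Λ v e : ℝ} (hr : 0 < r) (hΛ : 0 ≤ Λ)
    (hQ : ∀ e l, 0 ≤ l → ∀ z, (gg H ^ n1 • slab j e l) z ≤ Λ * (1 + l / r))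
    (hv0 : 0 < v) (hv : vv Hs j ≤ v) {f : BM ι} (hf : MB j e r f) (z) :
    |((gg H ^ (n1 + n2) * AA H) • f) z| ≤ 4 * Λ * √((1 - p) / (p * (n2 + 1)))
      + 60 * (K + 1) * Λ * (1 / ((n2 + 1) * p) + √v / r / √((n2 + 1) * p)) := by
  have hp := h.pos
  set ν := gg H ^ n1 with hν
  have mν : Mk ν := (Mk.gg H).pow n1
  set s := √((1 - p) / (p * (n2 + 1))) with hs
  have hn2 : (0:ℝ) < n2 + 1 := by positivity
  have hfQ : ∀ z, (ν • ab f) z ≤ 2 * Λ := by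
    intro z
    refine (mν.1.mono (fun w => hf.abs_le w) z).trans ((hQ e r hr.le z).trans (le_of_eq ?_))
    field_simp; norm_num
  have t2 : |((ν * ((km Hs - km H) * km H ^ n2 * (kr H ^ n2 * kr Hs))) • f) z| ≤ s * (1 * 1) * (2 * Λ) := by
    refine (mν.1.abs_smul _ _ z).trans ?_
    exact ((h.F1 n2).mul (((Mk.kr H).pow n2).Bdd.mul (Mk.kr Hs).Bdd)).ab_le mν.1 hfQ z
  have t3 : |((ν * ((kr Hs - kr H) * kr H ^ n2 * (km H ^ n2 * km H))) • f) z| ≤ s * (1 * 1) * (2 * Λ) := by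
    refine (mν.1.abs_smul _ _ z).trans ?_
    exact ((h.F2 n2).mul (((Mk.km H).pow n2).Bdd.mul (Mk.km H).Bdd)).ab_le mν.1 hfQ z
  set y := √((n2 + 1) * p) with hy
  have hy0 : 0 < y := Real.sqrt_pos.2 (by positivity)
  have hy2 : y ^ 2 = (n2 + 1) * p := Real.sq_sqrt (by positivity)
  set s0 := √v / r with hs0
  have hs00 : 0 < s0 := div_pos (Real.sqrt_pos.2 hv0) hr
  have t1 : |(gg H ^ n2 • ((ν * AA Hs) • f)) z| ≤
      2 * (2 * (K + 1) * Λ * (15 + 7 * s0 * y)) / ((n2 + 1) * p) + 2 * (K + 1) * Λ * (7 * s0 / y)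
        + 2 * 0 * n2 * (1 - p) := by
    refine h.dbl (by positivity) le_rfl (fun k hk z => ?_) z
    have hk1 : (0:ℝ) < k + 1 := by positivity
    have hsk : 0 < √((k + 1) * v) := Real.sqrt_pos.2 (by positivity)
    have hLL := (h.nice hH).LL hK (hk.trans hn) hK0 (σ := r + √((k + 1) * v)) hr (by linarith) (by
        have : ((k:ℝ) + 1) * vv Hs j ≤ √((k + 1) * v) ^ 2 := by
          rw [Real.sq_sqrt (by positivity)]; gcongr
        nlinarith) mν (fun z => hQ e _ (by positivity) z) hf z
    rw [← mul_smul, mul_comm, mul_assoc, mul_comm (AA Hs)]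
    refine (mν.1.abs_smul _ _ z).trans (hLL.trans ?_)
    have e1 : √((k + 1) * v) = √v * √(k + 1) := by rw [mul_comm, Real.sqrt_mul hv0.le]
    have e2 : (1 + 14 * (r + √((k + 1) * v)) / r) / (k + 1) = 15 / (k + 1) + 14 * s0 * (1 / √(k + 1)) := by
      rw [e1, hs0]
      have h3 : √((k:ℝ) + 1) ^ 2 = k + 1 := Real.sq_sqrt hk1.le
      have h4 : 0 < √((k:ℝ) + 1) := Real.sqrt_pos.2 hk1
      rw [← h3]
      rw [Real.sqrt_sq h4.le]
      field_simp
      ring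
    have h5 := inv_sqrt_le hk1 hy0
    calc 2 * (K + 1) * (Λ * (1 + 14 * (r + √((k + 1) * v)) / r)) / (k + 1)
        = 2 * (K + 1) * Λ * ((1 + 14 * (r + √((k + 1) * v)) / r) / (k + 1)) := by ring
      _ = 2 * (K + 1) * Λ * (15 / (k + 1) + 14 * s0 * (1 / √(k + 1))) := by rw [e2]
      _ ≤ 2 * (K + 1) * Λ * (15 / (k + 1) + 14 * s0 * ((1 / y + y / (k + 1)) / 2)) := by gcongr
      _ = _ := by field_simp; ring
  have hsplit : gg H ^ (n1 + n2) * AA H = gg H ^ n2 * (ν * AA Hs)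
      + ν * ((km Hs - km H) * km H ^ n2 * (kr H ^ n2 * kr Hs))
      + ν * ((kr Hs - kr H) * kr H ^ n2 * (km H ^ n2 * km H)) := by
    rw [AA_split H Hs, pow_add, hν]
    have : gg H ^ n2 = km H ^ n2 * kr H ^ n2 := by rw [gg_eq, mul_pow]
    rw [this]; ring
  rw [hsplit, add_smul, add_smul, BM.add_apply, BM.add_apply, mul_smul (gg H ^ n2)]
  refine (abs_add_le _ _).trans ?_
  refine (add_le_add ((abs_add_le _ _).trans (add_le_add t1 t2)) t3).trans ?_
  have hA : 2 * (2 * (K + 1) * Λ * (15 + 7 * s0 * y)) / ((n2 + 1) * p) + 2 * (K + 1) * Λ * (7 * s0 / y)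
      ≤ 60 * (K + 1) * Λ * (1 / ((n2 + 1) * p) + s0 / y) := by
    rw [← hy2]
    have : 2 * (2 * (K + 1) * Λ * (15 + 7 * s0 * y)) / y ^ 2 + 2 * (K + 1) * Λ * (7 * s0 / y)
        = (K + 1) * Λ * (60 * (1 / y ^ 2) + 42 * (s0 / y)) := by field_simp; ring
    rw [this]
    have h7 : 0 ≤ (K + 1) * Λ * (18 * (s0 / y)) := by positivity
    linarith
  linarith

end cndsec

end
end ZB

open MeasureTheory
namespace ZB
noncomputable section
variable {ι : Type} [Fintype ι]

section VVsec
variable (H : Measure (ι → ℝ)) [IsProbabilityMeasure H] (j : ι)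

theorem VV_meas (ρ : ℝ) : Measurable (fun y : ι → ℝ => min ((y j / ρ) ^ 2) 1) := by fun_prop

theorem VV_int (ρ : ℝ) : Integrable (fun y : ι → ℝ => min ((y j / ρ) ^ 2) 1) (sm H) := by
  refine Integrable.of_bound (VV_meas j ρ).aestronglyMeasurable 1 (Filter.Eventually.of_forall fun y => ?_)
  rw [Real.norm_eq_abs, abs_of_nonneg (le_min (sq_nonneg _) zero_le_one)]
  exact min_le_right _ _

theorem VV_nonneg (ρ : ℝ) : 0 ≤ VV H j ρ := integral_nonneg fun _ => le_min (sq_nonneg _) zero_le_one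

theorem VV_le_one (ρ : ℝ) : VV H j ρ ≤ 1 := by
  have := integral_mono (VV_int H j ρ) (integrable_const (1:ℝ)) (fun y => min_le_right _ _)
  simpa [VV] using this

theorem VV_anti {ρ ρ' : ℝ} (h0 : 0 < ρ) (h : ρ ≤ ρ') : VV H j ρ' ≤ VV H j ρ := by
  refine integral_mono (VV_int H j ρ') (VV_int H j ρ) fun y => ?_
  refine min_le_min_right _ ?_
  rw [div_pow, div_pow]
  gcongr

theorem VV_half (ρ : ℝ) : VV H j (ρ / 2) ≤ 4 * VV H j ρ := by
  unfold VV
  rw [← integral_const_mul]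
  refine integral_mono (VV_int H j _) ((VV_int H j ρ).const_mul 4) fun y => ?_
  have : (y j / (ρ / 2)) ^ 2 = 4 * (y j / ρ) ^ 2 := by
    rw [div_div_eq_mul_div]; ring
  simp only [this]
  rcases le_total ((y j / ρ) ^ 2) 1 with h | h
  · rw [min_eq_left h]; exact min_le_left _ _
  · rw [min_eq_right h]; exact (min_le_right _ _).trans (by norm_num)

theorem VV_small (hH : Nice H) {x : ℝ} (hx : 0 < x) : ∃ ρ, 0 < ρ ∧ VV H j ρ ≤ x := by
  obtain ⟨B, hB0, hB⟩ := hH.sm_bdd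
  refine ⟨(B + 1) / √x, by positivity, ?_⟩
  have h1 : VV H j ((B + 1) / √x) ≤ ∫ _, x ∂(sm H) := by
    refine integral_mono_ae (VV_int H j _) (integrable_const _) ?_
    filter_upwards [hB] with y hy
    refine (min_le_left _ _).trans ?_
    rw [div_div_eq_mul_div, div_pow, mul_pow, Real.sq_sqrt hx.le, div_le_iff₀ (by positivity), mul_comm]
    apply mul_le_mul_of_nonneg_left _ hx.le
    rw [← sq_abs (y j)]
    exact pow_le_pow_left₀ (abs_nonneg _) ((hy j).trans (by linarith)) 2
  simpa using h1

theorem sm_noatom (hH : Nice H) : ∀ᵐ y ∂(sm H), y j ≠ 0 := by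
  rw [sm, ae_map_iff meas_sub.aemeasurable]
  · rw [Measure.ae_prod_iff_ae_ae]
    · refine Filter.Eventually.of_forall fun a => ?_
      rw [ae_iff]
      have := hH.noatom j (a j)
      refine measure_mono_null (fun b hb => ?_) this
      simp only [Set.mem_ofPred_eq, not_not, ne_eq, Pi.sub_apply] at hb ⊢
      linarith
    · exact ((measurable_pi_apply j).comp meas_sub) (measurableSet_singleton (0:ℝ)).compl
  · exact (measurableSet_eq_fun (measurable_pi_apply j) measurable_const).compl

theorem VV_big (hH : Nice H) {ρ : ℝ} (hρ : 0 < ρ) : ∃ k0 : ℕ, ∀ k ≥ k0, 1 / 32 < VV H j (ρ / 2 ^ k) := by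
  have h : Filter.Tendsto (fun k : ℕ => VV H j (ρ / 2 ^ k)) Filter.atTop (nhds (∫ _, (1:ℝ) ∂(sm H))) := by
    refine tendsto_integral_of_dominated_convergence (fun _ => 1) (fun k => (VV_meas j _).aestronglyMeasurable)
      (integrable_const _) (fun k => Filter.Eventually.of_forall fun y => ?_) ?_
    · rw [Real.norm_eq_abs, abs_of_nonneg (le_min (sq_nonneg _) zero_le_one)]
      exact min_le_right _ _
    · filter_upwards [sm_noatom H j hH] with y hy
      have h2 : Filter.Tendsto (fun k : ℕ => (2:ℝ) ^ k) Filter.atTop Filter.atTop :=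
        tendsto_pow_atTop_atTop_of_one_lt (by norm_num)
      apply tendsto_const_nhds.congr'
      have h3 := h2.eventually_ge_atTop (ρ / |y j|)
      filter_upwards [h3] with k hk
      have hy' : 0 < |y j| := abs_pos.2 hy
      rw [min_eq_right]
      rw [div_div_eq_mul_div, ← sq_abs, abs_div, abs_mul, abs_of_pos hρ, abs_of_pos (by positivity : (0:ℝ) < 2 ^ k)]
      apply one_le_pow₀
      rw [le_div_iff₀ hρ]
      rw [div_le_iff₀ hy'] at hk
      linarith
  simp only [integral_const, probReal_univ, smul_eq_mul, mul_one] at h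
  have := h.eventually (lt_mem_nhds (by norm_num : (1:ℝ)/32 < 1))
  exact Filter.eventually_atTop.1 this

theorem scales (hH : Nice H) {x η : ℝ} (hx : 0 < x) (hx' : x ≤ 1 / 128) (hη : 0 < η) :
    ∃ (r1 : ℝ) (D : ℕ), 0 < r1 ∧ 1 ≤ D ∧ VV H j r1 ≤ x ∧
      (∀ a, 1 ≤ a → a ≤ D → x * (1 + η) ^ (a - 1) ≤ VV H j (r1 / 2 ^ a)) ∧
      VV H j (r1 / 2 ^ D) ≤ 1 / 32 ∧
      (VV H j (r1 / 2 ^ D / 2) ≤ (1 + η) * VV H j (r1 / 2 ^ D) ∨ 1 / 128 ≤ VV H j (r1 / 2 ^ D)) := by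
  obtain ⟨ρ0, hρ0, h0⟩ := VV_small H j hH hx
  obtain ⟨k0, hk0⟩ := VV_big H j hH hρ0
  have hex : ∃ k : ℕ, x < VV H j (ρ0 / 2 ^ k) := ⟨k0, by have := hk0 k0 le_rfl; linarith⟩
  classical
  obtain ⟨k1, hk1⟩ : ∃ k1, Nat.find hex = k1 + 1 := by
    refine Nat.exists_eq_succ_of_ne_zero fun h => ?_
    have := Nat.find_spec hex
    rw [h] at this
    simp only [pow_zero, div_one] at this
    linarith
  set r1 := ρ0 / 2 ^ k1 with hr1
  have hr10 : 0 < r1 := by positivity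
  have hV1 : VV H j r1 ≤ x := not_lt.1 (Nat.find_min hex (by omega : k1 < Nat.find hex))
  have hV2 : x < VV H j (r1 / 2 ^ 1) := by
    have := Nat.find_spec hex
    rw [hk1] at this
    rwa [hr1, div_div, ← pow_add]
  obtain ⟨k2, hk2⟩ := VV_big H j hH hr10
  have hex2 : ∃ a : ℕ, 1 ≤ a ∧ (VV H j (r1 / 2 ^ (a + 1)) ≤ (1 + η) * VV H j (r1 / 2 ^ a) ∨
      1 / 32 < VV H j (r1 / 2 ^ (a + 1))) := ⟨k2 + 1, by omega, Or.inr (hk2 _ (by omega))⟩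
  obtain ⟨hD1, hD2⟩ := Nat.find_spec hex2
  have hmin : ∀ a, 1 ≤ a → a < Nat.find hex2 → (1 + η) * VV H j (r1 / 2 ^ a) < VV H j (r1 / 2 ^ (a + 1)) ∧
      VV H j (r1 / 2 ^ (a + 1)) ≤ 1 / 32 := by
    intro a ha h
    have := Nat.find_min hex2 h
    push Not at this
    exact this ha
  set D := Nat.find hex2 with hD
  have hsucc : ∀ a, r1 / 2 ^ (a + 1) = r1 / 2 ^ a / 2 := fun a => by rw [pow_succ, ← div_div]
  refine ⟨r1, D, hr10, hD1, hV1, ?_, ?_, ?_⟩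
  · intro a ha
    induction a, ha using Nat.le_induction with
    | base => intro _; simpa using hV2.le
    | succ a ha ih =>
      intro h
      have h1 := ih (by omega)
      have h2 := (hmin a ha (by omega)).1
      have : a + 1 - 1 = (a - 1) + 1 := by omega
      rw [this, pow_succ]
      nlinarith
  · rcases Nat.lt_or_ge D 2 with h | h
    · have : D = 0 + 1 := by omega
      rw [this, hsucc]
      have := VV_half H j (r1 / 2 ^ 0)
      simp only [pow_zero, div_one] at this ⊢
      linarith
    · have := (hmin (D - 1) (by omega) (by omega)).2
      rwa [Nat.sub_add_cancel (by omega)] at this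
  · rcases hD2 with h | h
    · left; rwa [hsucc] at h
    · right
      rw [hsucc] at h
      have := VV_half H j (r1 / 2 ^ D)
      linarith

theorem center {ρ t : ℝ} (hρ : 0 < ρ) (ht : 0 < t) (ht1 : t ≤ 1) :
    ∃ x0, H.real {x | t * ρ < |x j - x0|} * t ^ 2 ≤ VV H j ρ := by
  by_contra! hcon
  have hm : MeasurableSet {y : ι → ℝ | t * ρ < |y j|} := measurableSet_lt measurable_const (by fun_prop)
  have h1 : (sm H).real {y | t * ρ < |y j|} * t ^ 2 ≤ VV H j ρ := by
    have : ∫ y, ({y : ι → ℝ | t * ρ < |y j|}.indicator (fun _ => t ^ 2) y) ∂(sm H) ≤ VV H j ρ := by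
      refine integral_mono ((integrable_const _).indicator hm) (VV_int H j ρ) fun y => ?_
      by_cases hy : t * ρ < |y j|
      · rw [Set.indicator_of_mem (by exact hy)]
        refine le_min ?_ (pow_le_one₀ ht.le ht1)
        rw [← sq_abs (y j / ρ), abs_div, abs_of_pos hρ]
        exact pow_le_pow_left₀ ht.le ((le_div_iff₀ hρ).2 hy.le) 2
      · rw [Set.indicator_of_notMem (by exact hy)]
        exact le_min (sq_nonneg _) zero_le_one
    rwa [integral_indicator_const _ hm, smul_eq_mul] at this
  have h2 : (sm H).real {y | t * ρ < |y j|} = ∫ a, H.real {x | t * ρ < |x j - a j|} ∂H := by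
    have e1 : (sm H).real {y | t * ρ < |y j|} = ∫ y, ({y : ι → ℝ | t * ρ < |y j|}.indicator (fun _ => (1:ℝ)) y) ∂(sm H) := by
      rw [integral_indicator_const _ hm]; simp
    rw [e1, integral_sm H (measurable_const.indicator hm), integral_prod_symm]
    · congr 1; ext a
      have hm' : MeasurableSet {x : ι → ℝ | t * ρ < |x j - a j|} := measurableSet_lt measurable_const (by fun_prop)
      have : ∀ x : ι → ℝ, {y : ι → ℝ | t * ρ < |y j|}.indicator (fun _ => (1:ℝ)) (x - a) =
          {x : ι → ℝ | t * ρ < |x j - a j|}.indicator (fun _ => (1:ℝ)) x := by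
        intro x; rfl
      simp only [this]
      rw [integral_indicator_const _ hm']; simp
    · refine Integrable.of_bound ((measurable_const.indicator hm).comp meas_sub).aestronglyMeasurable 1
        (Filter.Eventually.of_forall fun q => ?_)
      exact (norm_indicator_le_norm_self _ _).trans (by simp)
  rw [h2, ← integral_mul_const] at h1
  have h3 : ∫ _ : ι → ℝ, VV H j ρ ∂H < ∫ a, H.real {x | t * ρ < |x j - a j|} * t ^ 2 ∂H := by
    have hmm : Measurable (fun a : ι → ℝ => H.real {x | t * ρ < |x j - a j|}) := by
      have hS : MeasurableSet {q : (ι → ℝ) × (ι → ℝ) | t * ρ < |q.2 j - q.1 j|} :=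
        measurableSet_lt measurable_const (by fun_prop)
      exact (measurable_measure_prodMk_left hS).ennreal_toReal
    have hIntg : Integrable (fun a : ι → ℝ => H.real {x | t * ρ < |x j - a j|} * t ^ 2) H := by
      refine Integrable.mul_const (Integrable.of_bound hmm.aestronglyMeasurable 1
        (Filter.Eventually.of_forall fun a => ?_)) _
      rw [Real.norm_eq_abs, abs_of_nonneg measureReal_nonneg]; exact measureReal_le_one
    rw [← sub_pos, ← integral_sub hIntg (integrable_const _)]
    rw [integral_pos_iff_support_of_nonneg]
    · have : Function.support (fun a : ι → ℝ => H.real {x | t * ρ < |x j - a j|} * t ^ 2 - VV H j ρ) = Set.univ := by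
        ext a; simp only [Function.mem_support, Set.mem_univ, iff_true]
        have := hcon (a j); exact ne_of_gt (by linarith)
      rw [this]; simp
    · intro a; have := hcon (a j); simp only [Pi.zero_apply]; linarith
    · exact hIntg.sub (integrable_const _)
  simp at h3
  linarith

theorem sm_ae {e ρ : ℝ} (h : ∀ᵐ x ∂H, |x j - e| ≤ ρ) : ∀ᵐ y ∂(sm H), |y j| ≤ 2 * ρ := by
  rw [sm, ae_map_iff meas_sub.aemeasurable]
  · have h1 : ∀ᵐ q ∂(H.prod H), |q.1 j - e| ≤ ρ := Measure.quasiMeasurePreserving_fst.ae h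
    have h2 : ∀ᵐ q ∂(H.prod H), |q.2 j - e| ≤ ρ := Measure.quasiMeasurePreserving_snd.ae h
    filter_upwards [h1, h2] with q h1 h2
    simp only [Pi.sub_apply]
    have : q.1 j - q.2 j = (q.1 j - e) - (q.2 j - e) := by ring
    rw [this]
    exact (abs_sub _ _).trans (by linarith)
  · exact measurableSet_le (by fun_prop) measurable_const

theorem vv_le_of_ae {e ρ : ℝ} (hρ : 0 ≤ ρ) (h : ∀ᵐ x ∂H, |x j - e| ≤ ρ) : vv H j ≤ (2 * ρ) ^ 2 := by
  have h1 := sm_ae H j h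
  have : vv H j ≤ ∫ _, (2 * ρ) ^ 2 ∂(sm H) := by
    refine integral_mono_of_nonneg (Filter.Eventually.of_forall fun y => sq_nonneg _) (integrable_const _) ?_
    filter_upwards [h1] with y hy
    rw [← sq_abs]
    exact pow_le_pow_left₀ (abs_nonneg _) hy 2
  simpa using this

end VVsec

variable {H Hs : Measure (ι → ℝ)} [IsProbabilityMeasure H] [IsProbabilityMeasure Hs] {p : ℝ}

theorem Cnd.int_le (h : Cnd H Hs p) (f : BM ι) (hf : ∀ z, 0 ≤ f z) :
    p ^ 2 * ∫ y, f y ∂(sm Hs) ≤ ∫ y, f y ∂(sm H) := by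
  have := h.gpow 1 hf 0
  simpa [gg, km_apply] using this

theorem BM.integrable' (μ : Measure (ι → ℝ)) [IsFiniteMeasure μ] (f : BM ι) : Integrable (fun u => f u) μ := by
  have := BM.integrable μ measurable_id f 0
  simpa using this

/-- truncated square as bounded function -/
def tsq (j : ι) (ρ : ℝ) : BM ι := ⟨fun y => if |y j| ≤ ρ then (y j) ^ 2 else 0,
  Measurable.ite (measurableSet_le (by fun_prop) measurable_const) (by fun_prop) measurable_const,
  ⟨ρ ^ 2, fun y => by
    split_ifs with h
    · rw [abs_of_nonneg (sq_nonneg _), ← sq_abs]; exact pow_le_pow_left₀ (abs_nonneg _) h 2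
    · simpa using sq_nonneg ρ⟩⟩

theorem tsq_apply (j : ι) (ρ : ℝ) (y) : tsq j ρ y = if |y j| ≤ ρ then (y j) ^ 2 else 0 := rfl
theorem tsq_nonneg (j : ι) (ρ : ℝ) (y) : 0 ≤ tsq j ρ y := by
  rw [tsq_apply]; split_ifs; exacts [sq_nonneg _, le_rfl]

theorem Cnd.vv_le (h : Cnd H Hs p) {j : ι} {e ρ : ℝ} (hs : ∀ᵐ x ∂Hs, |x j - e| ≤ ρ) :
    p ^ 2 * vv Hs j ≤ ∫ y, tsq j (2 * ρ) y ∂(sm H) := by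
  refine le_trans (le_of_eq ?_) (h.int_le (tsq j (2 * ρ)) (tsq_nonneg _ _))
  congr 1
  refine integral_congr_ae ?_
  filter_upwards [sm_ae Hs j hs] with y hy
  rw [tsq_apply, if_pos hy]

theorem tsq_VV (H : Measure (ι → ℝ)) [IsProbabilityMeasure H] (j : ι) {r : ℝ} (hr : 0 < r) :
    ∫ y, tsq j r y ∂(sm H) ≤ r ^ 2 * VV H j r := by
  rw [VV, ← integral_const_mul]
  refine integral_mono (BM.integrable' (sm H) (tsq j r)) ((VV_int H j r).const_mul _) fun y => ?_
  simp only [tsq_apply]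
  split_ifs with h
  · rw [min_eq_left, div_pow, mul_div_cancel₀ _ (by positivity)]
    rw [← sq_abs, abs_div, abs_of_pos hr]
    exact pow_le_one₀ (by positivity) ((div_le_one hr).2 h)
  · have : 0 ≤ min ((y j / r) ^ 2) 1 := le_min (sq_nonneg _) zero_le_one
    positivity

theorem tsq_idle (H : Measure (ι → ℝ)) [IsProbabilityMeasure H] (j : ι) {r : ℝ} (hr : 0 < r) :
    3 * ∫ y, tsq j (r / 2) y ∂(sm H) ≤ r ^ 2 * (VV H j (r / 2) - VV H j r) := by
  rw [VV, VV, ← integral_sub (VV_int H j _) (VV_int H j _), ← integral_const_mul, ← integral_const_mul]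
  refine integral_mono ((BM.integrable' (sm H) (tsq j _)).const_mul _)
    (((VV_int H j _).sub (VV_int H j _)).const_mul _) fun y => ?_
  simp only [tsq_apply]
  have h4 : (y j / (r / 2)) ^ 2 = 4 * (y j / r) ^ 2 := by
    rw [div_div_eq_mul_div]; ring
  rw [h4]
  have h0 := sq_nonneg (y j / r)
  split_ifs with h
  · have h5 : (y j / r) ^ 2 ≤ 1 / 4 := by
      rw [← sq_abs, abs_div, abs_of_pos hr]
      have : |y j| / r ≤ 1 / 2 := by rw [div_le_iff₀ hr]; linarith
      calc _ ≤ (1 / 2 : ℝ) ^ 2 := pow_le_pow_left₀ (by positivity) this 2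
        _ = _ := by norm_num
    rw [min_eq_left (by linarith), min_eq_left (by linarith)]
    rw [div_pow]; field_simp; linarith
  · have : min ((y j / r) ^ 2) 1 ≤ min (4 * (y j / r) ^ 2) 1 := min_le_min_right _ (by linarith)
    have : 0 ≤ r ^ 2 * (min (4 * (y j / r) ^ 2) 1 - min ((y j / r) ^ 2) 1) :=
      mul_nonneg (sq_nonneg _) (by linarith)
    linarith
end
end ZB

open MeasureTheory
namespace ZB
noncomputable section
variable {ι : Type} [Fintype ι]

theorem pigeon (H : Measure (ι → ℝ)) [IsProbabilityMeasure H] (j : ι) {x0 r : ℝ} (hr : 0 < r) {M : ℕ} (hM : 0 < M)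
    (h : 1 / 2 ≤ H.real {x | |x j - x0| ≤ r}) :
    ∃ e, 1 / (2 * (M : ℝ)) ≤ H.real {x | |x j - e| ≤ r / M} := by
  by_contra! hcon
  have hM' : (0:ℝ) < M := by exact_mod_cast hM
  set e : ℕ → ℝ := fun i => x0 - r + (2 * i + 1) * (r / M) with he
  have hsub : {x : ι → ℝ | |x j - x0| ≤ r} ⊆ ⋃ i ∈ Finset.range M, {x : ι → ℝ | |x j - e i| ≤ r / M} := by
    intro x hx
    have hx' := abs_le.1 (show |x j - x0| ≤ r from hx)
    set t := (x j - x0 + r) / (2 * (r / M)) with ht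
    have ht0 : 0 ≤ t := div_nonneg (by linarith) (by positivity)
    have htM : t ≤ M := by
      rw [ht, div_le_iff₀ (by positivity)]
      have : (M : ℝ) * (2 * (r / M)) = 2 * r := by field_simp
      rw [this]; linarith
    have hxt : x j = x0 - r + 2 * t * (r / M) := by
      rw [ht]; field_simp; ring
    have hex : ∃ i ∈ Finset.range M, (i : ℝ) ≤ t ∧ t ≤ i + 1 := by
      rcases htM.lt_or_eq with h' | h'
      · refine ⟨⌊t⌋₊, Finset.mem_range.2 ((Nat.floor_lt ht0).2 h'), Nat.floor_le ht0, (Nat.lt_floor_add_one t).le⟩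
      · refine ⟨M - 1, Finset.mem_range.2 (by omega), ?_, ?_⟩
        · rw [h']; exact_mod_cast Nat.sub_le _ _
        · rw [h']; have : M ≤ M - 1 + 1 := by omega
          exact_mod_cast this
    obtain ⟨i, hi, h1, h2⟩ := hex
    simp only [Set.mem_iUnion]
    refine ⟨i, hi, ?_⟩
    simp only [Set.mem_ofPred_eq]
    have hrM : 0 < r / M := by positivity
    rw [hxt, he]
    have : x0 - r + 2 * t * (r / M) - (x0 - r + (2 * i + 1) * (r / M)) = (2 * (t - i) - 1) * (r / M) := by ring
    simp only [this]
    rw [abs_mul, abs_of_pos hrM]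
    have : |2 * (t - i) - 1| ≤ 1 := abs_le.2 ⟨by linarith, by linarith⟩
    nlinarith
  have h1 : H.real {x : ι → ℝ | |x j - x0| ≤ r} ≤ ∑ i ∈ Finset.range M, H.real {x : ι → ℝ | |x j - e i| ≤ r / M} :=
    (measureReal_mono hsub (measure_ne_top _ _)).trans (measureReal_biUnion_finset_le _ _)
  have h2 : ∑ i ∈ Finset.range M, H.real {x : ι → ℝ | |x j - e i| ≤ r / M} < ∑ i ∈ Finset.range M, 1 / (2 * (M : ℝ)) :=
    Finset.sum_lt_sum_of_nonempty (by simpa using hM.ne') fun i _ => hcon _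
  rw [Finset.sum_const, Finset.card_range, nsmul_eq_mul] at h2
  have : (M : ℝ) * (1 / (2 * M)) = 1 / 2 := by field_simp
  linarith

theorem slab_bound (H : Measure (ι → ℝ)) [IsProbabilityMeasure H] (j : ι) {r V : ℝ} (hr : 0 < r) {n n1 : ℕ}
    (hn : (n + 1 : ℝ) / 2 ≤ n1 + 1) (hV : 0 < V) (hV' : V ≤ VV H j r) (e l : ℝ) (hl : 0 ≤ l) (z) :
    (gg H ^ n1 • slab j e l) z ≤ 6 / √((n + 1) * V) * (1 + l / r) := by
  have h1 : ∀ e z, (gg H ^ n1 • slab j e r) z ≤ 6 / √((n + 1) * V) := by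
    intro e z
    have h := conc H j hr n1 e z
    have hs : √((n + 1) * V) * 2 ≤ 3 * √((n1 + 1) * VV H j r) := by
      have e3 : (3:ℝ) = √9 := by rw [show (9:ℝ) = 3 ^ 2 by norm_num, Real.sqrt_sq (by norm_num)]
      have e2 : (2:ℝ) = √4 := by rw [show (4:ℝ) = 2 ^ 2 by norm_num, Real.sqrt_sq (by norm_num)]
      rw [e3, e2, ← Real.sqrt_mul (by positivity), ← Real.sqrt_mul (by norm_num)]
      apply Real.sqrt_le_sqrt
      have : (n + 1 : ℝ) * V ≤ 2 * (n1 + 1) * VV H j r :=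
        mul_le_mul (by linarith) hV' hV.le (by positivity)
      have : 0 ≤ (n1 + 1 : ℝ) * VV H j r := mul_nonneg (by positivity) (hV.le.trans hV')
      linarith
    have hg0 : 0 ≤ (gg H ^ n1 • slab j e r) z := (((Mk.gg H).pow n1).1 _ (fun w => slab_nonneg _ _ _ w) z)
    rw [le_div_iff₀ (by positivity)]
    nlinarith
  have := slab_cover ((Mk.gg H).pow n1).1 hr h1 hl e z
  linarith

set_option maxHeartbeats 1000000 in
theorem Psi {H : Measure (ι → ℝ)} [IsProbabilityMeasure H] (hH : Nice H) {K : ℝ} (hK0 : 0 ≤ K) {N n : ℕ}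
    (hK : HK ι K N) (hn : n ≤ N) {j : ι} {r η x : ℝ} (hr : 0 < r) (hη : 0 < η) (hx : 0 < x) (hxV : x ≤ VV H j r)
    (hV : VV H j r ≤ 1 / 32)
    (hor : VV H j (r / 2) ≤ (1 + η) * VV H j r ∨ 1 / 128 ≤ VV H j r) {M : ℕ} (hM : 0 < M)
    {f : BM ι} {e : ℝ} (hf : MB j e r f) (z) :
    |((gg H ^ n * AA H) • f) z| ≤ (192 + 544 * √M + (K + 1) * (360 * (4 / √((n + 1) * x) + 3 * √η)
      + 4080 * (4 * M / √(n + 1) + 1 / √M))) / (n + 1) := by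
  have hM' : (0:ℝ) < M := by exact_mod_cast hM
  have hn1 : (0:ℝ) < n + 1 := by positivity
  set V := VV H j r with hVd
  have hV0 : 0 < V := hx.trans_le hxV
  obtain ⟨x0, hx0⟩ := center H j hr (by norm_num : (0:ℝ) < 1 / 4) (by norm_num)
  have hms : ∀ e ρ : ℝ, MeasurableSet {x : ι → ℝ | |x j - e| ≤ ρ} := fun e ρ =>
    measurableSet_le (by fun_prop) measurable_const
  have hq : 1 - 16 * V ≤ H.real {x | |x j - x0| ≤ r / 4} := by
    have e1 : {x : ι → ℝ | 1 / 4 * r < |x j - x0|} = {x : ι → ℝ | |x j - x0| ≤ r / 4}ᶜ := by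
      ext x; simp only [Set.mem_ofPred_eq, Set.mem_compl_iff, not_le]
      rw [show 1 / 4 * r = r / 4 by ring]
    rw [e1, measureReal_compl (hms _ _), probReal_univ] at hx0
    rw [← hVd] at hx0
    linarith
  obtain ⟨n1, n2, hn12, hh1, hh2⟩ : ∃ n1 n2 : ℕ, n1 + n2 = n ∧ (n + 1 : ℝ) / 2 ≤ n1 + 1 ∧ (n + 1 : ℝ) / 2 ≤ n2 + 1 := by
    refine ⟨n / 2, n - n / 2, by omega, ?_, ?_⟩
    · have : n + 1 ≤ 2 * (n / 2 + 1) := by omega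
      have : (n + 1 : ℝ) ≤ 2 * ((n / 2 : ℕ) + 1) := by exact_mod_cast this
      linarith
    · have : n + 1 ≤ 2 * ((n - n / 2) + 1) := by omega
      have : (n + 1 : ℝ) ≤ 2 * (((n - n / 2 : ℕ) : ℝ) + 1) := by exact_mod_cast this
      linarith
  have hn2N : n2 ≤ N := by omega
  have hn20 : (0:ℝ) < n2 + 1 := by positivity
  set s := √(n + 1 : ℝ) with hsd
  have hs0 : 0 < s := Real.sqrt_pos.2 hn1
  have hss : s * s = n + 1 := Real.mul_self_sqrt hn1.le
  have hsM : 0 < √(M:ℝ) := Real.sqrt_pos.2 hM'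
  have hsMM : √(M:ℝ) * √(M:ℝ) = M := Real.mul_self_sqrt hM'.le
  have hsη : 0 < √η := Real.sqrt_pos.2 hη
  set u := √V with hu
  have hu0 : 0 < u := Real.sqrt_pos.2 hV0
  have huu : u * u = V := Real.mul_self_sqrt hV0.le
  rcases hor with hidle | hbig
  · -- idle case
    have hp : 1 / 2 ≤ H.real {x | |x j - x0| ≤ r / 4} := by linarith
    obtain ⟨Hs, hHs, hC, hae, -⟩ := cnd H (hms x0 (r / 4)) (by linarith)
    set p := H.real {x | |x j - x0| ≤ r / 4} with hpd
    have hvv : vv Hs j ≤ 2 * r ^ 2 * η * V := by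
      have h1 := hC.vv_le (j := j) (e := x0) (ρ := r / 4) hae
      have h2 := tsq_idle H j hr
      rw [show 2 * (r / 4) = r / 2 by ring] at h1
      have h3 : r ^ 2 * (VV H j (r / 2) - V) ≤ r ^ 2 * (η * V) :=
        mul_le_mul_of_nonneg_left (by linarith) (sq_nonneg _)
      have h4 : (1 / 2) ^ 2 * vv Hs j ≤ p ^ 2 * vv Hs j := by
        gcongr; exact vv_nonneg _ _
      rw [← hVd] at h2
      have : 0 ≤ r ^ 2 * (η * V) := by positivity
      linarith
    have h := hC.cell (n1 := n1) (n2 := n2) hH hK0 hK hn2N hr (Λ := 6 / √((n + 1) * V)) (by positivity)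
      (fun e l hl z => slab_bound H j hr hh1 hV0 le_rfl e l hl z) (v := 2 * r ^ 2 * η * V) (by positivity)
      hvv hf z
    rw [hn12] at h
    have hp0 : 0 < p := by linarith
    have eΛ : √((n + 1) * V) = s * u := Real.sqrt_mul hn1.le V
    rw [eΛ] at h
    have hpn : (n + 1 : ℝ) / 4 ≤ (n2 + 1) * p := by
      have : (n + 1 : ℝ) / 2 * (1 / 2) ≤ (n2 + 1) * p := mul_le_mul hh2 hp (by norm_num) hn20.le
      linarith
    have a1 : √((1 - p) / (p * (n2 + 1))) ≤ 8 * u / s := by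
      have : (1 - p) / (p * (n2 + 1)) ≤ (8 * u / s) ^ 2 := by
        have e1 : (8 * u / s) ^ 2 = 64 * V / (n + 1) := by
          rw [div_pow, mul_pow, sq u, sq s, huu, hss]; norm_num
        rw [e1, div_le_div_iff₀ (by positivity) hn1]
        have b1 : (n + 1 : ℝ) ≤ 4 * (p * (n2 + 1)) := by linarith
        have b2 : (1 - p) * (n + 1) ≤ 16 * V * (n + 1) := mul_le_mul_of_nonneg_right (by linarith) hn1.le
        have b3 : 16 * V * (n + 1) ≤ 16 * V * (4 * (p * (n2 + 1))) := mul_le_mul_of_nonneg_left b1 (by positivity)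
        linarith
      exact (Real.sqrt_le_sqrt this).trans (by rw [Real.sqrt_sq (by positivity)])
    have a2 : 1 / ((n2 + 1) * p) ≤ 4 / (n + 1) := by
      rw [div_le_div_iff₀ (by positivity) hn1]; linarith
    have a3 : s / 2 ≤ √((n2 + 1) * p) := by
      apply Real.le_sqrt_of_sq_le
      rw [div_pow, sq s, hss]; linarith
    have a4 : √(2 * r ^ 2 * η * V) / r ≤ 3 / 2 * (√η * u) := by
      rw [div_le_iff₀ hr]
      apply Real.sqrt_le_iff.2 ⟨by positivity, ?_⟩
      have : (3 / 2 * (√η * u) * r) ^ 2 = 9 / 4 * r ^ 2 * (√η * √η) * (u * u) := by ring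
      rw [this, Real.mul_self_sqrt hη.le, huu]
      have : 0 ≤ r ^ 2 * η * V := by positivity
      linarith
    have a5 : √(2 * r ^ 2 * η * V) / r / √((n2 + 1) * p) ≤ 3 * √η * u / s := by
      calc _ ≤ 3 / 2 * (√η * u) / (s / 2) := by gcongr
        _ = _ := by field_simp
    have hxs : √((n + 1) * x) ≤ s * u := by
      rw [← eΛ]; apply Real.sqrt_le_sqrt; gcongr
    have hxs0 : 0 < √((n + 1) * x) := Real.sqrt_pos.2 (by positivity)
    calc _ ≤ _ := h
      _ ≤ 4 * (6 / (s * u)) * (8 * u / s) + 60 * (K + 1) * (6 / (s * u)) * (4 / (n + 1) + 3 * √η * u / s) := by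
          gcongr
      _ = (192 + (K + 1) * (360 * (4 / (s * u) + 3 * √η))) / (n + 1) := by
          rw [← hss]; field_simp; ring
      _ ≤ _ := by
          apply div_le_div_of_nonneg_right _ hn1.le
          have : 4 / (s * u) ≤ 4 / √((n + 1) * x) := by gcongr
          have h7 : 0 ≤ 544 * √(M:ℝ) := by positivity
          have h8 : 0 ≤ 4080 * (4 * (M:ℝ) / s + 1 / √M) := by positivity
          have : (K + 1) * (360 * (4 / (s * u) + 3 * √η)) ≤ (K + 1) * (360 * (4 / √((n + 1) * x) + 3 * √η)
            + 4080 * (4 * M / s + 1 / √M)) := by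
            apply mul_le_mul_of_nonneg_left _ (by linarith); linarith
          linarith
  · have hp' : 1 / 2 ≤ H.real {x | |x j - x0| ≤ r / 4} := by linarith
    obtain ⟨e0, he0⟩ := pigeon H j (by positivity : 0 < r / 4) hM hp'
    have hpp : 0 < H.real {x | |x j - e0| ≤ r / 4 / M} := lt_of_lt_of_le (by positivity) he0
    obtain ⟨Hs, hHs, hC, hae, -⟩ := cnd H (hms e0 (r / 4 / M)) hpp
    set p := H.real {x | |x j - e0| ≤ r / 4 / M} with hpd
    have hvv : vv Hs j ≤ (r / (2 * M)) ^ 2 := by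
      have := vv_le_of_ae Hs j (e := e0) (ρ := r / 4 / M) (by positivity) hae
      refine this.trans (le_of_eq ?_); congr 1; field_simp; norm_num
    have h := hC.cell (n1 := n1) (n2 := n2) hH hK0 hK hn2N hr (Λ := 6 / √((n + 1) * (1 / 128))) (by positivity)
      (fun e l hl z => slab_bound H j hr hh1 (by norm_num) hbig e l hl z) (v := (r / (2 * M)) ^ 2) (by positivity)
      hvv hf z
    rw [hn12] at h
    have hΛ : 6 / √((n + 1) * (1 / 128 : ℝ)) ≤ 68 / s := by
      have : 6 / 68 * s ≤ √((n + 1) * (1 / 128 : ℝ)) := by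
        apply Real.le_sqrt_of_sq_le
        rw [mul_pow, sq s, hss]; nlinarith
      rw [div_le_div_iff₀ (by positivity) hs0]; linarith
    have hnp : (n + 1 : ℝ) ≤ 4 * M * ((n2 + 1) * p) := by
      have : 1 ≤ 2 * M * p := by
        rw [div_le_iff₀ (by positivity)] at he0; linarith
      have b1 : (n + 1 : ℝ) * 1 ≤ 2 * (n2 + 1) * (2 * M * p) := mul_le_mul (by linarith) this (by norm_num) (by positivity)
      linarith
    have a1 : √((1 - p) / (p * (n2 + 1))) ≤ 2 * √M / s := by
      have : (1 - p) / (p * (n2 + 1)) ≤ (2 * √M / s) ^ 2 := by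
        have e1 : (2 * √(M:ℝ) / s) ^ 2 = 4 * M / (n + 1) := by
          rw [div_pow, mul_pow, sq √(M:ℝ), sq s, hsMM, hss]; norm_num
        rw [e1, div_le_div_iff₀ (by positivity) hn1]
        have : (1 - p) * (n + 1) ≤ 1 * (n + 1) := mul_le_mul_of_nonneg_right (by linarith) hn1.le
        linarith
      exact (Real.sqrt_le_sqrt this).trans (by rw [Real.sqrt_sq (by positivity)])
    have a2 : 1 / ((n2 + 1) * p) ≤ 4 * M / (n + 1) := by
      rw [div_le_div_iff₀ (by positivity) hn1]; linarith
    have a3 : s / (2 * √M) ≤ √((n2 + 1) * p) := by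
      apply Real.le_sqrt_of_sq_le
      rw [div_pow, mul_pow, sq s, sq √(M:ℝ), hsMM, hss, div_le_iff₀ (by positivity)]; linarith
    have a4 : √((r / (2 * M)) ^ 2) / r = 1 / (2 * M) := by
      rw [Real.sqrt_sq (by positivity)]; field_simp
    have a5 : √((r / (2 * M)) ^ 2) / r / √((n2 + 1) * p) ≤ 1 / (√M * s) := by
      rw [a4]
      calc _ ≤ 1 / (2 * M) / (s / (2 * √(M:ℝ))) := by gcongr
        _ = 1 / (√M * s) := by
          field_simp
          rw [Real.sq_sqrt hM'.le]
    calc _ ≤ _ := h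
      _ ≤ 4 * (68 / s) * (2 * √M / s) + 60 * (K + 1) * (68 / s) * (4 * M / (n + 1) + 1 / (√M * s)) := by
          gcongr
      _ = (544 * √M + (K + 1) * (4080 * (4 * M / s + 1 / √M))) / (n + 1) := by
          rw [← hss]; field_simp; ring
      _ ≤ _ := by
          apply div_le_div_of_nonneg_right _ hn1.le
          have h8 : 0 ≤ 360 * (4 / √((n + 1) * x) + 3 * √η) := by positivity
          have : (K + 1) * (4080 * (4 * M / s + 1 / √M)) ≤ (K + 1) * (360 * (4 / √((n + 1) * x) + 3 * √η)
            + 4080 * (4 * M / s + 1 / √M)) := by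
            apply mul_le_mul_of_nonneg_left _ (by linarith); linarith
          linarith
end
end ZB

open MeasureTheory
namespace ZB
noncomputable section
variable {ι : Type} [Fintype ι] [DecidableEq ι]

theorem meas_single (i : ι) : Measurable (fun t : ℝ => (Pi.single i t : ι → ℝ)) := by
  rw [measurable_pi_iff]
  intro a
  by_cases h : a = i
  · subst h; simp only [Pi.single_eq_same]; exact measurable_id
  · simpa [Pi.single_eq_of_ne h] using measurable_const

/-- shift operator -/
def sh (i : ι) (t : ℝ) : Op ι := ku (Measure.dirac t) (fun t : ℝ => (Pi.single i t : ι → ℝ)) (meas_single i)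

theorem sh_apply (i : ι) (t : ℝ) (f : BM ι) (z) : (sh i t • f) z = f (z + Pi.single i t) := by
  rw [sh, ku_apply, integral_dirac]

theorem Mk.sh (i : ι) (t : ℝ) : Mk (sh i t) := Mk.ku _ _ _

/-- one-dimensional smoothing, unnormalized -/
def S0 (i : ι) (ρ : ℝ) : Op ι := ku (volume.restrict (Set.Icc (-ρ) ρ)) (fun t : ℝ => (Pi.single i t : ι → ℝ)) (meas_single i)

/-- one-dimensional smoothing -/
def S1 (i : ι) (ρ : ℝ) : Op ι := (2 * ρ)⁻¹ • S0 i ρ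

theorem S1_apply (i : ι) {ρ : ℝ} (f : BM ι) (z) :
    (S1 i ρ • f) z = (2 * ρ)⁻¹ * ∫ t in Set.Icc (-ρ) ρ, f (z + Pi.single i t) := by
  rw [S1, smul_assoc, BM.smul_apply, S0, ku_apply]

theorem S1_apply' (i : ι) {ρ : ℝ} (hρ : 0 < ρ) (f : BM ι) (z) :
    (S1 i ρ • f) z = (2 * ρ)⁻¹ * ∫ t in (-ρ)..ρ, f (z + Pi.single i t) := by
  rw [S1_apply, intervalIntegral.integral_of_le (by linarith), integral_Icc_eq_integral_Ioc]

theorem single_ii (i : ι) (f : BM ι) (z) (a b : ℝ) : IntervalIntegrable (fun t : ℝ => f (z + (Pi.single i t : ι → ℝ))) volume a b := by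
  rw [intervalIntegrable_iff]
  have : IsFiniteMeasure (volume.restrict (Set.uIoc a b)) := ⟨by simp [Set.uIoc]⟩
  exact BM.integrable (volume.restrict (Set.uIoc a b)) (meas_single i) f z

theorem Mk.S1 (i : ι) {ρ : ℝ} (hρ : 0 < ρ) : Mk (S1 i ρ) := by
  constructor
  · intro f hf z
    rw [S1_apply]
    have : 0 ≤ ∫ t in Set.Icc (-ρ) ρ, f (z + Pi.single i t) := integral_nonneg fun u => hf _
    positivity
  · ext z
    rw [S1_apply' i hρ]
    simp only [one_apply, intervalIntegral.integral_const, smul_eq_mul, mul_one]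
    field_simp; ring

/-- second difference -/
def De (i : ι) (ρ : ℝ) : Op ι := 1 - (1 / 2 : ℝ) • (sh i ρ + sh i (-ρ))

theorem S1_half (i : ι) {ρ : ℝ} (hρ : 0 < ρ) :
    S1 i ρ = S1 i (ρ / 2) * ((1 / 2 : ℝ) • (sh i (ρ / 2) + sh i (-(ρ / 2)))) := by
  apply Op.ext
  intro f z
  rw [mul_smul, S1_apply' i hρ, S1_apply' i (by positivity)]
  simp only [smul_assoc, add_smul, BM.smul_apply, BM.add_apply, sh_apply]
  have e1 : ∀ t s : ℝ, z + Pi.single i t + Pi.single i s = z + Pi.single i (t + s) := by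
    intro t s; rw [add_assoc, Pi.single_add]
  simp only [e1]
  set φ : ℝ → ℝ := fun t => f (z + Pi.single i t) with hφ
  have hi : ∀ a b, IntervalIntegrable φ volume a b := single_ii i f z
  have hi2 : ∀ c a b, IntervalIntegrable (fun t => φ (t + c)) volume a b := by
    intro c a b
    have := (hi (a + c) (b + c)).comp_add_right c
    simpa using this
  change (2 * ρ)⁻¹ * ∫ t in (-ρ)..ρ, φ t = (2 * (ρ / 2))⁻¹ * ∫ t in (-(ρ / 2))..(ρ / 2), 1 / 2 * (φ (t + ρ / 2) + φ (t + -(ρ / 2)))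
  rw [intervalIntegral.integral_const_mul, intervalIntegral.integral_add (hi2 _ _ _) (hi2 _ _ _),
    intervalIntegral.integral_comp_add_right, intervalIntegral.integral_comp_add_right]
  have := intervalIntegral.integral_add_adjacent_intervals (hi (-ρ) 0) (hi 0 ρ)
  rw [← this]
  have e2 : -(ρ / 2) + ρ / 2 = 0 := by ring
  have e3 : ρ / 2 + ρ / 2 = ρ := by ring
  have e4 : -(ρ / 2) + -(ρ / 2) = -ρ := by ring
  have e5 : ρ / 2 + -(ρ / 2) = 0 := by ring
  rw [e2, e3, e4, e5]
  field_simp; ring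

theorem S1_tel (i : ι) {ρ : ℝ} (hρ : 0 < ρ) (D : ℕ) :
    S1 i (ρ / 2 ^ D) = ∑ a ∈ Finset.range (D + 1), S1 i (ρ / 2 ^ a) * (if a = 0 then 1 else De i (ρ / 2 ^ a)) := by
  induction D with
  | zero => simp
  | succ D ih =>
    rw [Finset.sum_range_succ, ← ih, if_neg (by omega), S1_half i (ρ := ρ / 2 ^ D) (by positivity)]
    have : ρ / 2 ^ D / 2 = ρ / 2 ^ (D + 1) := by rw [pow_succ, ← div_div]
    rw [this, De, mul_sub, mul_one]; abel

theorem prod_tel {r1 : ι → ℝ} (hr : ∀ i, 0 < r1 i) (D : ι → ℕ) :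
    ∏ i, S1 i (r1 i / 2 ^ D i) = ∑ α ∈ Fintype.piFinset (fun i => Finset.range (D i + 1)),
      (∏ i, S1 i (r1 i / 2 ^ α i)) * ∏ i, (if α i = 0 then 1 else De i (r1 i / 2 ^ α i)) := by
  rw [Finset.prod_congr rfl fun i _ => S1_tel i (hr i) (D i), Finset.prod_univ_sum]
  refine Finset.sum_congr rfl fun α _ => ?_
  rw [Finset.prod_mul_distrib]

theorem Mk.prod {κ : Type*} (s : Finset κ) {a : κ → Op ι} (h : ∀ i ∈ s, Mk (a i)) : Mk (∏ i ∈ s, a i) := by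
  classical
  induction s using Finset.induction_on with
  | empty => simpa using Mk.one
  | insert i s hi ih =>
    rw [Finset.prod_insert hi]
    exact (h i (Finset.mem_insert_self _ _)).mul (ih fun j hj => h j (Finset.mem_insert_of_mem hj))

/-- box with a single interval replaced -/
def Bx.rep (B : Bx ι) (j : ι) (S : Set ℝ) (hS : S.OrdConnected) : Bx ι where
  I i := if i = j then S else B.I i
  oc i := by
    split_ifs
    · exact hS
    · exact B.oc i

theorem Bx.mem_rep {B : Bx ι} {j : ι} {S : Set ℝ} {hS : S.OrdConnected} {w : ι → ℝ} :
    w ∈ (B.rep j S hS).set ↔ w j ∈ S ∧ ∀ i, i ≠ j → w i ∈ B.I i := by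
  simp only [Bx.set, Bx.rep, Set.mem_ofPred_eq]
  constructor
  · intro h
    refine ⟨by simpa using h j, fun i hi => by simpa [hi] using h i⟩
  · rintro ⟨h1, h2⟩ i
    split_ifs with hi
    · rw [hi]; exact h1
    · exact h2 i hi

theorem oc_diff {I : Set ℝ} (hI : I.OrdConnected) (τ : ℝ) : {x | x ∈ I ∧ x + τ ∉ I}.OrdConnected := by
  constructor
  rintro x ⟨hx, hx'⟩ y ⟨hy, hy'⟩ u ⟨hu1, hu2⟩
  refine ⟨hI.out hx hy ⟨hu1, hu2⟩, fun hu => ?_⟩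
  rcases le_total 0 τ with h | h
  · exact hx' (hI.out hx hu ⟨by linarith, by linarith⟩)
  · exact hy' (hI.out hu hy ⟨by linarith, by linarith⟩)

theorem oc_diff' {I : Set ℝ} (hI : I.OrdConnected) (τ : ℝ) : {x | x + τ ∈ I ∧ x ∉ I}.OrdConnected := by
  constructor
  rintro x ⟨hx, hx'⟩ y ⟨hy, hy'⟩ u ⟨hu1, hu2⟩
  refine ⟨hI.out hx hy ⟨by linarith, by linarith⟩, fun hu => ?_⟩
  rcases le_total 0 τ with h | h
  · exact hy' (hI.out hu hy ⟨by linarith, by linarith⟩)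
  · exact hx' (hI.out hx hu ⟨by linarith, by linarith⟩)

theorem diam_diff {I : Set ℝ} (hI : I.OrdConnected) {τ r : ℝ} (hτ : |τ| ≤ r) {x y : ℝ}
    (hx : x ∈ {x | x ∈ I ∧ x + τ ∉ I}) (hy : y ∈ {x | x ∈ I ∧ x + τ ∉ I}) : |x - y| ≤ r := by
  by_contra! h
  obtain ⟨hx, hx'⟩ := hx
  obtain ⟨hy, hy'⟩ := hy
  have hτ' := abs_le.1 hτ
  rcases lt_abs.1 h with h | h
  · rcases le_total 0 τ with h0 | h0
    · exact hy' (hI.out hy hx ⟨by linarith, by linarith⟩)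
    · exact hx' (hI.out hy hx ⟨by linarith, by linarith⟩)
  · rcases le_total 0 τ with h0 | h0
    · exact hx' (hI.out hx hy ⟨by linarith, by linarith⟩)
    · exact hy' (hI.out hx hy ⟨by linarith, by linarith⟩)

theorem diam_diff' {I : Set ℝ} (hI : I.OrdConnected) {τ r : ℝ} (hτ : |τ| ≤ r) {x y : ℝ}
    (hx : x ∈ {x | x + τ ∈ I ∧ x ∉ I}) (hy : y ∈ {x | x + τ ∈ I ∧ x ∉ I}) : |x - y| ≤ r := by
  have := diam_diff hI (τ := -τ) (r := r) (by rwa [abs_neg]) (x := x + τ) (y := y + τ)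
    ⟨hx.1, by simpa using hx.2⟩ ⟨hy.1, by simpa using hy.2⟩
  simpa using this

theorem ball_of_diam {S : Set ℝ} {r : ℝ} (h : ∀ x ∈ S, ∀ y ∈ S, |x - y| ≤ r) : ∃ e, ∀ x ∈ S, |x - e| ≤ r := by
  rcases S.eq_empty_or_nonempty with rfl | ⟨e, he⟩
  · exact ⟨0, by simp⟩
  · exact ⟨e, fun x hx => h x hx e he⟩

theorem shift_box (B : Bx ι) (i : ι) {τ r : ℝ} (hτ : |τ| ≤ r) :
    ∃ (B1 B2 : Bx ι) (e1 e2 : ℝ), ib B - sh i τ • ib B = ib B1 - ib B2 ∧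
      (∀ w ∈ B1.set, |w i - e1| ≤ r) ∧ (∀ w ∈ B2.set, |w i - e2| ≤ r) := by
  obtain ⟨e1, he1⟩ := ball_of_diam (fun x hx y hy => diam_diff (B.oc i) hτ (x := x) (y := y) hx hy)
  obtain ⟨e2, he2⟩ := ball_of_diam (fun x hx y hy => diam_diff' (B.oc i) hτ (x := x) (y := y) hx hy)
  refine ⟨B.rep i _ (oc_diff (B.oc i) τ), B.rep i _ (oc_diff' (B.oc i) τ), e1, e2, ?_, ?_, ?_⟩
  · ext w
    simp only [BM.sub_apply, sh_apply]
    have m0 : w ∈ B.set ↔ w i ∈ B.I i ∧ ∀ l, l ≠ i → w l ∈ B.I l := by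
      constructor
      · intro h; exact ⟨h i, fun l _ => h l⟩
      · rintro ⟨h1, h2⟩ l
        by_cases hl : l = i
        · rw [hl]; exact h1
        · exact h2 l hl
    have m1 : w + Pi.single i τ ∈ B.set ↔ w i + τ ∈ B.I i ∧ ∀ l, l ≠ i → w l ∈ B.I l := by
      constructor
      · intro h; refine ⟨by simpa using h i, fun l hl => by simpa [Pi.single_eq_of_ne hl] using h l⟩
      · rintro ⟨h1, h2⟩ l
        by_cases hl : l = i
        · rw [hl]; simpa using h1
        · simpa [Pi.single_eq_of_ne hl] using h2 l hl
    have m2 := Bx.mem_rep (B := B) (j := i) (hS := oc_diff (B.oc i) τ) (w := w)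
    have m3 := Bx.mem_rep (B := B) (j := i) (hS := oc_diff' (B.oc i) τ) (w := w)
    classical
    have hv : ∀ (B : Bx ι) w, ib B w = if w ∈ B.set then 1 else 0 := by
      intro B w; split_ifs with h
      · exact ib_of_mem h
      · exact ib_of_not_mem h
    rw [hv, hv, hv, hv]
    simp only [m0, m1, m2, m3, Set.mem_ofPred_eq]
    by_cases h1 : w i ∈ B.I i <;> by_cases h2 : w i + τ ∈ B.I i <;>
      by_cases h3 : ∀ l, l ≠ i → w l ∈ B.I l <;> simp [h1, h2]
  · intro w hw; exact he1 _ (Bx.mem_rep.1 hw).1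
  · intro w hw; exact he2 _ (Bx.mem_rep.1 hw).1

theorem smooth1 {D : Op ι} {i : ι} {r ψ : ℝ} (hr : 0 < r)
    (hψ : ∀ (B : Bx ι) e, (∀ w ∈ B.set, |w i - e| ≤ r) → ∀ z, |(D • ib B) z| ≤ ψ) (B : Bx ι) (z) :
    |((D * (1 - S1 i r)) • ib B) z| ≤ 2 * ψ := by
  have h1 : ∀ t ∈ Set.uIoc (-r) r, ‖(D • ib B) z - (D • ib B) (z + Pi.single i t)‖ ≤ 2 * ψ := by
    intro t ht
    rw [Set.uIoc_of_le (by linarith)] at ht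
    obtain ⟨B1, B2, e1, e2, he, h1, h2⟩ := shift_box B i (τ := t) (r := r) (abs_le.2 ⟨ht.1.le, ht.2⟩)
    have : (D • ib B) z - (D • ib B) (z + Pi.single i t) = (D • ib B1) z - (D • ib B2) z := by
      rw [← sh_apply, smul_comm, ← BM.sub_apply, ← smul_sub, he, smul_sub, BM.sub_apply]
    rw [this, Real.norm_eq_abs]
    have a1 := hψ B1 e1 h1 z
    have a2 := hψ B2 e2 h2 z
    exact (abs_sub _ _).trans (by linarith)
  have h2 := intervalIntegral.norm_integral_le_of_norm_le_const h1
  rw [intervalIntegral.integral_sub (by simp) (single_ii i _ z _ _)] at h2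
  rw [mul_comm D, mul_smul, sub_smul, one_smul, BM.sub_apply, S1_apply' i hr]
  simp only [intervalIntegral.integral_const, smul_eq_mul] at h2
  have e : (D • ib B) z - (2 * r)⁻¹ * ∫ t in (-r)..r, (D • ib B) (z + Pi.single i t) =
      (2 * r)⁻¹ * ((r - -r) * (D • ib B) z - ∫ t in (-r)..r, (D • ib B) (z + Pi.single i t)) := by
    field_simp; ring
  rw [e, abs_mul, abs_of_pos (by positivity)]
  rw [Real.norm_eq_abs, abs_of_pos (by linarith : 0 < r - -r)] at h2
  calc _ ≤ (2 * r)⁻¹ * (2 * ψ * (r - -r)) := by gcongr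
    _ = _ := by field_simp; ring

theorem smooth_all {D : Op ι} {r : ι → ℝ} {ψ : ℝ} (hr : ∀ i, 0 < r i)
    (hψ : ∀ i (B : Bx ι) e, (∀ w ∈ B.set, |w i - e| ≤ r i) → ∀ z, |(D • ib B) z| ≤ ψ) (B : Bx ι) (z) :
    |((D * (1 - ∏ i, S1 i (r i))) • ib B) z| ≤ 2 * Fintype.card ι * ψ := by
  have : ∀ s : Finset ι, ∀ z, |((D * (1 - ∏ i ∈ s, S1 i (r i))) • ib B) z| ≤ 2 * s.card * ψ := by
    intro s
    induction s using Finset.induction_on with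
    | empty => intro z; simp
    | insert i s hi ih =>
      intro z
      have e : D * (1 - ∏ l ∈ insert i s, S1 l (r l)) = D * (1 - S1 i (r i)) + S1 i (r i) * (D * (1 - ∏ l ∈ s, S1 l (r l))) := by
        rw [Finset.prod_insert hi]; ring
      rw [e, add_smul, BM.add_apply, mul_smul (S1 i (r i))]
      have h1 := smooth1 (hr i) (hψ i) B z
      have h2 := (Mk.S1 i (hr i)).abs_le ih z
      rw [Finset.card_insert_of_notMem hi]
      push_cast
      exact (abs_add_le _ _).trans (by linarith)
  exact this Finset.univ z
end
end ZB

open MeasureTheory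
namespace ZB
noncomputable section
variable {ι : Type} [Fintype ι] [DecidableEq ι]

theorem pi_update (u : ι → Measure ℝ) [∀ i, IsProbabilityMeasure (u i)] (a : ι) :
    ((u a).prod (Measure.pi u)).map (fun q : ℝ × (ι → ℝ) => Function.update q.2 a q.1) = Measure.pi u := by
  have hm : Measurable (fun q : ℝ × (ι → ℝ) => Function.update q.2 a q.1) := by
    rw [measurable_pi_iff]
    intro i
    by_cases h : i = a
    · subst h; simpa using measurable_fst
    · simp only [Function.update_of_ne h]; fun_prop
  symm
  apply Measure.pi_eq
  intro A hA
  rw [Measure.map_apply hm (MeasurableSet.univ_pi hA)]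
  have : (fun q : ℝ × (ι → ℝ) => Function.update q.2 a q.1) ⁻¹' (Set.univ.pi A) =
      (A a) ×ˢ (Set.univ.pi (Function.update A a Set.univ)) := by
    ext ⟨τ, t⟩
    simp only [Set.mem_preimage, Set.mem_pi, Set.mem_univ, true_implies, Set.mem_prod]
    constructor
    · intro h
      refine ⟨by simpa using h a, fun i => ?_⟩
      by_cases hi : i = a
      · subst hi; simp
      · have := h i; simpa [Function.update_of_ne hi] using this
    · rintro ⟨h1, h2⟩ i
      by_cases hi : i = a
      · subst hi; simpa using h1
      · have := h2 i; simpa [Function.update_of_ne hi] using this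
  rw [this, Measure.prod_prod, Measure.pi_pi, ← Finset.mul_prod_erase _ _ (Finset.mem_univ a),
    ← Finset.mul_prod_erase Finset.univ (fun i => (u i) (A i)) (Finset.mem_univ a)]
  simp only [Function.update_self, measure_univ, one_mul]
  congr 1
  refine Finset.prod_congr rfl fun i hi => ?_
  rw [Function.update_of_ne (Finset.ne_of_mem_erase hi)]

theorem prod_ku (u : ι → Measure ℝ) [∀ i, IsProbabilityMeasure (u i)] (s : Finset ι) (f : BM ι) (z) :
    ((∏ i ∈ s, ku (u i) (fun t : ℝ => (Pi.single i t : ι → ℝ)) (meas_single i)) • f) z =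
      ∫ t, f (z + ∑ i ∈ s, Pi.single i (t i)) ∂(Measure.pi u) := by
  induction s using Finset.induction_on generalizing z with
  | empty => simp
  | insert a s ha ih =>
    have hmS : Measurable (fun t : ι → ℝ => ∑ i ∈ s, (Pi.single i (t i) : ι → ℝ)) :=
      Finset.measurable_fun_sum _ fun i _ => (meas_single i).comp (measurable_pi_apply i)
    have hmS' : Measurable (fun t : ι → ℝ => ∑ i ∈ insert a s, (Pi.single i (t i) : ι → ℝ)) :=
      Finset.measurable_fun_sum _ fun i _ => (meas_single i).comp (measurable_pi_apply i)
    have hm : Measurable (fun q : ℝ × (ι → ℝ) => Function.update q.2 a q.1) := by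
      rw [measurable_pi_iff]
      intro i
      by_cases h : i = a
      · subst h; simpa using measurable_fst
      · simp only [Function.update_of_ne h]; fun_prop
    rw [Finset.prod_insert ha, mul_smul, ku_apply]
    simp only [ih]
    have e1 : ∀ (τ : ℝ) (t : ι → ℝ), f (z + Pi.single a τ + ∑ i ∈ s, Pi.single i (t i)) =
        f (z + ((Pi.single a τ : ι → ℝ) + ∑ i ∈ s, Pi.single i (t i))) := fun τ t => by rw [add_assoc]
    simp only [e1]
    rw [← integral_prod (fun q : ℝ × (ι → ℝ) => f (z + ((Pi.single a q.1 : ι → ℝ) + ∑ i ∈ s, Pi.single i (q.2 i))))]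
    · conv_rhs => rw [← pi_update u a]
      rw [integral_map hm.aemeasurable (by exact (f.meas.comp (measurable_const.add hmS')).aestronglyMeasurable)]
      congr 1; ext q; congr 2
      rw [Finset.sum_insert ha, Function.update_self]
      congr 1
      refine Finset.sum_congr rfl fun i hi => ?_
      rw [Function.update_of_ne]; rintro rfl; exact ha hi
    · exact BM.integrable _ (((meas_single a).comp measurable_fst).add (hmS.comp measurable_snd)) f z

/-- cube -/
def cube (z ρ : ι → ℝ) : Set (ι → ℝ) := {w | ∀ i, |w i - z i| ≤ ρ i}

theorem cube_eq (z ρ : ι → ℝ) : cube z ρ = Set.univ.pi fun i => Set.Icc (z i - ρ i) (z i + ρ i) := by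
  ext w
  simp only [cube, Set.mem_ofPred_eq, Set.mem_pi, Set.mem_univ, true_implies, Set.mem_Icc, abs_le]
  exact forall_congr' fun i => ⟨fun h => ⟨by linarith [h.1], by linarith [h.2]⟩, fun h => ⟨by linarith [h.1], by linarith [h.2]⟩⟩

theorem cube_meas (z ρ : ι → ℝ) : MeasurableSet (cube z ρ) := by
  rw [cube_eq]; exact MeasurableSet.univ_pi fun i => measurableSet_Icc

theorem cube_vol (z : ι → ℝ) {ρ : ι → ℝ} (hρ : ∀ i, 0 < ρ i) : volume (cube z ρ) = ENNReal.ofReal (∏ i, 2 * ρ i) := by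
  rw [cube_eq, volume_pi_pi, ENNReal.ofReal_prod_of_nonneg (fun i _ => by have := hρ i; positivity)]
  refine Finset.prod_congr rfl fun i _ => ?_
  rw [Real.volume_Icc]; congr 1; ring

theorem S1_ku (i : ι) {ρ : ℝ} (hρ : 0 < ρ) : ∃ u : Measure ℝ, ∃ _ : IsProbabilityMeasure u,
    u = (ENNReal.ofReal (2 * ρ))⁻¹ • volume.restrict (Set.Icc (-ρ) ρ) ∧
    S1 i ρ = ku u (fun t : ℝ => (Pi.single i t : ι → ℝ)) (meas_single i) := by
  have hp : IsProbabilityMeasure ((ENNReal.ofReal (2 * ρ))⁻¹ • volume.restrict (Set.Icc (-ρ) ρ)) := by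
    constructor
    rw [Measure.smul_apply, Measure.restrict_apply_univ, Real.volume_Icc, smul_eq_mul,
      show ρ - -ρ = 2 * ρ by ring]
    exact ENNReal.inv_mul_cancel (by simpa using hρ) ENNReal.ofReal_ne_top
  refine ⟨_, hp, rfl, ?_⟩
  apply Op.ext
  intro f z
  rw [S1_apply, ku_apply, integral_smul_measure, smul_eq_mul, ENNReal.toReal_inv,
    ENNReal.toReal_ofReal (by positivity)]

theorem prod_S1 {ρ : ι → ℝ} (hρ : ∀ i, 0 < ρ i) (F : BM ι) (z) :
    ((∏ i, S1 i (ρ i)) • F) z = (∏ i, 2 * ρ i)⁻¹ * ∫ w, ind (cube z ρ) (cube_meas z ρ) w * F w := by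
  choose u hu h1 h2 using fun i => S1_ku i (hρ i)
  have hpi : Measure.pi u = (ENNReal.ofReal (∏ i, 2 * ρ i))⁻¹ • volume.restrict (cube 0 ρ) := by
    apply Measure.pi_eq
    intro A hA
    rw [Measure.smul_apply, Measure.restrict_apply (MeasurableSet.univ_pi hA), cube_eq, ← Set.pi_inter_distrib,
      volume_pi_pi, smul_eq_mul, ENNReal.ofReal_prod_of_nonneg (fun i _ => by have := hρ i; positivity),
      ENNReal.prod_inv_distrib, ← Finset.prod_mul_distrib]
    · refine Finset.prod_congr rfl fun i _ => ?_
      rw [h1 i, Measure.smul_apply, Measure.restrict_apply (hA i)]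
      simp
    · intro i _ j _ _
      left; exact ENNReal.ofReal_ne_zero_iff.2 (by have := hρ i; positivity)
  rw [Finset.prod_congr rfl fun i _ => h2 i, prod_ku u]
  simp only [Finset.univ_sum_single]
  have hpos : 0 < ∏ i, 2 * ρ i := Finset.prod_pos fun i _ => by have := hρ i; positivity
  rw [hpi, integral_smul_measure, smul_eq_mul, ENNReal.toReal_inv, ENNReal.toReal_ofReal hpos.le,
    ← integral_indicator (cube_meas _ _),
    ← integral_add_left_eq_self (fun w => ind (cube z ρ) (cube_meas z ρ) w * F w) z]
  congr 2
  ext w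
  by_cases h : w ∈ cube 0 ρ
  · rw [Set.indicator_of_mem h]
    rw [ind_of_mem, one_mul]
    intro i; simpa using h i
  · rw [Set.indicator_of_notMem h]
    rw [ind_of_not_mem, zero_mul]
    intro h'; apply h; intro i; simpa using h' i

/-- pairing -/
def pr (f g : BM ι) : ℝ := ∫ w, f w * g w

/-- integrable bounded function -/
def IB (f : BM ι) : Prop := Integrable (fun w => f w) volume

theorem IB.mul {f : BM ι} (hf : IB f) (g : BM ι) : Integrable (fun w => f w * g w) volume := by
  obtain ⟨C, _, hC⟩ := g.bdd
  exact Integrable.mul_bdd hf g.meas.aestronglyMeasurable (Filter.Eventually.of_forall hC)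

theorem IB.add {f g : BM ι} (hf : IB f) (hg : IB g) : IB (f + g) := by
  have := Integrable.add hf hg; exact this
theorem IB.sub {f g : BM ι} (hf : IB f) (hg : IB g) : IB (f - g) := by
  have := Integrable.sub hf hg; exact this
theorem IB.smul {f : BM ι} (hf : IB f) (c : ℝ) : IB (c • f) := by
  have := Integrable.smul c hf; exact this
theorem IB.ab {f : BM ι} (hf : IB f) : IB (ab f) := by
  have := Integrable.abs hf; exact this

theorem IB.joint (μ : Measure (ι → ℝ)) [IsProbabilityMeasure μ] {p : (ι → ℝ) → ι → ℝ} (hp : Measurable p)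
    {f : BM ι} (hf : IB f) : Integrable (fun q : (ι → ℝ) × (ι → ℝ) => f (q.2 + p q.1)) (μ.prod volume) := by
  have hm : Measurable (fun q : (ι → ℝ) × (ι → ℝ) => f (q.2 + p q.1)) :=
    f.meas.comp (measurable_snd.add (hp.comp measurable_fst))
  rw [integrable_prod_iff hm.aestronglyMeasurable]
  refine ⟨Filter.Eventually.of_forall fun u => ?_, ?_⟩
  · exact Integrable.comp_add_right hf (p u)
  · have : ∀ u, ∫ w, ‖f (w + p u)‖ = ∫ w, ‖f w‖ := fun u =>
      integral_add_right_eq_self (fun w => ‖f w‖) (p u)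
    simp only [this]
    exact integrable_const _

theorem IB.ku (μ : Measure (ι → ℝ)) [IsProbabilityMeasure μ] {p : (ι → ℝ) → ι → ℝ} (hp : Measurable p)
    {f : BM ι} (hf : IB f) : IB (ku μ p hp • f) := by
  have := (IB.joint μ hp hf).integral_prod_right
  unfold IB
  simp only [ku_apply]
  exact this

theorem ku_adj (μ : Measure (ι → ℝ)) [IsProbabilityMeasure μ] {p : (ι → ℝ) → ι → ℝ} (hp : Measurable p)
    (hp' : Measurable fun u => - p u) {f : BM ι} (hf : IB f) (g : BM ι) :
    pr f (ku μ p hp • g) = pr (ZB.ku μ (fun u => - p u) hp' • f) g := by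
  unfold pr
  simp only [ku_apply]
  simp only [← integral_const_mul, ← integral_mul_const]
  obtain ⟨C, _, hC⟩ := g.bdd
  have i1 : Integrable (fun q : (ι → ℝ) × (ι → ℝ) => f q.1 * g (q.1 + p q.2)) (volume.prod μ) := by
    have h1 := (IB.joint μ (p := fun _ => 0) measurable_const hf)
    have h2 := h1.swap
    simp only [add_zero] at h2
    refine Integrable.mul_bdd (c := C) h2 ?_ (Filter.Eventually.of_forall fun q => hC _)
    exact (g.meas.comp (measurable_fst.add (hp.comp measurable_snd))).aestronglyMeasurable
  have i2 : Integrable (fun q : (ι → ℝ) × (ι → ℝ) => f (q.1 + - p q.2) * g q.1) (volume.prod μ) := by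
    have h1 := (IB.joint μ hp' hf)
    have h2 := h1.swap
    refine Integrable.mul_bdd (c := C) h2 ?_ (Filter.Eventually.of_forall fun q => hC _)
    exact (g.meas.comp measurable_fst).aestronglyMeasurable
  have e1 : ∫ w, (∫ u, f w * g (w + p u) ∂μ) = ∫ u, (∫ w, f w * g (w + p u)) ∂μ :=
    integral_integral_swap i1
  have e2 : ∫ w, (∫ u, f (w + - p u) * g w ∂μ) = ∫ u, (∫ w, f (w + - p u) * g w) ∂μ :=
    integral_integral_swap i2
  refine e1.trans (Eq.trans ?_ e2.symm)
  congr 1; ext u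
  rw [← integral_add_right_eq_self (fun w => f (w + - p u) * g w) (p u)]
  simp

variable (H : Measure (ι → ℝ)) [IsProbabilityMeasure H]

theorem km_ku : km H = ku H id measurable_id := by
  apply Op.ext; intro f z; rw [km_apply, ku_apply]; rfl

theorem IB.km {f : BM ι} (hf : IB f) : IB (km H • f) := by rw [km_ku]; exact IB.ku H _ hf
theorem IB.kr {f : BM ι} (hf : IB f) : IB (kr H • f) := IB.ku H _ hf
theorem IB.gg {f : BM ι} (hf : IB f) : IB (gg H • f) := IB.km (sm H) hf
theorem IB.gpow {f : BM ι} (hf : IB f) (n : ℕ) : IB (ZB.gg H ^ n • f) := by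
  induction n with
  | zero => simpa using hf
  | succ n ih => rw [pow_succ', mul_smul]; exact ih.gg H
theorem IB.AA {f : BM ι} (hf : IB f) : IB (AA H • f) := by
  rw [ZB.AA, sub_smul, one_smul]; exact hf.sub (hf.gg H)
theorem IB.krpow {f : BM ι} (hf : IB f) (n : ℕ) : IB (ZB.kr H ^ n • f) := by
  induction n with
  | zero => simpa using hf
  | succ n ih => rw [pow_succ', mul_smul]; exact ih.kr H

theorem km_adj {f : BM ι} (hf : IB f) (g : BM ι) : pr f (km H • g) = pr (kr H • f) g := by
  rw [km_ku, ku_adj H measurable_id meas_neg hf]; rfl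

theorem kr_adj {f : BM ι} (hf : IB f) (g : BM ι) : pr f (kr H • g) = pr (km H • f) g := by
  rw [km_ku, kr, ku_adj H meas_neg (by simp only [neg_neg]; exact measurable_id) hf]
  congr 2
  apply Op.ext; intro f z; simp [ku_apply]

theorem gg_adj {f : BM ι} (hf : IB f) (g : BM ι) : pr f (gg H • g) = pr (gg H • f) g := by
  rw [gg_eq, mul_smul, km_adj H hf, kr_adj H (hf.kr H), ← mul_smul]

theorem pr_comm (f g : BM ι) : pr f g = pr g f := by unfold pr; simp only [mul_comm]
theorem pr_sub {f : BM ι} (hf : IB f) (g h : BM ι) : pr f (g - h) = pr f g - pr f h := by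
  unfold pr; rw [← integral_sub (hf.mul g) (hf.mul h)]; simp [mul_sub]
theorem pr_add {f : BM ι} (hf : IB f) (g h : BM ι) : pr f (g + h) = pr f g + pr f h := by
  unfold pr; rw [← integral_add (hf.mul g) (hf.mul h)]; simp [mul_add]
theorem pr_self (f : BM ι) : 0 ≤ pr f f := integral_nonneg fun w => mul_self_nonneg _

theorem AA_adj {f : BM ι} (hf : IB f) (g : BM ι) : pr f (AA H • g) = pr (AA H • f) g := by
  rw [AA, sub_smul, one_smul, sub_smul, one_smul, pr_sub hf, gg_adj H hf]
  unfold pr; rw [← integral_sub (hf.mul g) ((hf.gg H).mul g)]; simp [sub_mul]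

theorem gpow_adj {f : BM ι} (hf : IB f) (g : BM ι) (n : ℕ) : pr f (gg H ^ n • g) = pr (gg H ^ n • f) g := by
  induction n generalizing g with
  | zero => simp
  | succ n ih => rw [pow_succ, mul_smul, ih, gg_adj H (hf.gpow H n), ← mul_smul, mul_comm]

theorem gpow_kr {f : BM ι} (hf : IB f) (g : BM ι) (n : ℕ) : pr f (gg H ^ n • g) = pr (kr H ^ n • f) (kr H ^ n • g) := by
  have : ∀ g, pr f (km H ^ n • g) = pr (kr H ^ n • f) g := by
    induction n with
    | zero => intro g; simp
    | succ n ih =>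
      intro g
      rw [pow_succ, mul_smul, ih, km_adj H (hf.krpow H n), ← mul_smul, ← pow_succ']
  rw [gg_eq, mul_pow, mul_smul, this]

theorem gpow_nonneg {f : BM ι} (hf : IB f) (n : ℕ) : 0 ≤ pr f (gg H ^ n • f) := by
  rw [gpow_kr H hf]; exact pr_self _

theorem gg_contr {f : BM ι} (hf : IB f) : pr f (gg H • f) ≤ pr f f := by
  unfold pr
  have hI := (IB.joint (sm H) measurable_id hf)
  obtain ⟨C, _, hC⟩ := f.bdd
  have hI2 : Integrable (fun q : (ι → ℝ) × (ι → ℝ) => f q.2 * f (q.2 + q.1)) ((sm H).prod volume) := by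
    refine (Integrable.mul_bdd (c := C) hI ?_ (Filter.Eventually.of_forall fun q => hC q.2)).congr
      (Filter.Eventually.of_forall fun q => mul_comm _ _)
    exact (f.meas.comp measurable_snd).aestronglyMeasurable
  have e1 : ∫ w, f w * (gg H • f) w = ∫ u, (∫ w, f w * f (w + u)) ∂(sm H) := by
    simp only [gg, km_apply, ← integral_const_mul]
    rw [integral_integral_swap]
    exact hI2.swap
  rw [e1]
  have hsq : Integrable (fun w => f w * f w) volume := hf.mul f
  have h2 : ∀ u, ∫ w, f w * f (w + u) ≤ ∫ w, f w * f w := by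
    intro u
    have hs2 : Integrable (fun w => f (w + u) * f (w + u)) volume := Integrable.comp_add_right hsq u
    have : ∫ w, f w * f (w + u) ≤ ∫ w, (1 / 2 * (f w * f w) + 1 / 2 * (f (w + u) * f (w + u))) := by
      refine integral_mono ?_ ((hsq.const_mul _).add (hs2.const_mul _)) fun w => ?_
      · exact Integrable.mul_bdd (c := C) hf (f.meas.comp (by fun_prop)).aestronglyMeasurable
          (Filter.Eventually.of_forall fun q => hC _)
      · nlinarith [sq_nonneg (f w - f (w + u))]
    rw [integral_add (hsq.const_mul _) (hs2.const_mul _), integral_const_mul, integral_const_mul,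
      integral_add_right_eq_self (fun w => f w * f w) u] at this
    linarith
  calc _ ≤ ∫ u, (∫ w, f w * f w) ∂(sm H) := integral_mono hI2.integral_prod_left (integrable_const _) h2
    _ = _ := by simp

theorem gA_nonneg {f : BM ι} (hf : IB f) (n : ℕ) : 0 ≤ pr f ((gg H ^ n * AA H) • f) := by
  rw [mul_smul, gpow_kr H hf]
  set φ := kr H ^ n • f with hφ
  have hφI : IB φ := hf.krpow H n
  have : kr H ^ n • AA H • f = φ - gg H • φ := by
    rw [hφ, smul_comm, AA, sub_smul, one_smul]
  rw [this, pr_sub hφI]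
  have := gg_contr H hφI
  linarith

theorem gA_anti {f : BM ι} (hf : IB f) (n : ℕ) :
    pr f ((gg H ^ (n + 1) * AA H) • f) ≤ pr f ((gg H ^ n * AA H) • f) := by
  have e : (gg H ^ n * AA H) • f - (gg H ^ (n + 1) * AA H) • f = gg H ^ n • (AA H • (AA H • f)) := by
    rw [← sub_smul, ← mul_smul, ← mul_smul]; congr 1; unfold AA; ring
  have h := pr_sub hf ((gg H ^ n * AA H) • f) ((gg H ^ (n + 1) * AA H) • f)
  rw [e, smul_comm, AA_adj H hf] at h
  have := gpow_nonneg H (hf.AA H) n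
  linarith

theorem gA_le {f : BM ι} (hf : IB f) (j l : ℕ) :
    (l + 1) * pr f ((gg H ^ (j + l) * AA H) • f) ≤ pr f (gg H ^ j • f) := by
  have hanti : Antitone fun n => pr f ((gg H ^ n * AA H) • f) := antitone_nat_of_succ_le (gA_anti H hf)
  have htel : ∀ L : ℕ, ∑ i ∈ Finset.range L, pr f ((gg H ^ (j + i) * AA H) • f) =
      pr f (gg H ^ j • f) - pr f (gg H ^ (j + L) • f) := by
    intro L
    induction L with
    | zero => simp
    | succ L ih =>
      rw [Finset.sum_range_succ, ih]
      have : (gg H ^ (j + L) * AA H) • f = gg H ^ (j + L) • f - gg H ^ (j + (L + 1)) • f := by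
        rw [← sub_smul]; congr 1; unfold AA; ring
      rw [this, pr_sub hf]; ring
  have h1 : ∑ i ∈ Finset.range (l + 1), pr f ((gg H ^ (j + l) * AA H) • f) ≤
      ∑ i ∈ Finset.range (l + 1), pr f ((gg H ^ (j + i) * AA H) • f) :=
    Finset.sum_le_sum fun i hi => hanti (by have := Finset.mem_range.1 hi; omega)
  rw [htel, Finset.sum_const, Finset.card_range, nsmul_eq_mul] at h1
  have := gpow_nonneg H hf (j + (l + 1))
  push_cast at h1
  linarith

theorem L2 {f E : BM ι} (hf : IB f) (hE : IB E) (j l : ℕ) :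
    |pr f ((gg H ^ (j + l) * AA H) • E)| ≤ (pr f (gg H ^ j • f) + pr E (gg H ^ j • E)) / (2 * (l + 1)) := by
  set D := gg H ^ (j + l) * AA H with hD
  have hsym : pr E (D • f) = pr f (D • E) := by
    rw [hD, mul_smul, gpow_adj H hE, AA_adj H (hE.gpow H _), pr_comm, ← mul_smul, mul_comm (AA H)]
  have h1 := gA_nonneg H (hf.add hE) (j + l)
  have h2 := gA_nonneg H (hf.sub hE) (j + l)
  rw [← hD, smul_add, pr_comm, pr_add (by
    rw [← smul_add, hD, mul_smul]; exact ((hf.add hE).AA H).gpow H _)] at h1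
  rw [← hD, smul_sub, pr_comm, pr_sub (by
    rw [← smul_sub, hD, mul_smul]; exact ((hf.sub hE).AA H).gpow H _)] at h2
  rw [pr_comm, pr_add hf, pr_comm _ E, pr_add hE] at h1
  rw [pr_comm, pr_sub hf, pr_comm _ E, pr_sub hE] at h2
  have h3 := gA_le H hf j l
  have h4 := gA_le H hE j l
  rw [← hD] at h3 h4
  rw [hsym] at h1 h2
  have hl : (0:ℝ) < l + 1 := by positivity
  rw [abs_le, le_div_iff₀ (by positivity), ← neg_div, div_le_iff₀ (by positivity)]
  constructor <;> nlinarith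
end
end ZB

open MeasureTheory
namespace ZB
noncomputable section
variable {ι : Type} [Fintype ι] [DecidableEq ι]

/-- one-dimensional second difference -/
def dl (ρ : ℝ) (φ : ℝ → ℝ) (x : ℝ) : ℝ := φ x - (φ (x + ρ) + φ (x - ρ)) / 2

theorem De_tens {f : BM ι} {φ : ι → ℝ → ℝ} (hf : ∀ w, f w = ∏ i, φ i (w i)) (j : ι) (ρ : ℝ) (w : ι → ℝ) :
    (De j ρ • f) w = ∏ i, (if i = j then dl ρ (φ i) (w i) else φ i (w i)) := by
  have key : ∀ t : ℝ, f (w + (Pi.single j t : ι → ℝ)) = φ j (w j + t) * ∏ i ∈ Finset.univ.erase j, φ i (w i) := by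
    intro t
    rw [hf, ← Finset.mul_prod_erase _ _ (Finset.mem_univ j)]
    congr 1
    · simp
    · refine Finset.prod_congr rfl fun i hi => ?_
      simp [Pi.single_eq_of_ne (Finset.ne_of_mem_erase hi)]
  have k0 : f w = φ j (w j) * ∏ i ∈ Finset.univ.erase j, φ i (w i) := by
    have := key 0
    simpa using this
  have kr : ∏ i, (if i = j then dl ρ (φ i) (w i) else φ i (w i)) =
      dl ρ (φ j) (w j) * ∏ i ∈ Finset.univ.erase j, φ i (w i) := by
    rw [← Finset.mul_prod_erase _ _ (Finset.mem_univ j)]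
    congr 1
    · simp
    · refine Finset.prod_congr rfl fun i hi => ?_
      rw [if_neg (Finset.ne_of_mem_erase hi)]
  rw [kr, De, sub_smul, one_smul, smul_assoc, add_smul]
  simp only [BM.sub_apply, BM.smul_apply, BM.add_apply, sh_apply]
  rw [key, key, k0, dl, ← sub_eq_add_neg]
  ring

open Classical in
/-- indicator of a set of reals -/
def chi (I : Set ℝ) (x : ℝ) : ℝ := if x ∈ I then 1 else 0

theorem ib_tens (B : Bx ι) (w : ι → ℝ) : ib B w = ∏ i, chi (B.I i) (w i) := by
  by_cases h : w ∈ B.set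
  · rw [ib_of_mem h, Finset.prod_eq_one]
    intro i _; rw [chi, if_pos (h i)]
  · rw [ib_of_not_mem h]
    have : ∃ i, w i ∉ B.I i := by
      by_contra h'; push Not at h'; exact h h'
    obtain ⟨i, hi⟩ := this
    rw [Finset.prod_eq_zero (Finset.mem_univ i)]
    rw [chi, if_neg hi]

theorem tens (B : Bx ι) (α : ι → ℕ) (ρ : ι → ℝ) (s : Finset ι) (w : ι → ℝ) :
    ((∏ i ∈ s, (if α i = 0 then 1 else De i (ρ i))) • ib B) w =
      ∏ i, (if i ∈ s ∧ α i ≠ 0 then dl (ρ i) (chi (B.I i)) (w i) else chi (B.I i) (w i)) := by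
  induction s using Finset.induction_on generalizing w with
  | empty => simp [ib_tens]
  | insert j s hj ih =>
    rw [Finset.prod_insert hj, mul_smul]
    by_cases hα : α j = 0
    · rw [if_pos hα, one_smul, ih]
      refine Finset.prod_congr rfl fun i _ => ?_
      by_cases hi : i = j
      · subst hi; simp [hα]
      · simp [hi]
    · rw [if_neg hα, De_tens (φ := fun i x => if i ∈ s ∧ α i ≠ 0 then dl (ρ i) (chi (B.I i)) x else chi (B.I i) x) ih]
      refine Finset.prod_congr rfl fun i _ => ?_
      by_cases hi : i = j
      · subst hi; simp [hα, hj]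
      · simp [hi]

theorem chi_01 (I : Set ℝ) (x : ℝ) : 0 ≤ chi I x ∧ chi I x ≤ 1 := by
  unfold chi; split_ifs <;> norm_num

theorem dl_abs (ρ : ℝ) (I : Set ℝ) (x : ℝ) : |dl ρ (chi I) x| ≤ 1 := by
  have h1 := chi_01 I x
  have h2 := chi_01 I (x + ρ)
  have h3 := chi_01 I (x - ρ)
  unfold dl
  rw [abs_le]; constructor <;> linarith

theorem dl_supp {I : Set ℝ} (hI : I.OrdConnected) (hb : BddBelow I) (ha : BddAbove I) {ρ : ℝ} (hρ : 0 < ρ) {x : ℝ}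
    (h : dl ρ (chi I) x ≠ 0) : |x - sInf I| ≤ ρ ∨ |x - sSup I| ≤ ρ := by
  have key : ∀ u v, |x - u| ≤ ρ → |x - v| ≤ ρ → u ∈ I → v ∉ I → |x - sInf I| ≤ ρ ∨ |x - sSup I| ≤ ρ := by
    intro u v hu hv huI hvI
    rw [abs_le] at hu hv
    rcases lt_or_ge u v with huv | huv
    · right
      have h1 : u ≤ sSup I := le_csSup ha huI
      have h2 : sSup I ≤ v := csSup_le ⟨u, huI⟩ fun y hy => by
        by_contra hc
        push Not at hc
        exact hvI (hI.out huI hy ⟨huv.le, hc.le⟩)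
      rw [abs_le]; constructor <;> linarith
    · left
      have h1 : sInf I ≤ u := csInf_le hb huI
      have h2 : v ≤ sInf I := le_csInf ⟨u, huI⟩ fun y hy => by
        by_contra hc
        push Not at hc
        exact hvI (hI.out hy huI ⟨hc.le, huv⟩)
      rw [abs_le]; constructor <;> linarith
  have x0 : |x - x| ≤ ρ := by simp [hρ.le]
  have x1 : |x - (x + ρ)| ≤ ρ := by rw [abs_le]; constructor <;> linarith
  have x2 : |x - (x - ρ)| ≤ ρ := by rw [abs_le]; constructor <;> linarith
  by_cases m0 : x ∈ I <;> by_cases m1 : x + ρ ∈ I <;> by_cases m2 : x - ρ ∈ I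
  · exact absurd (by simp [dl, chi, m0, m1, m2]) h
  · exact key _ _ x0 x2 m0 m2
  · exact key _ _ x0 x1 m0 m1
  · exact key _ _ x0 x1 m0 m1
  · exact key _ _ x1 x0 m1 m0
  · exact key _ _ x1 x0 m1 m0
  · exact key _ _ x2 x0 m2 m0
  · exact absurd (by simp [dl, chi, m0, m1, m2]) h

/-- the bounds on the elementary pieces -/
theorem E_bounds (B : Bx ι) (z : ι → ℝ) {r1 : ι → ℝ} (hr : ∀ i, 0 < r1 i) {L : ℝ} (hL : 1 ≤ L)
    (hB : ∀ i, ∀ x ∈ B.I i, |x - z i| ≤ L * r1 i) (α : ι → ℕ) :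
    ∃ a a' : ι → ℝ, ∀ w, |((∏ i, (if α i = 0 then 1 else De i (r1 i / 2 ^ α i))) • ib B) w| ≤ 1 ∧
      (((∏ i, (if α i = 0 then 1 else De i (r1 i / 2 ^ α i))) • ib B) w ≠ 0 →
        ∀ i, |w i - a i| ≤ L * (r1 i / 2 ^ α i) ∨ |w i - a' i| ≤ L * (r1 i / 2 ^ α i)) := by
  refine ⟨fun i => if α i = 0 then z i else sInf (B.I i), fun i => if α i = 0 then z i else sSup (B.I i), fun w => ?_⟩
  rw [tens B α (fun i => r1 i / 2 ^ α i)]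
  simp only [Finset.mem_univ, true_and]
  constructor
  · rw [Finset.abs_prod]
    refine Finset.prod_le_one (fun i _ => abs_nonneg _) fun i _ => ?_
    split_ifs
    · exact dl_abs _ _ _
    · have := chi_01 (B.I i) (w i)
      rw [abs_le]; constructor <;> linarith
  · intro h i
    have hi := Finset.prod_ne_zero_iff.1 h i (Finset.mem_univ i)
    by_cases hα : α i = 0
    · simp only [hα, ne_eq, not_true_eq_false, if_false, if_true] at hi ⊢
      left
      have : w i ∈ B.I i := by
        by_contra hc; apply hi; rw [chi, if_neg hc]
      simpa using hB i _ this
    · simp only [hα, ne_eq, not_false_eq_true, if_true, if_false] at hi ⊢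
      have hρ : 0 < r1 i / 2 ^ α i := by have := hr i; positivity
      have hle : r1 i / 2 ^ α i ≤ L * (r1 i / 2 ^ α i) := le_mul_of_one_le_left hρ.le hL
      have := dl_supp (B.oc i) ⟨z i - L * r1 i, fun x hx => by have := abs_le.1 (hB i x hx); linarith⟩
        ⟨z i + L * r1 i, fun x hx => by have := abs_le.1 (hB i x hx); linarith⟩ hρ hi
      rcases this with h | h
      · left; exact h.trans hle
      · right; exact h.trans hle

theorem ind_IB {s : Set (ι → ℝ)} (hs : MeasurableSet s) (h : volume s ≠ ⊤) : IB (ind s hs) := by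
  unfold IB
  have : (fun w => ind s hs w) = s.indicator (fun _ => (1:ℝ)) := by
    ext w
    by_cases hw : w ∈ s
    · rw [ind_of_mem hw, Set.indicator_of_mem hw]
    · rw [ind_of_not_mem hw, Set.indicator_of_notMem hw]
  rw [this]
  exact (integrable_indicator_iff hs).2 (integrableOn_const h)

theorem ind_int {s : Set (ι → ℝ)} (hs : MeasurableSet s) : ∫ w, ind s hs w = (volume s).toReal := by
  have : (fun w => ind s hs w) = s.indicator (fun _ => (1:ℝ)) := by
    ext w
    by_cases hw : w ∈ s
    · rw [ind_of_mem hw, Set.indicator_of_mem hw]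
    · rw [ind_of_not_mem hw, Set.indicator_of_notMem hw]
  rw [this, integral_indicator hs]
  simp [Measure.real]

/-- union of two intervals in each coordinate -/
def ZZ (a a' ρ : ι → ℝ) : Set (ι → ℝ) := Set.univ.pi fun i => Set.Icc (a i - ρ i) (a i + ρ i) ∪ Set.Icc (a' i - ρ i) (a' i + ρ i)

theorem ZZ_meas (a a' ρ : ι → ℝ) : MeasurableSet (ZZ a a' ρ) :=
  MeasurableSet.univ_pi fun _ => measurableSet_Icc.union measurableSet_Icc

theorem mem_ZZ {a a' ρ : ι → ℝ} {w : ι → ℝ} : w ∈ ZZ a a' ρ ↔ ∀ i, |w i - a i| ≤ ρ i ∨ |w i - a' i| ≤ ρ i := by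
  unfold ZZ
  simp only [Set.mem_univ_pi, Set.mem_union, Set.mem_Icc, abs_le]
  refine forall_congr' fun i => or_congr ?_ ?_ <;> constructor <;> rintro ⟨h1, h2⟩ <;> constructor <;> linarith

theorem ZZ_vol (a a' : ι → ℝ) {ρ : ι → ℝ} (hρ : ∀ i, 0 < ρ i) : volume (ZZ a a' ρ) ≤ ENNReal.ofReal (∏ i, 4 * ρ i) := by
  unfold ZZ
  rw [volume_pi_pi, ENNReal.ofReal_prod_of_nonneg (fun i _ => by have := hρ i; positivity)]
  refine Finset.prod_le_prod' fun i _ => ?_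
  refine (measure_union_le _ _).trans ?_
  have := hρ i
  rw [Real.volume_Icc, Real.volume_Icc, ← ENNReal.ofReal_add (by linarith) (by linarith)]
  apply ENNReal.ofReal_le_ofReal; linarith

/-- quadratic form bound -/
theorem pr_le {P : Op ι} (hP : Pos P) {E : BM ι} {s : Set (ι → ℝ)} (hs : MeasurableSet s) {v Q : ℝ} (hv : 0 ≤ v)
    (hvol : volume s ≤ ENNReal.ofReal v) (hE : ∀ w, |E w| ≤ ind s hs w)
    (hQ : ∀ z, (P • ind s hs) z ≤ Q) (hQ0 : 0 ≤ Q) : pr E (P • E) ≤ v * Q := by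
  have hfin : volume s ≠ ⊤ := (hvol.trans_lt ENNReal.ofReal_lt_top).ne
  have hI := ind_IB hs hfin
  have hE' : IB E := by
    refine Integrable.mono' hI E.meas.aestronglyMeasurable (Filter.Eventually.of_forall hE)
  have hPE : ∀ w, |(P • E) w| ≤ Q := fun w =>
    (hP.abs_le E w).trans ((hP.mono (f := ab E) (g := ind s hs) hE w).trans (hQ w))
  calc pr E (P • E) ≤ ∫ w, ind s hs w * Q := by
        refine integral_mono (hE'.mul _) (Integrable.mul_const hI Q) fun w => ?_
        refine (le_abs_self _).trans ?_
        rw [abs_mul]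
        exact mul_le_mul (hE w) (hPE w) (abs_nonneg _) (ind_nonneg w)
    _ = (volume s).toReal * Q := by rw [integral_mul_const, ind_int]
    _ ≤ v * Q := by
        refine mul_le_mul_of_nonneg_right ?_ hQ0
        exact ENNReal.toReal_le_of_le_ofReal hv hvol

theorem term (H : Measure (ι → ℝ)) [IsProbabilityMeasure H] (z : ι → ℝ) {ρ : ι → ℝ} (hρ : ∀ i, 0 < ρ i)
    {L : ℝ} (hL : 1 ≤ L) {E : BM ι} {a a' : ι → ℝ} (hE1 : ∀ w, |E w| ≤ 1)
    (hEs : ∀ w, E w ≠ 0 → ∀ i, |w i - a i| ≤ L * ρ i ∨ |w i - a' i| ≤ L * ρ i) (j l : ℕ) (i : ι) {q : ℝ}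
    (hq : ∀ e z, (gg H ^ j • slab i e (ρ i)) z ≤ q) :
    |((gg H ^ (j + l) * AA H * ∏ i, S1 i (ρ i)) • E) z| ≤
      (1 + (2 * L) ^ Fintype.card ι * (2 * (L + 1))) * q / (2 * (l + 1)) := by
  have hP : Pos (gg H ^ j) := (Mk.gg H).1.pow j
  have hq0 : 0 ≤ q := (hP _ (fun w => slab_nonneg _ _ _ w) z).trans (hq 0 z)
  have hL0 : 0 < L := by linarith
  set v := ∏ i, 2 * ρ i with hv
  have hvpos : 0 < v := Finset.prod_pos fun i _ => by have := hρ i; positivity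
  have hfin : volume (cube z ρ) ≠ ⊤ := by rw [cube_vol z hρ]; exact ENNReal.ofReal_ne_top
  set f : BM ι := ind (cube z ρ) (cube_meas z ρ) with hf
  have hfI : IB f := ind_IB _ hfin
  -- support of E
  have hEZ : ∀ w, |E w| ≤ ind (ZZ a a' (fun i => L * ρ i)) (ZZ_meas _ _ _) w := by
    intro w
    by_cases h : E w = 0
    · rw [h, abs_zero]; exact ind_nonneg w
    · rw [ind_of_mem (mem_ZZ.2 (hEs w h))]; exact hE1 w
  have hv2 : ∏ i, 4 * (L * ρ i) = (2 * L) ^ Fintype.card ι * v := by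
    rw [hv, ← Finset.card_univ, ← Finset.prod_const, ← Finset.prod_mul_distrib]
    refine Finset.prod_congr rfl fun i _ => by ring
  have hvolZ : volume (ZZ a a' (fun i => L * ρ i)) ≤ ENNReal.ofReal ((2 * L) ^ Fintype.card ι * v) := by
    rw [← hv2]; exact ZZ_vol _ _ fun i => mul_pos hL0 (hρ i)
  have hEI : IB E := by
    refine Integrable.mono' (ind_IB (ZZ_meas a a' (fun i => L * ρ i)) (hvolZ.trans_lt ENNReal.ofReal_lt_top).ne)
      E.meas.aestronglyMeasurable (Filter.Eventually.of_forall hEZ)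
  have b1 : pr f (gg H ^ j • f) ≤ v * q := by
    refine pr_le hP (cube_meas z ρ) hvpos.le (cube_vol z hρ).le (fun w => ?_) (fun y => ?_) hq0
    · rw [abs_of_nonneg (ind_nonneg w)]
    · refine (hP.mono (fun w => ?_) y).trans (hq (z i) y)
      by_cases hw : w ∈ cube z ρ
      · rw [ind_of_mem hw, slab_of_mem (hw i)]
      · rw [ind_of_not_mem hw]; exact slab_nonneg _ _ _ _
  have b2 : pr E (gg H ^ j • E) ≤ (2 * L) ^ Fintype.card ι * v * (2 * (L + 1) * q) := by
    refine pr_le hP (ZZ_meas a a' (fun i => L * ρ i)) (by positivity) hvolZ hEZ (fun y => ?_) (by positivity)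
    have c1 := slab_cover hP (hρ i) hq (l := L * ρ i) (by have := hρ i; positivity) (a i) y
    have c2 := slab_cover hP (hρ i) hq (l := L * ρ i) (by have := hρ i; positivity) (a' i) y
    have c3 : (gg H ^ j • ind (ZZ a a' (fun i => L * ρ i)) (ZZ_meas _ _ _)) y ≤
        (gg H ^ j • (slab i (a i) (L * ρ i) + slab i (a' i) (L * ρ i))) y := by
      refine hP.mono (fun w => ?_) y
      rw [BM.add_apply]
      have s1 := slab_nonneg i (a i) (L * ρ i) w
      have s2 := slab_nonneg i (a' i) (L * ρ i) w
      by_cases hw : w ∈ ZZ a a' (fun i => L * ρ i)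
      · rw [ind_of_mem hw]
        rcases mem_ZZ.1 hw i with h | h
        · rw [slab_of_mem h]; linarith
        · rw [slab_of_mem (e := a' i) h]; linarith
      · rw [ind_of_not_mem hw]; linarith
    rw [smul_add, BM.add_apply] at c3
    rw [mul_div_assoc, div_self (hρ i).ne', mul_one] at c1 c2
    linarith
  have e : ((gg H ^ (j + l) * AA H * ∏ i, S1 i (ρ i)) • E) z = v⁻¹ * pr f ((gg H ^ (j + l) * AA H) • E) := by
    rw [mul_comm _ (∏ i, S1 i (ρ i)), mul_smul, prod_S1 hρ]; rfl
  rw [e, abs_mul, abs_of_pos (inv_pos.2 hvpos)]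
  have hl := L2 H hfI hEI j l
  have hl0 : (0:ℝ) < 2 * (l + 1) := by positivity
  calc v⁻¹ * |pr f ((gg H ^ (j + l) * AA H) • E)| ≤
        v⁻¹ * ((v * q + (2 * L) ^ Fintype.card ι * v * (2 * (L + 1) * q)) / (2 * (l + 1))) := by
        refine mul_le_mul_of_nonneg_left (hl.trans ?_) (inv_pos.2 hvpos).le
        gcongr
    _ = _ := by field_simp

end
end ZB

open MeasureTheory
namespace ZB
noncomputable section
variable {ι : Type} [Fintype ι] [DecidableEq ι]

theorem geo_le {μ : ℝ} (h0 : 0 ≤ μ) (h1 : μ < 1) (n : ℕ) : ∑ a ∈ Finset.range n, μ ^ a ≤ 1 / (1 - μ) := by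
  have h : (∑ a ∈ Finset.range n, μ ^ a) * (1 - μ) = 1 - μ ^ n := geom_sum_mul_neg μ n
  rw [le_div_iff₀ (by linarith), h]
  have := pow_nonneg h0 n
  linarith

theorem expand [Nonempty ι] (H : Measure (ι → ℝ)) [IsProbabilityMeasure H] (B : Bx ι) (z : ι → ℝ) {r1 : ι → ℝ}
    (hr : ∀ i, 0 < r1 i) {L : ℝ} (hL : 1 ≤ L) (hB : ∀ i, ∀ x ∈ B.I i, |x - z i| ≤ L * r1 i) (D : ι → ℕ)
    {μ Q : ℝ} (h0 : 0 ≤ μ) (h1 : μ < 1) (hQ : 0 ≤ Q) (j l : ℕ)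
    (hq : ∀ i, ∀ a ≤ D i, ∀ e z, (gg H ^ j • slab i e (r1 i / 2 ^ a)) z ≤ Q * μ ^ (Fintype.card ι * a)) :
    |((gg H ^ (j + l) * AA H * ∏ i, S1 i (r1 i / 2 ^ D i)) • ib B) z| ≤
      (1 + (2 * L) ^ Fintype.card ι * (2 * (L + 1))) * Q * (1 / (1 - μ)) ^ Fintype.card ι / (2 * (l + 1)) := by
  set c := 1 + (2 * L) ^ Fintype.card ι * (2 * (L + 1)) with hc
  have hc0 : 0 ≤ c := by have : 0 < L := by linarith
                         positivity
  have hl0 : (0:ℝ) < 2 * (l + 1) := by positivity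
  rw [prod_tel hr D, Finset.mul_sum, Finset.sum_smul, BM.sum_apply]
  have step : ∀ α ∈ Fintype.piFinset (fun i => Finset.range (D i + 1)),
      |((gg H ^ (j + l) * AA H * ((∏ i, S1 i (r1 i / 2 ^ α i)) *
        ∏ i, (if α i = 0 then 1 else De i (r1 i / 2 ^ α i)))) • ib B) z| ≤ c * (Q * ∏ i, μ ^ α i) / (2 * (l + 1)) := by
    intro α hα
    obtain ⟨i, -, hi⟩ := Finset.exists_max_image Finset.univ α Finset.univ_nonempty
    obtain ⟨a, a', hE⟩ := E_bounds B z hr hL hB α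
    have hαi : α i ≤ D i := by
      have := Fintype.mem_piFinset.1 hα i
      have := Finset.mem_range.1 this
      omega
    have := term H z (ρ := fun i => r1 i / 2 ^ α i) (fun i => by have := hr i; positivity) hL
      (fun w => (hE w).1) (fun w => (hE w).2) j l i (hq i (α i) hαi)
    rw [← mul_assoc, mul_smul]
    refine this.trans ?_
    rw [← hc]
    have hμ : μ ^ (Fintype.card ι * α i) ≤ ∏ i, μ ^ α i := by
      rw [Finset.prod_pow_eq_pow_sum]
      apply pow_le_pow_of_le_one h0 h1.le
      calc ∑ i, α i ≤ ∑ _k : ι, α i := Finset.sum_le_sum fun k _ => hi k (Finset.mem_univ k)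
        _ = _ := by simp
    gcongr
  refine (Finset.abs_sum_le_sum_abs _ _).trans ((Finset.sum_le_sum step).trans ?_)
  rw [← Finset.sum_div, ← Finset.mul_sum, ← Finset.mul_sum, ← Finset.prod_univ_sum, mul_assoc]
  have : ∏ i, ∑ a ∈ Finset.range (D i + 1), μ ^ a ≤ (1 / (1 - μ)) ^ Fintype.card ι := by
    rw [← Finset.card_univ, ← Finset.prod_const]
    refine Finset.prod_le_prod (fun i _ => Finset.sum_nonneg fun a _ => pow_nonneg h0 a) fun i _ => geo_le h0 h1 _
  gcongr

/-- averages are local -/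
theorem S_local {r : ι → ℝ} (hr : ∀ i, 0 < r i) {F : BM ι} {z : ι → ℝ} {c : ℝ}
    (h : ∀ w, (∀ i, |w i - z i| ≤ r i) → |F w| ≤ c) : |((∏ i, S1 i (r i)) • F) z| ≤ c := by
  have hv : 0 < ∏ i, 2 * r i := Finset.prod_pos fun i _ => by have := hr i; positivity
  have hfin : volume (cube z r) ≠ ⊤ := by rw [cube_vol z hr]; exact ENNReal.ofReal_ne_top
  have hI := ind_IB (cube_meas z r) hfin
  rw [prod_S1 hr, abs_mul, abs_of_pos (inv_pos.2 hv)]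
  have h1 : |∫ w, ind (cube z r) (cube_meas z r) w * F w| ≤ ∫ w, ind (cube z r) (cube_meas z r) w * c := by
    rw [← Real.norm_eq_abs]
    refine norm_integral_le_of_norm_le (Integrable.mul_const hI c) (Filter.Eventually.of_forall fun w => ?_)
    rw [norm_mul, Real.norm_eq_abs, Real.norm_eq_abs, abs_of_nonneg (ind_nonneg w)]
    by_cases hw : w ∈ cube z r
    · exact mul_le_mul_of_nonneg_left (h w hw) (ind_nonneg w)
    · rw [ind_of_not_mem hw]; simp
  rw [integral_mul_const, ind_int, cube_vol z hr, ENNReal.toReal_ofReal hv.le] at h1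
  calc _ ≤ (∏ i, 2 * r i)⁻¹ * ((∏ i, 2 * r i) * c) := mul_le_mul_of_nonneg_left h1 (inv_pos.2 hv).le
    _ = c := by field_simp

/-- cut a set of coordinates -/
def cutS (B : Bx ι) (z b : ι → ℝ) (s : Finset ι) : Bx ι where
  I i := if i ∈ s then B.I i ∩ Set.Icc (z i - b i) (z i + b i) else B.I i
  oc i := by
    split_ifs
    · exact (B.oc i).inter Set.ordConnected_Icc
    · exact B.oc i

theorem mem_cutS {B : Bx ι} {z b : ι → ℝ} {s : Finset ι} {w : ι → ℝ} :
    w ∈ (cutS B z b s).set ↔ w ∈ B.set ∧ ∀ i ∈ s, w i ∈ Set.Icc (z i - b i) (z i + b i) := by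
  simp only [Bx.set, cutS, Set.mem_ofPred_eq]
  constructor
  · intro h
    refine ⟨fun i => ?_, fun i hi => ?_⟩
    · have := h i
      split_ifs at this
      · exact this.1
      · exact this
    · have := h i
      rw [if_pos hi] at this
      exact this.2
  · rintro ⟨h1, h2⟩ i
    split_ifs with h
    · exact ⟨h1 i, h2 i h⟩
    · exact h1 i

theorem cutall {H : Measure (ι → ℝ)} [IsProbabilityMeasure H] (hH : Nice H) {K : ℝ} (hK0 : 0 ≤ K) {N k : ℕ}
    (hK : HK ι K N) (hk : k ≤ N) {r r1 : ι → ℝ} (hr : ∀ i, 0 < r i) (hrr : ∀ i, r i ≤ r1 i) {σ L : ℝ} (hσ : 0 ≤ σ)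
    (hL : 1 < L) (hv : ∀ i, (k + 1) * vv H i ≤ (σ * r1 i) ^ 2) (B : Bx ι) (z : ι → ℝ) (s : Finset ι) :
    |((gg H ^ k * AA H * ∏ i, S1 i (r i)) • ib B) z -
      ((gg H ^ k * AA H * ∏ i, S1 i (r i)) • ib (cutS B z (fun i => L * r1 i) s)) z| ≤
      s.card * (2 * (σ / (L - 1) * (4 * K + 1) / (k + 1))) := by
  set b : ι → ℝ := fun i => L * r1 i with hb
  set T := gg H ^ k * AA H * ∏ i, S1 i (r i) with hT
  have hr1 : ∀ i, 0 < r1 i := fun i => (hr i).trans_le (hrr i)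
  have one : ∀ (C : Bx ι) (i : ι) (t : ℝ), t ^ 2 = 1 → (∀ w ∈ C.set, b i < t * (w i - z i)) →
      |(T • ib C) z| ≤ σ / (L - 1) * (4 * K + 1) / (k + 1) := by
    intro C i t ht hC
    rw [hT, mul_comm, mul_smul]
    refine S_local hr fun w hw => ?_
    have h1 := hr1 i
    have hbb : 0 < (L - 1) * r1 i := mul_pos (by linarith) h1
    have := hH.cut hK hk (i := i) (σ := σ * r1 i) (b := (L - 1) * r1 i) (by positivity) hbb (hv i) (B := C) (z := w)
      ht (fun y hy => by
        have a1 := hC y hy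
        have a2 := (hw i).trans (hrr i)
        have a3 : t * (w i - z i) ≤ r1 i := by
          have : |t * (w i - z i)| = |w i - z i| := by
            have h1 : |t| = 1 := by
              rw [← sq_abs] at ht
              exact (pow_eq_one_iff_of_nonneg (abs_nonneg t) two_ne_zero).1 ht
            rw [abs_mul, h1, one_mul]
          exact (le_abs_self _).trans (this.le.trans a2)
        simp only [hb] at a1
        linarith)
    rwa [mul_div_mul_right _ _ h1.ne'] at this
  induction s using Finset.induction_on with
  | empty =>
    have : ib (cutS B z b ∅) = ib B := by
      have : cutS B z b ∅ = B := by cases B; simp [cutS]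
      rw [this]
    rw [this]; simp
  | insert j s hj ih =>
    set C := cutS B z b s with hC
    set C1 := C.cut j (Set.Ioi (z j + b j)) Set.ordConnected_Ioi with hC1
    set C2 := C.cut j (Set.Iio (z j - b j)) Set.ordConnected_Iio with hC2
    have e : ib C - ib (cutS B z b (insert j s)) = ib C1 + ib C2 := by
      ext w
      rw [BM.sub_apply, BM.add_apply]
      have m0 : w ∈ (cutS B z b (insert j s)).set ↔ w ∈ C.set ∧ w j ∈ Set.Icc (z j - b j) (z j + b j) := by
        rw [mem_cutS, hC, mem_cutS, Finset.forall_mem_insert]; tauto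
      have m1 : w ∈ C1.set ↔ w ∈ C.set ∧ z j + b j < w j := Bx.mem_cut
      have m2 : w ∈ C2.set ↔ w ∈ C.set ∧ w j < z j - b j := Bx.mem_cut
      have hbj : 0 < b j := mul_pos (by linarith) (hr1 j)
      by_cases hw : w ∈ C.set
      · rw [ib_of_mem hw]
        by_cases h1 : z j + b j < w j
        · have n2 : ¬ (w j < z j - b j) := by linarith
          rw [ib_of_mem (m1.2 ⟨hw, h1⟩), ib_of_not_mem (fun h => n2 (m2.1 h).2),
            ib_of_not_mem (fun h => absurd (m0.1 h).2.2 (by linarith))]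
          norm_num
        · by_cases h2 : w j < z j - b j
          · rw [ib_of_not_mem (fun h => h1 (m1.1 h).2), ib_of_mem (m2.2 ⟨hw, h2⟩),
              ib_of_not_mem (fun h => absurd (m0.1 h).2.1 (by linarith))]
            norm_num
          · rw [ib_of_not_mem (fun h => h1 (m1.1 h).2), ib_of_not_mem (fun h => h2 (m2.1 h).2),
              ib_of_mem (m0.2 ⟨hw, by linarith, by linarith⟩)]
            norm_num
      · rw [ib_of_not_mem hw, ib_of_not_mem (fun h => hw (m0.1 h).1), ib_of_not_mem (fun h => hw (m1.1 h).1),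
          ib_of_not_mem (fun h => hw (m2.1 h).1)]
        norm_num
    have e' : (T • ib C) z - (T • ib (cutS B z b (insert j s))) z = (T • ib C1) z + (T • ib C2) z := by
      rw [← BM.sub_apply, ← smul_sub, e, smul_add, BM.add_apply]
    have o1 := one C1 j 1 (by norm_num) (fun w hw => by
      have : z j + b j < w j := (Bx.mem_cut.1 hw).2
      linarith)
    have o2 := one C2 j (-1) (by norm_num) (fun w hw => by
      have : w j < z j - b j := (Bx.mem_cut.1 hw).2
      linarith)
    rw [Finset.card_insert_of_notMem hj]
    push_cast
    calc _ = |((T • ib B) z - (T • ib C) z) + ((T • ib C1) z + (T • ib C2) z)| := by rw [← e']; congr 1; ring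
      _ ≤ |(T • ib B) z - (T • ib C) z| + (|(T • ib C1) z| + |(T • ib C2) z|) :=
          (abs_add_le _ _).trans (add_le_add_right (abs_add_le _ _) _)
      _ ≤ _ := by linarith

end
end ZB

open MeasureTheory
namespace ZB
noncomputable section
variable {ι : Type} [Fintype ι] [DecidableEq ι]

theorem pow_low {y p C : ℝ} (hp0 : 0 < p) (hp : 1 - y ≤ p) (hp1 : p ≤ 1) (hy : 0 ≤ y) (hy2 : y ≤ 1 / 2) {n j : ℕ} (hj : 2 * j ≤ n)
    (hyn : n * y ≤ C) : 1 ≤ Real.exp (2 * C) * p ^ (2 * j) := by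
  have h1 : Real.exp (-(2 * y)) ≤ p := by
    refine le_trans ?_ hp
    rw [Real.exp_neg, inv_le_comm₀ (Real.exp_pos _) (by linarith)]
    refine le_trans ?_ (Real.add_one_le_exp _)
    rw [inv_le_iff_one_le_mul₀ (by linarith)]
    nlinarith
  have h2 : p ^ n ≤ p ^ (2 * j) := pow_le_pow_of_le_one hp0.le hp1 hj
  have h3 : Real.exp (-(2 * y)) ^ n ≤ p ^ n := pow_le_pow_left₀ (Real.exp_pos _).le h1 n
  rw [← Real.exp_nat_mul] at h3
  have h4 : Real.exp (2 * C) * Real.exp (n * -(2 * y)) ≤ Real.exp (2 * C) * p ^ (2 * j) :=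
    mul_le_mul_of_nonneg_left (h3.trans h2) (Real.exp_pos _).le
  refine le_trans ?_ h4
  rw [← Real.exp_add]
  exact Real.one_le_exp (by nlinarith)

theorem qbound {H H0 : Measure (ι → ℝ)} [IsProbabilityMeasure H] [IsProbabilityMeasure H0] {p : ℝ} (hc : Cnd H H0 p)
    {C5 : ℝ} {j n : ℕ} (h5 : 1 ≤ C5 * p ^ (2 * j)) (hC5 : 1 ≤ C5) {C' η lam : ℝ} (hC' : 1 ≤ C') (hη : 0 < η)
    (hη1 : η ≤ 1) (hlam : 0 < lam) (hl : lam ^ 2 * (1 + η) = 1) (hj : n + 1 ≤ 4 * (j + 1)) {i : ι} {r1 : ℝ} (hr : 0 < r1)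
    {D : ℕ} (hD : ∀ a, 1 ≤ a → a ≤ D → C' / (n + 1) * (1 + η) ^ (a - 1) ≤ VV H i (r1 / 2 ^ a)) (a : ℕ) (ha : a ≤ D)
    (e : ℝ) (z) : (gg H0 ^ j • slab i e (r1 / 2 ^ a)) z ≤ 16 * C5 * lam ^ a := by
  rcases Nat.eq_zero_or_pos a with h0 | h0
  · subst h0
    have := ((Mk.gg H0).pow j).le_const (f := slab i e (r1 / 2 ^ 0)) (C := 1) (slab_le_one _ _ _) z
    simp only [pow_zero, mul_one] at this ⊢
    linarith
  set ρ := r1 / 2 ^ a with hρd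
  have hρ : 0 < ρ := by positivity
  have h1 := conc H i hρ j e z
  have h2 := hc.gpow j (f := slab i e ρ) (slab_nonneg _ _ _) z
  set q0 := (gg H0 ^ j • slab i e ρ) z
  set q := (gg H ^ j • slab i e ρ) z
  have hq0 : 0 ≤ q0 := (Mk.gg H0).1.pow j _ (slab_nonneg _ _ _) z
  have hq : 0 ≤ q := (Mk.gg H).1.pow j _ (slab_nonneg _ _ _) z
  obtain ⟨b, rfl⟩ : ∃ b, a = b + 1 := ⟨a - 1, by omega⟩
  have h3 := hD (b + 1) h0 ha
  simp only [Nat.add_sub_cancel] at h3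
  have hn : (0:ℝ) < (n:ℝ) + 1 := by positivity
  have hjr : (n:ℝ) + 1 ≤ 4 * ((j:ℝ) + 1) := by exact_mod_cast hj
  have h4 : (1 / (2 * lam ^ b)) ≤ √((j + 1) * VV H i ρ) := by
    apply Real.le_sqrt_of_sq_le
    have e1 : (1 / (2 * lam ^ b)) ^ 2 = 1 / 4 * (1 + η) ^ b := by
      have : (lam ^ b) ^ 2 * (1 + η) ^ b = 1 := by
        rw [← pow_mul, mul_comm b 2, pow_mul, ← mul_pow, hl, one_pow]
      have hlb : (lam ^ b) ^ 2 ≠ 0 := by positivity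
      field_simp
      linarith
    rw [e1]
    have hpw : 0 ≤ (1 + η) ^ b := by positivity
    calc 1 / 4 * (1 + η) ^ b ≤ ((j + 1) / (n + 1)) * (1 * (1 + η) ^ b) := by
          rw [one_mul]
          refine mul_le_mul_of_nonneg_right ?_ hpw
          rw [div_le_div_iff₀ (by norm_num) hn]; linarith
      _ ≤ ((j + 1) / (n + 1)) * (C' * (1 + η) ^ b) := by gcongr
      _ = (j + 1) * (C' / (n + 1) * (1 + η) ^ b) := by ring
      _ ≤ _ := by gcongr
  have h5' : q ≤ 8 * lam ^ b := by
    have : q * (1 / (2 * lam ^ b)) ≤ 4 := (mul_le_mul_of_nonneg_left h4 hq).trans h1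
    rw [mul_one_div, div_le_iff₀ (by positivity)] at this
    linarith
  have hlam2 : 1 / 2 ≤ lam := by
    by_contra hcon
    push Not at hcon
    nlinarith
  have h6 : q0 ≤ C5 * q := by
    calc q0 ≤ (C5 * p ^ (2 * j)) * q0 := le_mul_of_one_le_left hq0 h5
      _ = C5 * (p ^ (2 * j) * q0) := by ring
      _ ≤ C5 * q := mul_le_mul_of_nonneg_left h2 (by linarith)
  have h7 : lam ^ b ≤ 2 * lam ^ (b + 1) := by
    rw [pow_succ]
    have : 0 < lam ^ b := by positivity
    nlinarith
  calc q0 ≤ C5 * (8 * (2 * lam ^ (b + 1))) := h6.trans (mul_le_mul_of_nonneg_left (by linarith) (by linarith))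
    _ = _ := by ring

/-- constant of the expansion -/
def cC6 (m : ℕ) (L C' μ : ℝ) : ℝ :=
  (1 + (2 * L) ^ m * (2 * (L + 1))) * (16 * Real.exp (2 * (m * C'))) * (1 / (1 - μ)) ^ m

/-- bound for the truncated measure -/
def cD1 (m : ℕ) (L C' μ K : ℝ) : ℝ := m * (2 * (4 * √C' / (L - 1) * (4 * K + 1))) + cC6 m L C' μ

theorem trunc_est [Nonempty ι] {H H0 : Measure (ι → ℝ)} [IsProbabilityMeasure H] [IsProbabilityMeasure H0] {p : ℝ}
    (hc : Cnd H H0 p) (hH0 : Nice H0) {K : ℝ} (hK0 : 0 ≤ K) {N n k : ℕ} (hK : HK ι K N) (hk : k ≤ n) (hnN : n ≤ N)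
    (hkn : n ≤ 2 * k)
    {C' η μ L : ℝ} (hC' : 1 ≤ C') (hη : 0 < η) (hη1 : η ≤ 1) (hμ : 0 < μ) (hμ1 : μ < 1)
    (hl : (μ ^ Fintype.card ι) ^ 2 * (1 + η) = 1) (hL : 1 < L)
    (hp : 1 - Fintype.card ι * (C' / (n + 1)) ≤ p) (hmx : Fintype.card ι * (C' / (n + 1)) ≤ 1 / 2)
    {r1 c : ι → ℝ} {D : ι → ℕ} (hr : ∀ i, 0 < r1 i) (hV1 : ∀ i, VV H i (r1 i) ≤ C' / (n + 1))
    (hs : ∀ i, ∀ᵐ x ∂H0, |x i - c i| ≤ r1 i)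
    (hD : ∀ i, ∀ a, 1 ≤ a → a ≤ D i → C' / (n + 1) * (1 + η) ^ (a - 1) ≤ VV H i (r1 i / 2 ^ a))
    (B : Bx ι) (z : ι → ℝ) :
    |((gg H0 ^ k * AA H0 * ∏ i, S1 i (r1 i / 2 ^ D i)) • ib B) z| ≤ cD1 (Fintype.card ι) L C' μ K / (k + 1) := by
  set m := Fintype.card ι with hm
  have hn : (0:ℝ) < (n:ℝ) + 1 := by positivity
  have hk1 : (0:ℝ) < (k:ℝ) + 1 := by positivity
  have hkr : (k:ℝ) + 1 ≤ (n:ℝ) + 1 := by exact_mod_cast Nat.add_le_add_right hk 1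
  have hp2 : 1 / 2 ≤ p := by linarith
  have hx0 : 0 < C' / (n + 1) := by positivity
  -- second moments
  have hvv : ∀ i, (k + 1) * vv H0 i ≤ (4 * √C' * r1 i) ^ 2 := by
    intro i
    have a1 := hc.vv_le (hs i)
    have hr2 : 0 < 2 * r1 i := by have := hr i; positivity
    have a2 := tsq_VV H i hr2
    have a3 : VV H i (2 * r1 i) ≤ C' / (n + 1) := (VV_anti H i (hr i) (by have := hr i; linarith)).trans (hV1 i)
    have a4 : p ^ 2 * vv H0 i ≤ (2 * r1 i) ^ 2 * (C' / (n + 1)) :=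
      a1.trans (a2.trans (mul_le_mul_of_nonneg_left a3 (by positivity)))
    have a5 : (1 / 4) * vv H0 i ≤ p ^ 2 * vv H0 i := mul_le_mul_of_nonneg_right (by nlinarith) (vv_nonneg _ _)
    have a6 : vv H0 i ≤ 16 * r1 i ^ 2 * (C' / (n + 1)) := by nlinarith
    calc (k + 1) * vv H0 i ≤ (n + 1) * (16 * r1 i ^ 2 * (C' / (n + 1))) :=
          mul_le_mul hkr a6 (vv_nonneg _ _) hn.le
      _ = 16 * r1 i ^ 2 * C' := by field_simp
      _ = (4 * √C' * r1 i) ^ 2 := by rw [mul_pow, mul_pow, Real.sq_sqrt (by linarith)]; ring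
  have hrD : ∀ i, 0 < r1 i / 2 ^ D i := fun i => by have := hr i; positivity
  have hrle : ∀ i, r1 i / 2 ^ D i ≤ r1 i := fun i => div_le_self (hr i).le (one_le_pow₀ (by norm_num))
  have c1 := cutall hH0 hK0 hK (hk.trans hnN) hrD hrle (σ := 4 * √C') (L := L) (by positivity) hL hvv B z Finset.univ
  set B' := cutS B z (fun i => L * r1 i) Finset.univ with hB'
  have hB'm : ∀ i, ∀ x ∈ B'.I i, |x - z i| ≤ L * r1 i := by
    intro i x hx
    simp only [hB', cutS, Finset.mem_univ, if_true] at hx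
    have := hx.2
    rw [Set.mem_Icc] at this
    rw [abs_le]; constructor <;> linarith
  have hexp : 1 ≤ Real.exp (2 * (m * C')) := Real.one_le_exp (by positivity)
  have hj4 : n + 1 ≤ 4 * (k / 2 + 1) := by omega
  have h5 : 1 ≤ Real.exp (2 * (m * C')) * p ^ (2 * (k / 2)) := by
    refine pow_low hc.pos hp hc.le (by positivity) hmx (n := n) (by omega) ?_
    calc (n:ℝ) * (m * (C' / (n + 1))) = m * C' * (n / (n + 1)) := by ring
      _ ≤ m * C' * 1 := by
        refine mul_le_mul_of_nonneg_left ?_ (by positivity)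
        rw [div_le_one hn]; linarith
      _ = m * C' := mul_one _
  have c2 := expand H0 B' z hr hL.le hB'm D (μ := μ) (Q := 16 * Real.exp (2 * (m * C'))) hμ.le hμ1 (by positivity)
    (k / 2) (k - k / 2) (fun i a ha e y => by
      rw [pow_mul]
      exact qbound hc h5 hexp hC' hη hη1 (pow_pos hμ _) hl hj4 (hr i) (hD i) a ha e y)
  rw [show k / 2 + (k - k / 2) = k by omega] at c2
  have c3 : (1 + (2 * L) ^ m * (2 * (L + 1))) * (16 * Real.exp (2 * (m * C'))) * (1 / (1 - μ)) ^ m /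
      (2 * (((k - k / 2 : ℕ) : ℝ) + 1)) ≤ cC6 m L C' μ / (k + 1) := by
    unfold cC6
    have hL0 : 0 < L := by linarith
    have : 0 < 1 - μ := by linarith
    have hk2 : (k:ℝ) + 1 ≤ 2 * (((k - k / 2 : ℕ) : ℝ) + 1) := by
      have : k + 1 ≤ 2 * ((k - k / 2) + 1) := by omega
      exact_mod_cast this
    gcongr
  have c4 := c2.trans c3
  rw [Finset.card_univ, ← hm] at c1
  have c5 := abs_sub_abs_le_abs_sub (((gg H0 ^ k * AA H0 * ∏ i, S1 i (r1 i / 2 ^ D i)) • ib B) z)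
    (((gg H0 ^ k * AA H0 * ∏ i, S1 i (r1 i / 2 ^ D i)) • ib B') z)
  have e : cD1 m L C' μ K / (k + 1) = m * (2 * (4 * √C' / (L - 1) * (4 * K + 1) / (k + 1))) + cC6 m L C' μ / (k + 1) := by
    unfold cD1; ring
  rw [e]
  linarith

/-- the K-dependent constant of `Psi` -/
def cPsi (M : ℕ) (C' η K : ℝ) (n : ℕ) : ℝ :=
  192 + 544 * √M + (K + 1) * (360 * (4 / √C' + 3 * √η) + 4080 * (4 * M / √(n + 1) + 1 / √M))

theorem main1 [Nonempty ι] {H : Measure (ι → ℝ)} [IsProbabilityMeasure H]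
    (hH : Nice H) {K : ℝ} (hK0 : 0 ≤ K) {N n : ℕ} (hK : HK ι K N) (hnN : n ≤ N)
    {C' η μ L : ℝ} {M : ℕ} (hM : 0 < M) (hC' : 1 ≤ C') (hη : 0 < η) (hη1 : η ≤ 1) (hμ : 0 < μ) (hμ1 : μ < 1)
    (hl : (μ ^ Fintype.card ι) ^ 2 * (1 + η) = 1) (hL : 1 < L)
    (hx : C' / (n + 1) ≤ 1 / 128) (hmx : Fintype.card ι * (C' / (n + 1)) ≤ 1 / 2)
    (B : Bx ι) (z : ι → ℝ) :
    |((gg H ^ n * AA H) • ib B) z| ≤ (2 * Fintype.card ι * cPsi M C' η K n + 12 * (Fintype.card ι * C') +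
      4 * cD1 (Fintype.card ι) L C' μ K) / (n + 1) := by
  have hn : (0:ℝ) < (n:ℝ) + 1 := by positivity
  have hx0 : 0 < C' / (n + 1) := by positivity
  choose r1 D hr hD1 hV1 hVa hV32 hor using fun i => scales H i hH hx0 hx hη
  choose c hcen using fun i => center H i (hr i) one_pos le_rfl
  set S := ∏ i, S1 i (r1 i / 2 ^ D i) with hS
  have hrD : ∀ i, 0 < r1 i / 2 ^ D i := fun i => by have := hr i; positivity
  have hSm : Mk S := Mk.prod _ fun i _ => Mk.S1 i (hrD i)
  set m := Fintype.card ι with hm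
  -- smoothing
  have p1 : |((gg H ^ n * AA H * (1 - S)) • ib B) z| ≤ 2 * m * (cPsi M C' η K n / (n + 1)) := by
    refine smooth_all hrD (fun i B e hB y => ?_) B z
    have hxV : C' / (n + 1) ≤ VV H i (r1 i / 2 ^ D i) := by
      refine le_trans ?_ (hVa i (D i) (hD1 i) le_rfl)
      exact le_mul_of_one_le_right hx0.le (one_le_pow₀ (by linarith))
    have := Psi hH hK0 hK hnN (hrD i) hη hx0 hxV (hV32 i) (hor i) hM (MB.ib hB) y
    rwa [mul_div_cancel₀ _ hn.ne'] at this
  -- truncation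
  set s : Set (ι → ℝ) := {y | ∀ i, |y i - c i| ≤ r1 i} with hs
  have hsm : MeasurableSet s := by
    have : s = ⋂ i, {y | |y i - c i| ≤ r1 i} := by ext; simp [hs]
    rw [this]
    exact MeasurableSet.iInter fun i => measurableSet_le (by fun_prop) measurable_const
  have hp : 1 - m * (C' / (n + 1)) ≤ H.real s := by
    have h1 : H.real sᶜ ≤ m * (C' / (n + 1)) := by
      have : sᶜ ⊆ ⋃ i, {y | 1 * r1 i < |y i - c i|} := by
        intro y hy
        by_contra hcon
        simp only [Set.mem_iUnion, Set.mem_ofPred_eq, not_exists, not_lt, one_mul] at hcon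
        exact hy hcon
      calc H.real sᶜ ≤ H.real (⋃ i, {y | 1 * r1 i < |y i - c i|}) := measureReal_mono this
        _ ≤ ∑ i, H.real {y | 1 * r1 i < |y i - c i|} := measureReal_iUnion_fintype_le _
        _ ≤ ∑ _i : ι, C' / (n + 1) := Finset.sum_le_sum fun i _ => by
            have := hcen i
            simp only [one_pow, mul_one] at this
            exact this.trans (hV1 i)
        _ = m * (C' / (n + 1)) := by simp [hm]
    rw [probReal_compl_eq_one_sub hsm] at h1
    linarith
  have hp2 : 1 / 2 ≤ H.real s := by linarith
  obtain ⟨H0, hH0p, hc, hae, -⟩ := cnd H hsm (by linarith)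
  set p := H.real s with hpd
  have hsae : ∀ i, ∀ᵐ x ∂H0, |x i - c i| ≤ r1 i := fun i => by
    filter_upwards [hae] with x hx using hx i
  have p2 : |((gg H ^ n * ((AA H - AA H0) * S)) • ib B) z| ≤ 4 * (m * (C' / (n + 1))) := by
    have := (((Mk.gg H).pow n).Bdd.mul (hc.diff.mul hSm.Bdd)).abs_le (f := ib B) (Q := 1)
      (fun w => abs_le.2 ⟨by linarith [ib_nonneg B w], ib_le_one B w⟩) z
    refine this.trans ?_
    linarith
  have hn1 : (1:ℝ) ≤ n := by
    rw [div_le_iff₀ hn] at hx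
    linarith
  have hD1p : 0 ≤ cD1 m L C' μ K := by
    unfold cD1 cC6
    have : 0 < L := by linarith
    have : 0 < L - 1 := by linarith
    have : 0 < 1 - μ := by linarith
    positivity
  have p3 : |(gg H ^ n • (AA H0 * S) • ib B) z| ≤ 2 * cD1 m L C' μ K / ((n + 1) * p) + 0 + 2 * (4 / n) * n * (1 - p) := by
    refine hc.dbl hD1p (by positivity) (fun k hk y => ?_) z
    have hk1 : (0:ℝ) < (k:ℝ) + 1 := by positivity
    have hkr : (k:ℝ) ≤ n := by exact_mod_cast hk
    rw [add_zero, ← mul_smul, ← mul_assoc]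
    rcases le_or_gt n (2 * k) with h2 | h2
    · have := trunc_est hc (hc.nice hH) hK0 hK hk hnN h2 hC' hη hη1 hμ hμ1 hl hL hp hmx hr hV1 hsae hVa B y
      have : 0 ≤ 4 / (n:ℝ) * (n - k) := mul_nonneg (by positivity) (by linarith)
      linarith
    · have h3 : (2:ℝ) * k ≤ n := by exact_mod_cast h2.le
      have := (((Mk.gg H0).pow k).Bdd.mul (Bdd.AA H0)).mul hSm.Bdd |>.abs_le (f := ib B) (Q := 1)
        (fun w => abs_le.2 ⟨by linarith [ib_nonneg B w], ib_le_one B w⟩) y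
      have h4 : 2 ≤ 4 / (n:ℝ) * (n - k) := by
        rw [div_mul_eq_mul_div, le_div_iff₀ (by linarith)]; linarith
      have h5 : 0 ≤ cD1 m L C' μ K / (k + 1) := by positivity
      linarith
  have p3' : |(gg H ^ n • (AA H0 * S) • ib B) z| ≤ 4 * cD1 m L C' μ K / (n + 1) + 8 * (m * (C' / (n + 1))) := by
    refine p3.trans ?_
    have a1 : 2 * cD1 m L C' μ K / ((n + 1) * p) ≤ 4 * cD1 m L C' μ K / (n + 1) := by
      rw [div_le_div_iff₀ (mul_pos hn hc.pos) hn]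
      have : 0 ≤ cD1 m L C' μ K * (n + 1) := by positivity
      nlinarith
    have a2 : 2 * (4 / (n:ℝ)) * n * (1 - p) = 8 * (1 - p) := by
      field_simp; ring
    rw [a2]; linarith
  have e : ((gg H ^ n * AA H) • ib B) z = ((gg H ^ n * AA H * (1 - S)) • ib B) z +
      ((gg H ^ n * ((AA H - AA H0) * S)) • ib B) z + (gg H ^ n • (AA H0 * S) • ib B) z := by
    rw [← BM.add_apply, ← mul_smul, ← add_smul, ← BM.add_apply, ← add_smul]
    congr 2; ring
  rw [e]
  refine (abs_add_le _ _).trans ((add_le_add_left (abs_add_le _ _) _).trans ?_)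
  have e2 : (2 * m * cPsi M C' η K n + 12 * (m * C') + 4 * cD1 m L C' μ K) / (n + 1) =
    2 * m * (cPsi M C' η K n / (n + 1)) + 4 * (m * (C' / (n + 1))) + (4 * cD1 m L C' μ K / (n + 1) + 8 * (m * (C' / (n + 1)))) := by
    ring
  rw [e2]
  linarith

end
end ZB

open MeasureTheory
namespace ZB
noncomputable section

theorem exists_mu {η : ℝ} (hη : 0 < η) {m : ℕ} (hm : 0 < m) :
    ∃ μ : ℝ, 0 < μ ∧ μ < 1 ∧ (μ ^ m) ^ 2 * (1 + η) = 1 := by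
  have hmr : (0:ℝ) < m := by exact_mod_cast hm
  refine ⟨(1 + η) ^ (-(1 / (2 * m) : ℝ)), by positivity, ?_, ?_⟩
  · apply Real.rpow_lt_one_of_one_lt_of_neg (by linarith)
    have : (0:ℝ) < 1 / (2 * m) := by positivity
    linarith
  · rw [← pow_mul, ← Real.rpow_natCast, ← Real.rpow_mul (by linarith)]
    have : (-(1 / (2 * m) : ℝ)) * ((m * 2 : ℕ) : ℝ) = -1 := by
      push_cast; field_simp
    rw [this, Real.rpow_neg_one]
    exact inv_mul_cancel₀ (by linarith)

theorem step_const (m : ℕ) (hm : 0 < m) : ∃ a : ℝ, 0 ≤ a ∧ ∀ (ι : Type) [Fintype ι] [DecidableEq ι] [Nonempty ι],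
    Fintype.card ι = m → ∀ (K : ℝ) (N : ℕ), 0 ≤ K → HK ι K N → 
    ∀ (H : Measure (ι → ℝ)) [IsProbabilityMeasure H], Nice H → ∀ B : Bx ι, ∀ k ≤ N, ∀ z,
    |((gg H ^ k * AA H) • ib B) z| ≤ (a + K / 2) / (k + 1) := by
  have hmr : (1:ℝ) ≤ m := by exact_mod_cast hm
  have hm0 : (0:ℝ) < m := by linarith
  set s : ℝ := 57600 * m with hs
  set C' : ℝ := s ^ 2 with hC'
  set t : ℝ := 1 / (43200 * m) with ht
  set η : ℝ := t ^ 2 with hη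
  set u : ℝ := 163200 * m with hu
  set M : ℕ := (163200 * m) ^ 2 with hM
  have hMr : (M:ℝ) = u ^ 2 := by rw [hM, hu]; push_cast; ring
  set L : ℝ := 1 + 2560 * m * s with hL
  set v : ℝ := 652800 * m * M with hv
  set T : ℝ := v ^ 2 + 128 * C' + 2 * m * C' with hT
  have hs1 : 1 ≤ s := by rw [hs]; linarith
  have ht0 : 0 < t := by positivity
  have ht1 : t ≤ 1 := by
    rw [ht, div_le_one (by positivity)]; linarith
  have hη0 : 0 < η := by positivity
  have hη1 : η ≤ 1 := pow_le_one₀ ht0.le ht1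
  have hu0 : 0 < u := by positivity
  have hM0 : 0 < M := by positivity
  have hMr0 : (0:ℝ) < M := by exact_mod_cast hM0
  have hC1 : 1 ≤ C' := one_le_pow₀ hs1
  have hs0 : 0 < s := by linarith
  have hL1 : 1 < L := by rw [hL]; have : 0 < 2560 * m * s := by positivity
                         linarith
  have hv0 : 0 < v := by positivity
  have hsC : √C' = s := Real.sqrt_sq (by linarith)
  have hsη : √η = t := Real.sqrt_sq ht0.le
  have hsM : √(M:ℝ) = u := by rw [hMr]; exact Real.sqrt_sq hu0.le
  obtain ⟨μ, hμ, hμ1, hl⟩ := exists_mu hη0 hm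
  have hμ2 : 0 < 1 - μ := by linarith
  have hC60 : 0 ≤ cC6 m L C' μ := by unfold cC6; have : 0 < L := by linarith
                                     positivity
  refine ⟨2 * m * (192 + 544 * u) + 12 * (m * C') + 4 * cC6 m L C' μ + 1 + 2 * T, by positivity, ?_⟩
  intro ι _ _ _ hcard K N hK0 hK H _ hH B k hk z
  have hk0 : (0:ℝ) < (k:ℝ) + 1 := by positivity
  rcases lt_or_ge ((k:ℝ) + 1) T with h | h
  · have h2 := (Bdd.gA H k).abs_le (f := ib B) (Q := 1)
        (fun w => abs_le.2 ⟨by linarith [ib_nonneg B w], ib_le_one B w⟩) z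
    refine h2.trans ?_
    rw [le_div_iff₀ hk0]
    have : 0 ≤ 2 * m * (192 + 544 * u) + 12 * (m * C') + 4 * cC6 m L C' μ + 1 := by positivity
    nlinarith
  · have hmC : 0 < 2 * m * C' := by positivity
    have hvT : v ≤ √((k:ℝ) + 1) := by
      apply Real.le_sqrt_of_sq_le
      linarith
    have := main1 hH hK0 hK hk (M := M) (C' := C') (η := η) (μ := μ) (L := L) hM0 hC1 hη0 hη1 hμ hμ1 (by rw [hcard]; exact hl) hL1
      (by rw [div_le_div_iff₀ hk0 (by norm_num)]; nlinarith [sq_nonneg v])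
      (by rw [hcard, ← mul_div_assoc, div_le_div_iff₀ hk0 (by norm_num)]; nlinarith [sq_nonneg v]) B z
    rw [hcard] at this
    refine this.trans ?_
    refine (div_le_div_iff_of_pos_right hk0).2 ?_
    unfold cPsi cD1
    rw [hsC, hsη, hsM]
    have k1 : 2 * m * (360 * (4 / s)) = 1 / 20 := by rw [hs]; field_simp; norm_num
    have k2 : 2 * m * (360 * (3 * t)) = 1 / 20 := by rw [ht]; field_simp; norm_num
    have k3 : 2 * m * (4080 * (1 / u)) = 1 / 20 := by rw [hu]; field_simp; norm_num
    have k4 : 2 * m * (4080 * (4 * M / √((k:ℝ) + 1))) ≤ 1 / 20 := by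
      have : 4 * (M:ℝ) / √((k:ℝ) + 1) ≤ 4 * M / v := by gcongr
      calc 2 * m * (4080 * (4 * M / √((k:ℝ) + 1))) ≤ 2 * m * (4080 * (4 * M / v)) := by gcongr
        _ = 1 / 20 := by rw [hv]; field_simp; norm_num
    have k5 : m * (2 * (4 * s / (L - 1))) = 1 / 320 := by
      rw [hL, add_sub_cancel_left]; field_simp; norm_num
    have e1 : 2 * (m:ℝ) * (192 + 544 * u + (K + 1) * (360 * (4 / s + 3 * t) + 4080 * (4 * M / √((k:ℝ) + 1) + 1 / u))) =
      2 * m * (192 + 544 * u) + (K + 1) * (2 * m * (360 * (4 / s)) + 2 * m * (360 * (3 * t)) + 2 * m * (4080 * (1 / u))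
        + 2 * m * (4080 * (4 * M / √((k:ℝ) + 1)))) := by ring
    have e2 : (m:ℝ) * (2 * (4 * s / (L - 1) * (4 * K + 1))) = (m * (2 * (4 * s / (L - 1)))) * (4 * K + 1) := by ring
    rw [e1, e2, k1, k2, k3, k5]
    have k6 : (K + 1) * (1 / 20 + 1 / 20 + 1 / 20 + 2 * m * (4080 * (4 * M / √((k:ℝ) + 1)))) ≤ (K + 1) * (1 / 5) :=
      mul_le_mul_of_nonneg_left (by linarith) (by linarith)
    have hT0 : 0 ≤ T := by positivity
    linarith

/-- index type for the self-bounding argument -/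
structure QI (ι : Type) [Fintype ι] (N : ℕ) where
  H : Measure (ι → ℝ)
  pr : IsProbabilityMeasure H
  nice : Nice H
  B : Bx ι
  k : ℕ
  hk : k ≤ N
  z : ι → ℝ

theorem HK_all (m : ℕ) (hm : 0 < m) : ∃ C : ℝ, 0 ≤ C ∧ ∀ (ι : Type) [Fintype ι] [DecidableEq ι],
    Fintype.card ι = m → ∀ N, HK ι C N := by
  obtain ⟨a, ha, h⟩ := step_const m hm
  refine ⟨2 * a, by positivity, ?_⟩
  intro ι _ _ hcard N
  haveI : Nonempty ι := Fintype.card_pos_iff.1 (by omega)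
  set φ : QI ι N → ℝ := fun q => haveI := q.pr; ((q.k:ℝ) + 1) * |((gg q.H ^ q.k * AA q.H) • ib q.B) q.z| with hφ
  have key : ∀ q, φ q ≤ 2 * a := by
    refine selfbd φ ((N + 1) * 2) ?_ a ?_
    · intro q
      haveI := q.pr
      have h2 := (Bdd.gA q.H q.k).abs_le (f := ib q.B) (Q := 1)
        (fun w => abs_le.2 ⟨by linarith [ib_nonneg q.B w], ib_le_one q.B w⟩) q.z
      have hk : (q.k:ℝ) ≤ N := by exact_mod_cast q.hk
      simp only [hφ]
      refine mul_le_mul (by linarith) (by linarith) (abs_nonneg _) (by positivity)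
    · intro K hK q
      haveI := q.pr
      have hK0 : 0 ≤ K := le_trans (by simp only [hφ]; positivity) (hK q)
      have hHK : HK ι K N := by
        intro H hp hH B k hk z
        have := hK ⟨H, hp, hH, B, k, hk, z⟩
        simp only [hφ] at this
        rw [le_div_iff₀ (by positivity)]; linarith
      have := h ι hcard K N hK0 hHK q.H q.nice q.B q.k q.hk q.z
      rw [le_div_iff₀ (by positivity)] at this
      simp only [hφ]; linarith
  intro H hp hH B k hk z
  have := key ⟨H, hp, hH, B, k, hk, z⟩
  simp only [hφ] at this
  rw [le_div_iff₀ (by positivity)]; linarith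

end
end ZB

open MeasureTheory

namespace ZB

noncomputable section

variable {ι : Type} [Fintype ι] [DecidableEq ι]

/-- indicator of a coordinate upper set -/
def iu (j : ι) (U : Set ℝ) (hU : U.OrdConnected) : BM ι :=
  ind ((fun w : ι → ℝ => w j) ⁻¹' U) (measurable_pi_apply j hU.measurableSet)

theorem iu_of_mem {j : ι} {U : Set ℝ} {hU : U.OrdConnected} {w : ι → ℝ} (h : w j ∈ U) :
    iu j U hU w = 1 := ind_of_mem h
theorem iu_of_not_mem {j : ι} {U : Set ℝ} {hU : U.OrdConnected} {w : ι → ℝ} (h : w j ∉ U) :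
    iu j U hU w = 0 := ind_of_not_mem h

theorem iu_abs (j : ι) (U : Set ℝ) (hU : U.OrdConnected) (w : ι → ℝ) : |iu j U hU w| ≤ 1 := by
  unfold iu
  rw [abs_of_nonneg (ind_nonneg w)]; exact ind_le_one w

theorem integral_symm {F : Measure (ι → ℝ)} (hs : F.map (fun y => -y) = F)
    {f : (ι → ℝ) → ℝ} (hf : Measurable f) : ∫ y, f (-y) ∂F = ∫ y, f y ∂F := by
  conv_rhs => rw [← hs]
  rw [integral_map meas_neg.aemeasurable hf.aestronglyMeasurable]

/-- sign -/
def sg (x : ℝ) : ℝ := if 0 < x then 1 else if x < 0 then -1 else 0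

theorem sg_meas : Measurable sg :=
  Measurable.ite measurableSet_Ioi measurable_const
    (Measurable.ite measurableSet_Iio measurable_const measurable_const)

theorem sg_neg (x : ℝ) : sg (-x) = - sg x := by
  unfold sg
  rcases lt_trichotomy x 0 with h | h | h
  · simp [h, h.le, not_lt.2 h.le]
  · simp [h]
  · simp [h, not_lt.2 h.le]

theorem sg_abs (x : ℝ) : |sg x| ≤ 1 := by
  unfold sg; split_ifs <;> simp

theorem upper_pt {U : Set ℝ} (hU : U.OrdConnected) (hU' : IsUpperSet U) {j : ι} (w y : ι → ℝ) :
    |iu j U hU (w + y) - iu j U hU w| ≤ sg (y j) * (iu j U hU (w + y) - iu j U hU (w + -y)) := by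
  have e1 : (w + y) j = w j + y j := rfl
  have e2 : (w + -y) j = w j - y j := by simp [sub_eq_add_neg]
  have v : ∀ v : ι → ℝ, (v j ∈ U ∧ iu j U hU v = 1) ∨ (v j ∉ U ∧ iu j U hU v = 0) := by
    intro v
    by_cases h : v j ∈ U
    · exact Or.inl ⟨h, iu_of_mem h⟩
    · exact Or.inr ⟨h, iu_of_not_mem h⟩
  have mono : ∀ v v' : ι → ℝ, v j ≤ v' j → iu j U hU v ≤ iu j U hU v' := by
    intro a b hab
    rcases v a with ⟨ha, ha'⟩ | ⟨ha, ha'⟩ <;> rcases v b with ⟨hb, hb'⟩ | ⟨hb, hb'⟩ <;> rw [ha', hb']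
    · exact absurd (hU' hab ha) hb
    · norm_num
  unfold sg
  rcases lt_trichotomy (y j) 0 with h | h | h
  · rw [if_neg (not_lt.2 h.le), if_pos h]
    have h1 := mono (w + y) w (by rw [e1]; linarith)
    have h2 := mono w (w + -y) (by rw [e2]; linarith)
    rw [abs_le]; constructor <;> linarith
  · have h1 := mono (w + y) w (by rw [e1]; linarith)
    have h2 := mono w (w + y) (by rw [e1]; linarith)
    rw [if_neg (by linarith), if_neg (by linarith), abs_le]; constructor <;> linarith
  · rw [if_pos h]
    have h1 := mono w (w + y) (by rw [e1]; linarith)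
    have h2 := mono (w + -y) w (by rw [e2]; linarith)
    rw [abs_le]; constructor <;> linarith

theorem sg_int (F : Measure (ι → ℝ)) [IsProbabilityMeasure F] (j : ι) :
    Integrable (fun y : ι → ℝ => sg (y j)) F :=
  Integrable.of_bound (sg_meas.comp (measurable_pi_apply j)).aestronglyMeasurable 1
    (Filter.Eventually.of_forall fun _ => sg_abs _)

/-- sign kernel -/
def WW (F : Measure (ι → ℝ)) [IsProbabilityMeasure F] (j : ι) : Op ι :=
  ker F id measurable_id (fun y : ι → ℝ => sg (y j)) (sg_meas.comp (measurable_pi_apply j)) (sg_int F j)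

theorem WW_bdd (F : Measure (ι → ℝ)) [IsProbabilityMeasure F] (hs : F.map (fun y => -y) = F)
    (j : ι) (N : ℕ) : Bdd (WW F j * km F ^ N) (√(1 / (N + 1))) := by
  have hi2 : Integrable (fun y : ι → ℝ => sg (y j) ^ 2) F :=
    Integrable.of_bound ((sg_meas.comp (measurable_pi_apply j)).pow_const 2).aestronglyMeasurable 1
      (Filter.Eventually.of_forall fun y => by
        rw [Real.norm_eq_abs, abs_pow]
        exact pow_le_one₀ (abs_nonneg _) (sg_abs _))
  have h0 : ∫ y : ι → ℝ, sg (y j) ∂F = 0 := by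
    have := integral_symm hs (f := fun y => sg (y j)) (sg_meas.comp (measurable_pi_apply j))
    simp only [Pi.neg_apply, sg_neg, integral_neg] at this
    linarith
  have h := Bdd_rep' F id measurable_id (fun y : ι → ℝ => sg (y j))
    (sg_meas.comp (measurable_pi_apply j)) (sg_int F j) hi2 h0 N
  refine Bdd.mono (a := WW F j * km F ^ N) h (Real.sqrt_le_sqrt ?_)
  have : ∫ y : ι → ℝ, sg (y j) ^ 2 ∂F ≤ ∫ y : ι → ℝ, (1:ℝ) ∂F := by
    refine integral_mono hi2 (integrable_const _) fun y => ?_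
    have := sg_abs (y j)
    rw [← sq_abs]
    exact pow_le_one₀ (abs_nonneg _) this
  simp at this
  gcongr

theorem WW_ge (F : Measure (ι → ℝ)) [IsProbabilityMeasure F] (hs : F.map (fun y => -y) = F)
    (j : ι) {U : Set ℝ} (hU : U.OrdConnected) (hU' : IsUpperSet U) (w : ι → ℝ) :
    ∫ y, |iu j U hU (w + y) - iu j U hU w| ∂F ≤ 2 * (WW F j • iu j U hU) w := by
  set f := iu j U hU
  have i1 : Integrable (fun y : ι → ℝ => sg (y j) * f (w + y)) F :=
    integrable_mul_BM measurable_id (sg_int F j) f w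
  have i2 : Integrable (fun y : ι → ℝ => sg (y j) * f (w + -y)) F :=
    integrable_mul_BM meas_neg (sg_int F j) f w
  have h1 : (WW F j • f) w = ∫ y : ι → ℝ, sg (y j) * f (w + y) ∂F := ker_apply ..
  have h2 : (WW F j • f) w = - ∫ y : ι → ℝ, sg (y j) * f (w + -y) ∂F := by
    rw [h1, ← integral_symm hs (f := fun y : ι → ℝ => sg (y j) * f (w + y)), ← integral_neg]
    · simp [sg_neg]
    · exact (sg_meas.comp (measurable_pi_apply j)).mul (f.meas.comp (measurable_const_add w))
  have h3 : 2 * (WW F j • f) w = ∫ y : ι → ℝ, sg (y j) * (f (w + y) - f (w + -y)) ∂F := by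
    simp_rw [mul_sub]
    rw [integral_sub i1 i2]
    linarith
  rw [h3]
  refine integral_mono ?_ ?_ fun y => upper_pt hU hU' w y
  · exact ((BM.integrable F measurable_id f w).sub (integrable_const _)).abs
  · have := i1.sub i2
    refine this.congr (Filter.Eventually.of_forall fun y => ?_)
    simp [mul_sub]

/-- upper closure -/
def up (I : Set ℝ) : Set ℝ := {x | ∃ y ∈ I, y ≤ x}
theorem up_upper (I : Set ℝ) : IsUpperSet (up I) := fun _ _ h ⟨y, hy, hyx⟩ => ⟨y, hy, hyx.trans h⟩
theorem up_upper' {I : Set ℝ} (hI : I.OrdConnected) : IsUpperSet (up I \ I) := by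
  rintro a b h ⟨⟨y, hy, hya⟩, ha⟩
  exact ⟨⟨y, hy, hya.trans h⟩, fun hb => ha (hI.out hy hb ⟨hya, h⟩)⟩

theorem up_dec {I : Set ℝ} (hI : I.OrdConnected) (j : ι) (w : ι → ℝ) :
    iu j I hI w = iu j (up I) (up_upper I).ordConnected w
      - iu j (up I \ I) (up_upper' hI).ordConnected w := by
  by_cases h : w j ∈ I
  · rw [iu_of_mem h, iu_of_mem (⟨_, h, le_rfl⟩ : w j ∈ up I), iu_of_not_mem (fun h' => h'.2 h)]
    norm_num
  · rw [iu_of_not_mem h]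
    by_cases h2 : w j ∈ up I
    · rw [iu_of_mem h2, iu_of_mem (⟨h2, h⟩ : w j ∈ up I \ I)]; norm_num
    · rw [iu_of_not_mem h2, iu_of_not_mem (fun h' => h2 h'.1)]; norm_num

theorem ib_diff (B : Bx ι) (a b : ι → ℝ) :
    |ib B a - ib B b| ≤ ∑ j, |iu j (B.I j) (B.oc j) a - iu j (B.I j) (B.oc j) b| := by
  have h0 : 0 ≤ ∑ j, |iu j (B.I j) (B.oc j) a - iu j (B.I j) (B.oc j) b| :=
    Finset.sum_nonneg fun _ _ => abs_nonneg _
  have key : ∀ j, |iu j (B.I j) (B.oc j) a - iu j (B.I j) (B.oc j) b| ≤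
      ∑ j, |iu j (B.I j) (B.oc j) a - iu j (B.I j) (B.oc j) b| := fun j =>
    Finset.single_le_sum (f := fun j => |iu j (B.I j) (B.oc j) a - iu j (B.I j) (B.oc j) b|)
      (fun _ _ => abs_nonneg _) (Finset.mem_univ j)
  by_cases ha : a ∈ B.set <;> by_cases hb : b ∈ B.set
  · rw [ib_of_mem ha, ib_of_mem hb]; simpa using h0
  · rw [ib_of_mem ha, ib_of_not_mem hb]
    have : ∃ j, b j ∉ B.I j := by by_contra h; push Not at h; exact hb h
    obtain ⟨j, hj⟩ := this
    have := key j
    rwa [iu_of_mem (ha j), iu_of_not_mem hj] at this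
  · rw [ib_of_not_mem ha, ib_of_mem hb]
    have : ∃ j, a j ∉ B.I j := by by_contra h; push Not at h; exact ha h
    obtain ⟨j, hj⟩ := this
    have := key j
    rwa [iu_of_mem (hb j), iu_of_not_mem hj] at this
  · rw [ib_of_not_mem ha, ib_of_not_mem hb]; simpa using h0

/-- the first-order bound -/
theorem partA (F : Measure (ι → ℝ)) [IsProbabilityMeasure F] (hs : F.map (fun y => -y) = F)
    (B : Bx ι) (N : ℕ) (z : ι → ℝ) :
    |((km F ^ N * (km F - 1)) • ib B) z| ≤ 4 * Fintype.card ι * √(1 / (N + 1)) := by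
  set u : ι → BM ι := fun j => iu j (up (B.I j)) (up_upper _).ordConnected with hu
  set v : ι → BM ι := fun j => iu j (up (B.I j) \ B.I j) (up_upper' (B.oc j)).ordConnected with hv
  set G : BM ι := ∑ j, (2:ℝ) • (WW F j • (u j + v j)) with hG
  have pt : ∀ w, |((km F - 1) • ib B) w| ≤ G w := by
    intro w
    have i0 : ∀ f : BM ι, Integrable (fun y => |f (w + y) - f w|) F := fun f =>
      ((BM.integrable F measurable_id f w).sub (integrable_const _)).abs
    have e : ((km F - 1) • ib B) w = ∫ y, (ib B (w + y) - ib B w) ∂F := by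
      rw [sub_smul, one_smul, BM.sub_apply, km_apply,
        integral_sub (f := fun y => ib B (w + y)) (g := fun _ => ib B w)
          (BM.integrable F measurable_id (ib B) w) (integrable_const _)]
      simp
    rw [e]
    refine (abs_integral_le_integral_abs).trans ?_
    calc ∫ y, |ib B (w + y) - ib B w| ∂F
        ≤ ∫ y, ∑ j, (|u j (w + y) - u j w| + |v j (w + y) - v j w|) ∂F := by
          refine integral_mono (i0 _) (integrable_finsetSum _ fun j _ => (i0 _).add (i0 _)) fun y => ?_
          refine (ib_diff B _ _).trans (Finset.sum_le_sum fun j _ => ?_)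
          rw [up_dec (B.oc j), up_dec (B.oc j)]
          change |u j (w + y) - v j (w + y) - (u j w - v j w)| ≤ _
          rw [show u j (w + y) - v j (w + y) - (u j w - v j w)
            = (u j (w + y) - u j w) - (v j (w + y) - v j w) by ring]
          exact abs_sub _ _
      _ = ∑ j, (∫ y, |u j (w + y) - u j w| ∂F + ∫ y, |v j (w + y) - v j w| ∂F) := by
          rw [integral_finsetSum (f := fun j y => |u j (w + y) - u j w| + |v j (w + y) - v j w|) _
            fun j _ => (i0 _).add (i0 _)]
          exact Finset.sum_congr rfl fun j _ => integral_add (i0 _) (i0 _)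
      _ ≤ G w := by
          rw [hG, BM.sum_apply]
          refine Finset.sum_le_sum fun j _ => ?_
          rw [smul_add, smul_add, BM.add_apply, BM.smul_apply, BM.smul_apply]
          exact add_le_add (WW_ge F hs j _ (up_upper _) w) (WW_ge F hs j _ (up_upper' (B.oc j)) w)
  have hP := ((Mk.km F).pow N).1
  rw [mul_smul]
  refine (hP.abs_le _ z).trans ((hP.mono (f := ab ((km F - 1) • ib B)) pt z).trans ?_)
  rw [hG, Finset.smul_sum, BM.sum_apply]
  calc ∑ j, (km F ^ N • (2:ℝ) • (WW F j • (u j + v j))) z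
      ≤ ∑ _j : ι, 4 * √(1 / (N + 1)) := by
        refine Finset.sum_le_sum fun j _ => ?_
        rw [smul_comm, BM.smul_apply, ← mul_smul, mul_comm (km F ^ N), smul_add, BM.add_apply]
        have h1 := (WW_bdd F hs j N).abs_le (f := u j) (Q := 1) (iu_abs _ _ _) z
        have h2 := (WW_bdd F hs j N).abs_le (f := v j) (Q := 1) (iu_abs _ _ _) z
        have := le_abs_self (((WW F j * km F ^ N) • u j) z)
        have := le_abs_self (((WW F j * km F ^ N) • v j) z)
        linarith
    _ = _ := by rw [Finset.sum_const, Finset.card_univ, nsmul_eq_mul]; ring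

end
end ZB

open MeasureTheory

namespace ZB

noncomputable section

variable {ι : Type} [Fintype ι] [DecidableEq ι]

/-- locality of an operator -/
def Loc (a : Op ι) (r : ℝ) : Prop := ∀ (f : BM ι) (z : ι → ℝ) (c : ℝ),
  (∀ w : ι → ℝ, (∀ i, |w i - z i| ≤ r) → f w = c) → (a • f) z = c

theorem Loc.one : Loc (1 : Op ι) 0 := by
  intro f z c h
  rw [one_smul]; exact h z (fun i => by simp)

theorem Loc.mul {a b : Op ι} {r s : ℝ} (ha : Loc a r) (hb : Loc b s) : Loc (a * b) (r + s) := by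
  intro f z c h
  rw [mul_smul]
  refine ha _ z c fun w hw => hb f w c fun v hv => h v fun i => ?_
  have := abs_add_le (v i - w i) (w i - z i)
  rw [sub_add_sub_cancel] at this
  linarith [hw i, hv i]

theorem Loc.pow {a : Op ι} {r : ℝ} (ha : Loc a r) (k : ℕ) : Loc (a ^ k) (k * r) := by
  induction k with
  | zero => simpa using Loc.one
  | succ k ih =>
    rw [pow_succ]
    have := ih.mul ha
    rw [show ((k + 1 : ℕ) : ℝ) * r = k * r + r by push_cast; ring]
    exact this

theorem Loc.mono {a : Op ι} {r s : ℝ} (ha : Loc a r) (h : r ≤ s) : Loc a s :=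
  fun f z c hf => ha f z c fun w hw => hf w fun i => (hw i).trans h

theorem Loc.ku {E : Type} [MeasurableSpace E] (μ : Measure E) [IsProbabilityMeasure μ]
    (p : E → ι → ℝ) (hp : Measurable p) {r : ℝ} (h : ∀ᵐ u ∂μ, ∀ i, |p u i| ≤ r) :
    Loc (ku μ p hp) r := by
  intro f z c hf
  rw [ku_apply, integral_congr_ae (g := fun _ => c)]
  · simp
  · filter_upwards [h] with u hu
    exact hf _ fun i => by simpa using hu i

/-- dominated convergence -/
def DC (a : Op ι) : Prop := ∀ (f : ℕ → BM ι) (g : BM ι) (C : ℝ), (∀ n z, |f n z| ≤ C) →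
  (∀ z, Filter.Tendsto (fun n => f n z) Filter.atTop (nhds (g z))) →
  ∀ z, Filter.Tendsto (fun n => (a • f n) z) Filter.atTop (nhds ((a • g) z))

theorem DC.gg_pow (H : Measure (ι → ℝ)) [IsProbabilityMeasure H] (k : ℕ) : DC (gg H ^ k) := by
  induction k with
  | zero => intro f g C _ h z; simpa using h z
  | succ k ih =>
    intro f g C hC h z
    rw [pow_succ]
    simp only [mul_smul]
    refine ih (fun n => gg H • f n) (gg H • g) C (fun n z => (Mk.gg H).abs_le (hC n) z) (fun w => ?_) z
    simp only [gg, km_apply]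
    refine tendsto_integral_of_dominated_convergence (fun _ => C) (fun n => ?_) (integrable_const C)
      (fun n => Filter.Eventually.of_forall fun u => hC n _) (Filter.Eventually.of_forall fun u => h _)
    exact ((f n).meas.comp (measurable_const_add w)).aestronglyMeasurable

/-- enlarged interval -/
def enl (I : Set ℝ) (δ : ℝ) : Set ℝ := {x | ∃ y ∈ I, |x - y| ≤ δ}

theorem enl_oc {I : Set ℝ} (hI : I.OrdConnected) (δ : ℝ) : (enl I δ).OrdConnected := by
  constructor
  rintro a ⟨y, hy, hay⟩ b ⟨y', hy', hby⟩ x ⟨hax, hxb⟩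
  rw [abs_le] at hay hby
  rcases le_total x y with h | h
  · exact ⟨y, hy, by rw [abs_le]; constructor <;> linarith⟩
  · rcases le_total x y' with h' | h'
    · exact ⟨x, hI.out hy hy' ⟨h, h'⟩, by simp; linarith⟩
    · exact ⟨y', hy', by rw [abs_le]; constructor <;> linarith⟩

/-- enlarged box -/
def Bx.enl (B : Bx ι) (δ : ℝ) : Bx ι := ⟨fun i => ZB.enl (B.I i) δ, fun i => enl_oc (B.oc i) δ⟩

/-- uniform measure -/
def uu : Measure ℝ := volume.restrict (Set.Icc (0:ℝ) 1)

instance : IsProbabilityMeasure uu := ⟨by simp [uu]⟩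

/-- perturbation map -/
def pp (ι : Type) (ε : ℝ) : ℝ → ι → ℝ := fun u _ => ε * u

theorem pp_meas (ε : ℝ) : Measurable (pp ι ε) := by
  unfold pp; fun_prop

theorem pt_meas (ε : ℝ) : Measurable (fun q : (ι → ℝ) × ℝ => q.1 + pp ι ε q.2) :=
  measurable_fst.add ((pp_meas ε).comp measurable_snd)

/-- perturbed measure -/
def pert (H : Measure (ι → ℝ)) (ε : ℝ) : Measure (ι → ℝ) :=
  (H.prod uu).map (fun q => q.1 + pp ι ε q.2)

instance (H : Measure (ι → ℝ)) [IsProbabilityMeasure H] (ε : ℝ) : IsProbabilityMeasure (pert H ε) :=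
  Measure.isProbabilityMeasure_map (pt_meas ε).aemeasurable

theorem uu_ae : ∀ᵐ u ∂uu, |u| ≤ 1 := by
  unfold uu
  filter_upwards [ae_restrict_mem measurableSet_Icc] with u hu
  rw [abs_le]; constructor <;> linarith [hu.1, hu.2]

theorem pert_nice (H : Measure (ι → ℝ)) [IsProbabilityMeasure H]
    (hb : ∃ B, ∀ᵐ x ∂H, ∀ i, |x i| ≤ B) {ε : ℝ} (hε : 0 < ε) : Nice (pert H ε) := by
  constructor
  · obtain ⟨B, hB⟩ := hb
    refine ⟨B + ε, ?_⟩
    rw [pert, ae_map_iff (pt_meas ε).aemeasurable]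
    · have h1 : ∀ᵐ q ∂(H.prod uu), ∀ i, |q.1 i| ≤ B := Measure.quasiMeasurePreserving_fst.ae hB
      have h2 : ∀ᵐ q ∂(H.prod uu), |q.2| ≤ 1 := Measure.quasiMeasurePreserving_snd.ae uu_ae
      filter_upwards [h1, h2] with q h1 h2 i
      have : |ε * q.2| ≤ ε := by
        rw [abs_mul, abs_of_pos hε]; nlinarith
      exact (abs_add_le _ _).trans (add_le_add (h1 i) this)
    · have : {y : ι → ℝ | ∀ i, |y i| ≤ B + ε} = ⋂ i, {y | |y i| ≤ B + ε} := by ext; simp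
      rw [this]
      exact MeasurableSet.iInter fun i =>
        measurableSet_le (measurable_pi_apply i).abs measurable_const
  · intro i c
    have hm : MeasurableSet {x : ι → ℝ | x i = c} :=
      measurableSet_eq_fun (measurable_pi_apply i) measurable_const
    rw [pert, Measure.map_apply (pt_meas ε) hm,
      Measure.measure_prod_null ((pt_meas ε) hm)]
    refine Filter.Eventually.of_forall fun x => ?_
    have : (Prod.mk x ⁻¹' ((fun q : (ι → ℝ) × ℝ => q.1 + pp ι ε q.2) ⁻¹' {x | x i = c}))
        ⊆ {(c - x i) / ε} := by
      intro u hu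
      have hu' : x i + ε * u = c := hu
      rw [Set.mem_singleton_iff, eq_div_iff hε.ne']; linarith
    refine measure_mono_null this ?_
    unfold uu
    exact (Measure.restrict_le_self.absolutelyContinuous) (by simp)

theorem pert_gg (H : Measure (ι → ℝ)) [IsProbabilityMeasure H] (ε : ℝ) :
    gg (pert H ε) = gg H * (ku uu (pp ι ε) (pp_meas ε) * ku uu (fun u => - pp ι ε u) (pp_meas ε).neg) := by
  have h1 : km (pert H ε) = km H * ku uu (pp ι ε) (pp_meas ε) := by
    have : km H * ku uu (pp ι ε) (pp_meas ε) = _ :=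
      ker_mul (hm'' := by fun_prop) (hw'' := by simp) (μ := H) (ν := uu) (p := id)
        (p' := pp ι ε) ..
    rw [this]
    apply Op.ext
    intro f z
    rw [km_apply, ker_apply, pert, integral_map (pt_meas ε).aemeasurable
      (f := fun u => f (z + u)) (f.meas.comp (measurable_const_add z)).aestronglyMeasurable]
    simp
  have h2 : kr (pert H ε) = kr H * ku uu (fun u => - pp ι ε u) (pp_meas ε).neg := by
    have : ku H (fun x => -x) meas_neg * ku uu (fun u => - pp ι ε u) (pp_meas ε).neg = _ :=
      ker_mul (hm'' := by fun_prop) (hw'' := by simp) (μ := H) (ν := uu) (p := fun x : ι → ℝ => -x)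
        (p' := fun u => - pp ι ε u) ..
    unfold kr
    rw [this]
    apply Op.ext
    intro f z
    rw [ku_apply, ker_apply, pert, integral_map (pt_meas ε).aemeasurable
      (f := fun u => f (z + -u)) (f.meas.comp ((meas_neg).const_add z)).aestronglyMeasurable]
    simp only [neg_add, one_mul]
  rw [gg_eq, gg_eq, h1, h2]; ring

theorem enl_tendsto {B : Bx ι} (hB : ∀ i, IsClosed (B.I i)) {a : ℕ → Op ι} {δ : ℕ → ℝ}
    (hδ0 : Filter.Tendsto δ Filter.atTop (nhds 0)) (ha : ∀ n, Loc (a n) (δ n)) (w : ι → ℝ) :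
    Filter.Tendsto (fun n => (a n • ib (B.enl (δ n))) w) Filter.atTop (nhds (ib B w)) := by
  by_cases hw : w ∈ B.set
  · rw [ib_of_mem hw]
    refine tendsto_const_nhds.congr fun n => ?_
    symm
    refine ha n _ w 1 fun v hv => ib_of_mem fun i => ⟨w i, hw i, hv i⟩
  · rw [ib_of_not_mem hw]
    have : ∃ j, w j ∉ B.I j := by by_contra h; push Not at h; exact hw h
    obtain ⟨j, hj⟩ := this
    obtain ⟨r, hr, hrj⟩ := Metric.isOpen_iff.1 (hB j).isOpen_compl (w j) hj
    refine tendsto_const_nhds.congr' ?_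
    filter_upwards [hδ0.eventually (gt_mem_nhds (show (0:ℝ) < r / 2 by positivity))] with n hn
    symm
    refine ha n _ w 0 fun v hv => ib_of_not_mem fun hvB => ?_
    obtain ⟨y, hy, hvy⟩ := hvB j
    refine hrj ?_ hy
    rw [Metric.mem_ball, Real.dist_eq]
    have h1 := hv j
    rw [abs_le] at h1 hvy
    rw [abs_lt]; constructor <;> linarith

theorem HKb {K : ℝ} (hK : ∀ N, HK ι K N) (H : Measure (ι → ℝ)) [IsProbabilityMeasure H]
    (hb : ∃ B, ∀ᵐ x ∂H, ∀ i, |x i| ≤ B) (B : Bx ι) (hB : ∀ i, IsClosed (B.I i)) (k : ℕ) (z : ι → ℝ) :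
    |((gg H ^ k * AA H) • ib B) z| ≤ K / (k + 1) := by
  set δ : ℕ → ℝ := fun n => 1 / ((n : ℝ) + 1) with hδ
  set ε : ℕ → ℝ := fun n => δ n / (2 * (k + 1)) with hε
  have hδp : ∀ n, 0 < δ n := fun n => by positivity
  have hεp : ∀ n, 0 < ε n := fun n => by have := hδp n; positivity
  have hδ0 : Filter.Tendsto δ Filter.atTop (nhds 0) := tendsto_one_div_add_atTop_nhds_zero_nat
  set s : ℕ → Op ι := fun n => ku uu (pp ι (ε n)) (pp_meas (ε n)) *
    ku uu (fun u => - pp ι (ε n) u) (pp_meas (ε n)).neg with hs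
  have hpp : ∀ n, ∀ᵐ u ∂uu, ∀ i : ι, |pp ι (ε n) u i| ≤ ε n := by
    intro n
    filter_upwards [uu_ae] with u hu i
    have := hεp n
    unfold pp
    rw [abs_mul, abs_of_pos this]; nlinarith
  have hsM : ∀ n, Mk (s n) := fun n => (Mk.ku _ _ _).mul (Mk.ku _ _ _)
  have hsL : ∀ n, Loc (s n) (2 * ε n) := by
    intro n
    have := (Loc.ku uu (pp ι (ε n)) (pp_meas (ε n)) (hpp n)).mul
      (Loc.ku uu (fun u => - pp ι (ε n) u) (pp_meas (ε n)).neg (r := ε n) (by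
        filter_upwards [hpp n] with u hu i
        simpa using hu i))
    exact this.mono (by linarith)
  have hL : ∀ l ≤ k + 1, ∀ n, Loc (s n ^ l) (δ n) := by
    intro l hl n
    refine ((hsL n).pow l).mono ?_
    have h1 : δ n = (k + 1) * (2 * ε n) := by rw [hε]; field_simp
    rw [h1]
    have := hεp n
    have : (l : ℝ) ≤ k + 1 := by exact_mod_cast hl
    gcongr
  have hlim : ∀ l ≤ k + 1, Filter.Tendsto (fun n => (gg H ^ l • (s n ^ l • ib (B.enl (δ n)))) z)
      Filter.atTop (nhds ((gg H ^ l • ib B) z)) := by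
    intro l hl
    refine DC.gg_pow H l _ _ 1 (fun n w => ((hsM n).pow l).abs_le (fun w => ?_) w)
      (fun w => enl_tendsto hB hδ0 (hL l hl) w) z
    rw [abs_of_nonneg (ib_nonneg _ _)]; exact ib_le_one _ _
  have hl := ((hlim k (by omega)).sub (hlim (k + 1) le_rfl)).abs
  have e1 : ((gg H ^ k * AA H) • ib B) z = (gg H ^ k • ib B) z - (gg H ^ (k + 1) • ib B) z := by
    rw [AA, mul_sub, mul_one, ← pow_succ, sub_smul, BM.sub_apply]
  rw [e1]
  refine le_of_tendsto hl (Filter.Eventually.of_forall fun n => ?_)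
  have h := hK k (pert H (ε n)) (pert_nice H hb (hεp n)) (B.enl (δ n)) k le_rfl z
  have e2 : ((gg (pert H (ε n)) ^ k * AA (pert H (ε n))) • ib (B.enl (δ n))) z =
      (gg H ^ k • (s n ^ k • ib (B.enl (δ n)))) z
        - (gg H ^ (k + 1) • (s n ^ (k + 1) • ib (B.enl (δ n)))) z := by
    have hpg : gg (pert H (ε n)) = gg H * s n := pert_gg H (ε n)
    rw [AA, mul_sub, mul_one, ← pow_succ, sub_smul, BM.sub_apply, hpg, mul_pow (gg H) (s n) k,
      mul_pow (gg H) (s n) (k + 1), mul_smul (gg H ^ k), mul_smul (gg H ^ (k + 1))]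
  rw [e2] at h
  exact h

theorem Bdd_pow_diff {a b : Op ι} (ha : Mk a) (hb : Mk b) {e : ℝ} (h : Bdd (a - b) e) (k : ℕ) :
    Bdd (a ^ k - b ^ k) (k * e) := by
  induction k with
  | zero => simpa using Bdd.zero
  | succ k ih =>
    have e1 : a ^ (k + 1) - b ^ (k + 1) = a ^ k * (a - b) + (a ^ k - b ^ k) * b := by ring
    rw [e1]
    refine (((ha.pow k).Bdd.mul h).add (ih.mul hb.Bdd)).mono ?_
    push_cast; linarith

theorem HKg {K : ℝ} (hK : ∀ N, HK ι K N) (H : Measure (ι → ℝ)) [IsProbabilityMeasure H]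
    (B : Bx ι) (hB : ∀ i, IsClosed (B.I i)) (k : ℕ) (z : ι → ℝ) :
    |((gg H ^ k * AA H) • ib B) z| ≤ K / (k + 1) := by
  set s : ℕ → Set (ι → ℝ) := fun R => {x | ∀ i, |x i| ≤ R} with hs
  have hsm : ∀ R, MeasurableSet (s R) := by
    intro R
    have : s R = ⋂ i, {y : ι → ℝ | |y i| ≤ (R : ℝ)} := by ext; simp [hs]
    rw [this]
    exact MeasurableSet.iInter fun i =>
      measurableSet_le (measurable_pi_apply i).abs measurable_const
  have hmono : Monotone s := fun R R' h x hx i => (hx i).trans (by exact_mod_cast h)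
  have hun : ⋃ R, s R = Set.univ := by
    ext x
    simp only [Set.mem_iUnion, Set.mem_univ, iff_true]
    obtain ⟨R, hR⟩ := exists_nat_ge (∑ i, |x i|)
    exact ⟨R, fun i => (Finset.single_le_sum (f := fun i => |x i|) (fun _ _ => abs_nonneg _)
      (Finset.mem_univ i)).trans hR⟩
  have hlim : Filter.Tendsto (fun R => H.real (s R)) Filter.atTop (nhds 1) := by
    have := tendsto_measure_iUnion_atTop (μ := H) hmono
    rw [hun, measure_univ] at this
    have h2 := (ENNReal.tendsto_toReal ENNReal.one_ne_top).comp this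
    simpa [measureReal_def, Function.comp_def] using h2
  have hl2 : Filter.Tendsto (fun R => K / (k + 1) + (2 * k + 1) * (4 * (1 - H.real (s R)))) Filter.atTop
      (nhds (K / (k + 1) + (2 * k + 1) * (4 * (1 - 1)))) :=
    (((hlim.const_sub 1).const_mul 4).const_mul _).const_add _
  have : K / ((k:ℝ) + 1) + (2 * k + 1) * (4 * (1 - 1)) = K / (k + 1) := by ring
  rw [this] at hl2
  refine ge_of_tendsto hl2 ?_
  filter_upwards [hlim.eventually (lt_mem_nhds (show (0:ℝ) < 1 by norm_num))] with R hR
  obtain ⟨Hs, _, hC, hae, _⟩ := cnd H (hsm R) hR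
  have h1 := HKb hK Hs ⟨R, hae⟩ B hB k z
  have hd : Bdd (gg H - gg Hs) (4 * (1 - H.real (s R))) := by
    have := hC.diff.neg
    rw [show -(AA H - AA Hs) = gg H - gg Hs by simp only [AA]; ring] at this
    exact this
  have hk := Bdd_pow_diff (Mk.gg H) (Mk.gg Hs) hd k
  have hk1 := Bdd_pow_diff (Mk.gg H) (Mk.gg Hs) hd (k + 1)
  have h2 := (hk.sub hk1).abs_le (f := ib B) (Q := 1) (fun w => by
    rw [abs_of_nonneg (ib_nonneg _ _)]; exact ib_le_one _ _) z
  have e : gg H ^ k * AA H = gg Hs ^ k * AA Hs + (gg H ^ k - gg Hs ^ k - (gg H ^ (k + 1) - gg Hs ^ (k + 1))) := by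
    simp only [AA]; ring
  rw [e, add_smul, BM.add_apply]
  refine (abs_add_le _ _).trans (add_le_add h1 (h2.trans (le_of_eq ?_)))
  push_cast; ring

end
end ZB

open MeasureTheory RealInnerProductSpace

namespace ZB

noncomputable section

variable {ι : Type} [Fintype ι] [DecidableEq ι]

theorem kr_symm (F : Measure (ι → ℝ)) [IsProbabilityMeasure F] (hs : F.map (fun y => -y) = F) :
    kr F = km F := by
  apply Op.ext
  intro f z
  rw [kr, ku_apply, km_apply]
  exact integral_symm hs (f := fun u => f (z + u)) (f.meas.comp (measurable_const_add z))

theorem gg_symm (F : Measure (ι → ℝ)) [IsProbabilityMeasure F] (hs : F.map (fun y => -y) = F) :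
    gg F = km F ^ 2 := by
  rw [gg_eq, kr_symm F hs, sq]

theorem partB {K : ℝ} (hK0 : 0 ≤ K) (hK : ∀ N, HK ι K N) (F : Measure (ι → ℝ))
    [IsProbabilityMeasure F] (hs : F.map (fun y => -y) = F)
    (B : Bx ι) (hB : ∀ i, IsClosed (B.I i)) (n : ℕ) (z : ι → ℝ) :
    |(km F ^ (n + 2) • ib B) z - (km F ^ n • ib B) z| ≤ 2 * K / (n + 1) := by
  have key : ∀ q : ℕ, ∀ z, |((km F ^ (2 * q) * (1 - km F ^ 2)) • ib B) z| ≤ K / (q + 1) := by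
    intro q z
    have := HKg hK F B hB q z
    rwa [AA, gg_symm F hs, ← pow_mul] at this
  rw [abs_sub_comm, ← BM.sub_apply, ← sub_smul]
  rcases Nat.even_or_odd' n with ⟨q, rfl | rfl⟩
  · have e : km F ^ (2 * q) - km F ^ (2 * q + 2) = km F ^ (2 * q) * (1 - km F ^ 2) := by ring
    rw [e]
    refine (key q z).trans ?_
    rw [div_le_div_iff₀ (by positivity) (by positivity)]
    push_cast
    nlinarith
  · have e : km F ^ (2 * q + 1) - km F ^ (2 * q + 1 + 2)
      = km F * (km F ^ (2 * q) * (1 - km F ^ 2)) := by ring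
    rw [e, mul_smul]
    refine ((Mk.km F).abs_le (key q) z).trans (le_of_eq ?_)
    push_cast
    field_simp
    ring

theorem seq_bound {a : ℕ → ℝ} {M D : ℝ} (hM : 0 ≤ M) (hD : 0 ≤ D) (h0 : ∀ k n, |a k - a n| ≤ 1)
    (h1 : ∀ n : ℕ, |a (n + 1) - a n| ≤ 4 * M / √(n + 1))
    (h2 : ∀ n : ℕ, |a (n + 2) - a n| ≤ D / (n + 1)) (k n : ℕ) :
    |a k - a n| ≤ min (8 * M / √(n + 1) + (D + 2) * |(k : ℝ) - n| / (n + 1)) 1 := by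
  refine le_min ?_ (h0 k n)
  have hst : ∀ n q : ℕ, |a (n + 2 * q) - a n| ≤ q * (D / (n + 1)) := by
    intro n q
    induction q with
    | zero => simp
    | succ q ih =>
      have e := h2 (n + 2 * q)
      have e2 : D / (((n + 2 * q : ℕ) : ℝ) + 1) ≤ D / (n + 1) := by
        push_cast; gcongr; linarith [Nat.cast_nonneg (α := ℝ) q]
      have := abs_add_le (a (n + 2 * q + 2) - a (n + 2 * q)) (a (n + 2 * q) - a n)
      rw [sub_add_sub_cancel] at this
      rw [show n + 2 * (q + 1) = n + 2 * q + 2 by ring]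
      push_cast
      linarith
  have hgen : ∀ n k : ℕ, n ≤ k → |a k - a n| ≤ 4 * M / √(n + 1) + D * ((k : ℝ) - n) / (2 * (n + 1)) := by
    intro n k hnk
    obtain ⟨r, rfl⟩ := Nat.exists_eq_add_of_le hnk
    rcases Nat.even_or_odd' r with ⟨q, rfl | rfl⟩
    · refine (hst n q).trans ?_
      have : (q : ℝ) * (D / (n + 1)) = D * (((n + 2 * q : ℕ) : ℝ) - n) / (2 * (n + 1)) := by
        push_cast; field_simp; ring
      rw [this]
      have : 0 ≤ 4 * M / √((n:ℝ) + 1) := by positivity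
      linarith
    · have e := hst (n + 1) q
      have e2 : (q:ℝ) * (D / (((n + 1 : ℕ) : ℝ) + 1)) ≤ q * (D / (n + 1)) := by
        push_cast; gcongr; linarith
      have := abs_add_le (a (n + 1 + 2 * q) - a (n + 1)) (a (n + 1) - a n)
      rw [sub_add_sub_cancel] at this
      rw [show n + (2 * q + 1) = n + 1 + 2 * q by ring]
      have e3 : (q : ℝ) * (D / (n + 1)) ≤ D * (((n + 1 + 2 * q : ℕ) : ℝ) - n) / (2 * (n + 1)) := by
        have : D * (((n + 1 + 2 * q : ℕ) : ℝ) - n) / (2 * (n + 1))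
          = q * (D / (n + 1)) + D / (2 * (n + 1)) := by
          push_cast; field_simp; ring
        rw [this]
        have : 0 ≤ D / (2 * ((n:ℝ) + 1)) := by positivity
        linarith
      linarith [h1 n]
  have hn1 : (0:ℝ) < n + 1 := by positivity
  rcases le_total n k with h | h
  · have hc : (n : ℝ) ≤ k := by exact_mod_cast h
    rw [abs_of_nonneg (sub_nonneg.2 hc)]
    refine (hgen n k h).trans (add_le_add ?_ ?_)
    · gcongr; norm_num
    · rw [div_le_div_iff₀ (by positivity) hn1]
      have : 0 ≤ ((k:ℝ) - n) * (n + 1) := mul_nonneg (by linarith) hn1.le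
      nlinarith
  · have hc : (k : ℝ) ≤ n := by exact_mod_cast h
    have hk1 : (0:ℝ) < k + 1 := by positivity
    rw [abs_sub_comm (k : ℝ), abs_of_nonneg (sub_nonneg.2 hc)]
    rcases lt_or_ge (2 * k) n with h3 | h3
    · have h4 : (2 * k + 1 : ℝ) ≤ n := by exact_mod_cast h3
      refine (h0 k n).trans ?_
      have h5 : 1 ≤ (D + 2) * ((n : ℝ) - k) / (n + 1) := by
        rw [le_div_iff₀ hn1]
        have : 0 ≤ D * ((n:ℝ) - k) := mul_nonneg hD (by linarith)
        nlinarith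
      have : 0 ≤ 8 * M / √((n:ℝ) + 1) := by positivity
      linarith
    · have h4 : (n : ℝ) ≤ 2 * k := by exact_mod_cast h3
      rw [abs_sub_comm]
      refine (hgen k n h).trans (add_le_add ?_ ?_)
      · rw [div_le_div_iff₀ (by positivity) (by positivity)]
        have : √((n:ℝ) + 1) ≤ 2 * √((k:ℝ) + 1) := by
          rw [show (2:ℝ) * √((k:ℝ) + 1) = √(4 * ((k:ℝ) + 1)) by
            rw [Real.sqrt_mul (by norm_num), show (4:ℝ) = 2 ^ 2 by norm_num,
              Real.sqrt_sq (by norm_num)]]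
          exact Real.sqrt_le_sqrt (by linarith)
        have := mul_le_mul_of_nonneg_left this (show 0 ≤ 4 * M by positivity)
        linarith
      · rw [div_le_div_iff₀ (by positivity) hn1]
        have h5 : 0 ≤ (n:ℝ) - k := by linarith
        have h6 : D * ((n:ℝ) - k) ≤ (D + 2) * ((n:ℝ) - k) := by nlinarith
        exact mul_le_mul h6 (by linarith) hn1.le (by positivity)

section push
variable {d m : ℕ}

instance convPow_prob (F : Measure (Euc d)) [IsProbabilityMeasure F] (k : ℕ) :
    IsProbabilityMeasure (convPow F k) := by
  induction k with
  | zero => unfold convPow; infer_instance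
  | succ k ih =>
    unfold convPow mconv
    exact Measure.isProbabilityMeasure_map (by fun_prop)

/-- coordinates -/
def TT (t : Fin m → Euc d) : Euc d → Fin m → ℝ := fun x j => ⟪x, t j⟫

theorem TT_meas (t : Fin m → Euc d) : Measurable (TT t) := by
  unfold TT
  exact measurable_pi_lambda _ fun j => (continuous_id.inner continuous_const).measurable

theorem TT_add (t : Fin m → Euc d) (x y : Euc d) : TT t (x + y) = TT t x + TT t y := by
  ext j; simp [TT, inner_add_left]

theorem TT_neg (t : Fin m → Euc d) (x : Euc d) : TT t (-x) = - TT t x := by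
  ext j; simp [TT]

instance TT_prob (F : Measure (Euc d)) [IsProbabilityMeasure F] (t : Fin m → Euc d) :
    IsProbabilityMeasure (F.map (TT t)) := Measure.isProbabilityMeasure_map (TT_meas t).aemeasurable

theorem conv_km (F : Measure (Euc d)) [IsProbabilityMeasure F] (t : Fin m → Euc d) (k : ℕ)
    (f : BM (Fin m)) (z : Fin m → ℝ) :
    ∫ x, f (z + TT t x) ∂(convPow F k) = (km (F.map (TT t)) ^ k • f) z := by
  induction k generalizing f z with
  | zero =>
    have : TT t 0 = 0 := by ext j; simp [TT]
    rw [pow_zero, one_smul, convPow, integral_dirac, this, add_zero]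
  | succ k ih =>
    have hm : Measurable fun x => f (z + TT t x) := f.meas.comp ((TT_meas t).const_add z)
    rw [pow_succ, mul_smul, ← ih, convPow, mconv, integral_map (by fun_prop)
      hm.aestronglyMeasurable, integral_prod]
    · congr 1; ext x
      rw [km_apply, integral_map (TT_meas t).aemeasurable
        (f := fun u => f (z + TT t x + u)) (f.meas.comp (measurable_const_add _)).aestronglyMeasurable]
      simp only [TT_add, add_assoc]
    · obtain ⟨C, _, hC⟩ := f.bdd
      refine Integrable.of_bound (hm.comp (measurable_fst.add measurable_snd)).aestronglyMeasurable C
        (Filter.Eventually.of_forall fun q => hC _)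

theorem poly_bound {K : ℝ} (hK0 : 0 ≤ K) (hK : ∀ N, HK (Fin m) K N)
    (F : Measure (Euc d)) [IsProbabilityMeasure F] (hs : IsSymmMeasure F)
    {X : Set (Euc d)} (hX : X ∈ polyhedra d m) : MeasurableSet X ∧ ∀ k n : ℕ,
    |(convPow F k X).toReal - (convPow F n X).toReal|
      ≤ min (8 * m / √(n + 1) + (2 * K + 2) * |(k : ℝ) - n| / (n + 1)) 1 := by
  obtain ⟨t, a, b, rfl⟩ := hX
  set B : Bx (Fin m) := ⟨fun j => {x : ℝ | a j ≤ (x : EReal) ∧ (x : EReal) ≤ b j}, fun j =>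
    ⟨fun x hx y hy z hz => ⟨hx.1.trans (EReal.coe_le_coe_iff.2 hz.1),
      (EReal.coe_le_coe_iff.2 hz.2).trans hy.2⟩⟩⟩ with hBdef
  have hB : ∀ j, IsClosed (B.I j) := fun j =>
    (isClosed_le continuous_const continuous_coe_real_ereal).inter
      (isClosed_le continuous_coe_real_ereal continuous_const)
  have hXB : {x : Euc d | ∀ j, a j ≤ ((⟪x, t j⟫ : ℝ) : EReal) ∧ ((⟪x, t j⟫ : ℝ) : EReal) ≤ b j}
    = TT t ⁻¹' B.set := rfl
  rw [hXB]
  have hm := TT_meas t B.meas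
  refine ⟨hm, ?_⟩
  set F' := F.map (TT t) with hF'
  have hs' : F'.map (fun y => -y) = F' := by
    rw [hF', Measure.map_map meas_neg (TT_meas t)]
    conv_rhs => rw [← show F.map (fun x => -x) = F from hs]
    rw [Measure.map_map (TT_meas t) measurable_neg]
    congr 1
    ext x : 1
    exact (TT_neg t x).symm
  have hval : ∀ k, (convPow F k (TT t ⁻¹' B.set)).toReal = (km F' ^ k • ib B) 0 := by
    intro k
    rw [← conv_km]
    have : ∀ x, ib B (0 + TT t x) = (TT t ⁻¹' B.set).indicator (fun _ => (1:ℝ)) x := by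
      intro x
      rw [zero_add]
      by_cases h : TT t x ∈ B.set
      · rw [ib_of_mem h, Set.indicator_of_mem (show x ∈ TT t ⁻¹' B.set from h)]
      · rw [ib_of_not_mem h, Set.indicator_of_notMem (show x ∉ TT t ⁻¹' B.set from h)]
    simp only [this]
    rw [integral_indicator hm]
    simp [measureReal_def]
  intro k n
  rw [hval, hval]
  refine seq_bound (a := fun k => (km F' ^ k • ib B) 0) (Nat.cast_nonneg m) (by positivity) ?_ ?_ ?_ k n
  · intro k n
    have r : ∀ k, 0 ≤ (km F' ^ k • ib B) 0 ∧ (km F' ^ k • ib B) 0 ≤ 1 := fun k =>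
      ⟨((Mk.km F').pow k).1 _ (ib_nonneg B) 0, ((Mk.km F').pow k).le_const (ib_le_one B) 0⟩
    have h1 := r k
    have h2 := r n
    rw [abs_le]; constructor <;> linarith [h1.1, h1.2, h2.1, h2.2]
  · intro n
    have := partA F' hs' B n 0
    rw [mul_sub, mul_one, ← pow_succ, sub_smul, BM.sub_apply, Fintype.card_fin,
      Real.sqrt_div (by norm_num), Real.sqrt_one, mul_one_div] at this
    exact this
  · intro n
    exact partB hK0 hK F' hs' B hB n 0

end push

theorem mix_eq {d : ℕ} (F : Measure (Euc d)) [IsProbabilityMeasure F] {Ω : Type} [MeasurableSpace Ω]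
    (P : Measure Ω) [IsProbabilityMeasure P] {μ : Ω → ℕ} (hμ : Measurable μ) {X : Set (Euc d)}
    (hX : MeasurableSet X) :
    ((Measure.sum fun k => P {ω | μ ω = k} • convPow F k) X).toReal
      = ∫ ω, (convPow F (μ ω) X).toReal ∂P := by
  have hm : Measurable fun k : ℕ => convPow F k X := measurable_of_countable _
  rw [Measure.sum_apply _ hX, integral_toReal (f := fun ω => convPow F (μ ω) X) (hm.comp hμ).aemeasurable
    (Filter.Eventually.of_forall fun ω => measure_lt_top _ _),
    ← lintegral_map (f := fun k => convPow F k X) hm hμ, lintegral_countable']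
  congr 1
  refine tsum_congr fun k => ?_
  rw [Measure.map_apply hμ (measurableSet_singleton k), Measure.smul_apply, smul_eq_mul, mul_comm]
  rfl

end
end ZB

theorem stmt14 :
    ∃ c : ℝ, 0 < c ∧ ∃ C : ℕ → ℝ, (∀ m, 0 < C m) ∧
      ∀ (d m : ℕ), 0 < d → 0 < m →
        ∀ F : Measure (Euc d), IsProbabilityMeasure F → IsSymmMeasure F →
          ∀ (Ω : Type) (_ : MeasurableSpace Ω) (P : Measure Ω), IsProbabilityMeasure P →
            ∀ μ ν : Ω → ℕ, Measurable μ → Measurable ν →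
              rhoPoly m (Measure.sum fun k => P {ω | μ ω = k} • convPow F k)
                  (Measure.sum fun k => P {ω | ν ω = k} • convPow F k) ≤
                ∫ ω, min (c * m / Real.sqrt (ν ω + 1) +
                    C m * |(μ ω : ℝ) - (ν ω : ℝ)| / ((ν ω : ℝ) + 1)) 1 ∂P := by
  have hex : ∀ m : ℕ, ∃ K : ℝ, 0 ≤ K ∧ (0 < m → ∀ N, ZB.HK (Fin m) K N) := by
    intro m
    rcases Nat.eq_zero_or_pos m with h | h
    · exact ⟨0, le_rfl, fun h' => by omega⟩
    · obtain ⟨K, hK0, hK⟩ := ZB.HK_all m h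
      exact ⟨K, hK0, fun _ => hK (Fin m) (Fintype.card_fin m)⟩
  choose K hK0 hK using hex
  refine ⟨8, by norm_num, fun m => 2 * K m + 2, fun m => by have := hK0 m; positivity, ?_⟩
  intro d m _ hm F hF hs Ω _ P hP μ ν hμ hν
  have hC : 0 ≤ 2 * K m + 2 := by have := hK0 m; positivity
  set R : ℕ × ℕ → ℝ := fun q => min (8 * m / Real.sqrt (q.2 + 1) +
    (2 * K m + 2) * |(q.1 : ℝ) - (q.2 : ℝ)| / ((q.2 : ℝ) + 1)) 1 with hR
  have hR0 : ∀ q, 0 ≤ R q := fun q => le_min (by positivity) (by norm_num)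
  have hRi : Integrable (fun ω => R (μ ω, ν ω)) P := by
    refine Integrable.of_bound
      ((measurable_of_countable R).comp (hμ.prodMk hν)).aestronglyMeasurable 1
      (Filter.Eventually.of_forall fun ω => ?_)
    rw [Real.norm_eq_abs, abs_of_nonneg (hR0 _)]
    exact min_le_right _ _
  have hI0 : 0 ≤ ∫ ω, R (μ ω, ν ω) ∂P := integral_nonneg fun ω => hR0 _
  change _ ≤ ∫ ω, R (μ ω, ν ω) ∂P
  unfold rhoPoly
  refine Real.iSup_le (fun X => Real.iSup_le (fun hX => ?_) hI0) hI0
  obtain ⟨hXm, hb⟩ := ZB.poly_bound (hK0 m) (hK m hm) F hs hX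
  rw [ZB.mix_eq F P hμ hXm, ZB.mix_eq F P hν hXm]
  have hi : ∀ κ : Ω → ℕ, Measurable κ → Integrable (fun ω => (convPow F (κ ω) X).toReal) P := by
    intro κ hκ
    refine Integrable.of_bound
      ((measurable_of_countable fun k : ℕ => (convPow F k X).toReal).comp hκ).aestronglyMeasurable 1
      (Filter.Eventually.of_forall fun ω => ?_)
    rw [Real.norm_eq_abs, abs_of_nonneg ENNReal.toReal_nonneg]
    exact measureReal_le_one
  rw [← integral_sub (hi μ hμ) (hi ν hν)]
  refine abs_integral_le_integral_abs.trans (integral_mono ((hi μ hμ).sub (hi ν hν)).abs hRi ?_)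
  intro ω
  exact hb (μ ω) (ν ω)
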